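/- arXiv:2312.14205 — 2 statements merged into one kernel-verified Lean document; each statement's English description precedes it below -/
import Mathlib

section
/- For Bernoulli bond percolation on ℤ² with parameter p: if p < 1/2, then almost surely there is no infinite cluster; if p > 1/2, then almost surely there exists a unique infinite cluster. -/
open MeasureTheory Set
open scoped ENNReal

noncomputable section

/-- Two vertices of `ℤ²` are adjacent if they are at Euclidean distance `1`. -/
def LatticeAdj (a b : ℤ × ℤ) : Prop :=
  (a.1 - b.1).natAbs + (a.2 - b.2).natAbs = 1

/-- An edge of the nearest-neighbour lattice `ℤ²`. -/
def IsLatticeEdge (e : Sym2 (ℤ × ℤ)) : Prop :=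
  ∃ a b : ℤ × ℤ, LatticeAdj a b ∧ e = s(a, b)

abbrev LatticeEdge := {e : Sym2 (ℤ × ℤ) // IsLatticeEdge e}

/-- A percolation configuration: each edge is open (`true`) or closed (`false`). -/
abbrev Config := LatticeEdge → Bool

/-- `ω`-open adjacency: `a` and `b` are neighbours joined by an open edge. -/
def OpenAdj (ω : Config) (a b : ℤ × ℤ) : Prop :=
  ∃ e : LatticeEdge, e.1 = s(a, b) ∧ ω e = true

/-- `a` and `b` lie in the same open cluster. -/
def ConnectedIn (ω : Config) (a b : ℤ × ℤ) : Prop :=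
  Relation.ReflTransGen (OpenAdj ω) a b

/-- The open cluster of a vertex. -/
def cluster (ω : Config) (a : ℤ × ℤ) : Set (ℤ × ℤ) := {b | ConnectedIn ω a b}

/-- `P` is the Bernoulli bond percolation measure with parameter `p`: the states of the
edges are independent, each open with probability `p`. -/
def IsBernoulliPercolation (P : Measure Config) (p : ℝ) : Prop :=
  ∀ (s : Finset LatticeEdge) (g : Config),
    P {ω | ∀ e ∈ s, ω e = g e} = ∏ e ∈ s, ENNReal.ofReal (if g e then p else 1 - p)

section BernoulliMeasure

/-! ### Bernoulli measures on bond configurations -/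

/-- The bonds of `ℤ²`: `(v, false)` joins `v` to `v + (1, 0)`, and `(v, true)` joins `v` to
`v + (0, 1)`. -/
abbrev Bond := (ℤ × ℤ) × Bool

/-- A bond configuration: each bond is open (`true`) or closed (`false`). -/
abbrev BondConfig := Bond → Bool

/-- The Bernoulli law on `Bool` with parameter `p`, clamped to `[0, 1]`. -/
def bitLaw (p : ℝ) : Measure Bool :=
  ENNReal.ofReal (max 0 (min p 1)) • Measure.dirac true +
    ENNReal.ofReal (1 - max 0 (min p 1)) • Measure.dirac false

instance (p : ℝ) : IsProbabilityMeasure (bitLaw p) := by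
  constructor
  simp only [bitLaw, Measure.add_apply, Measure.smul_apply, measure_univ, smul_eq_mul, mul_one]
  rw [← ENNReal.ofReal_add (by simp) (by simp)]
  simp

/-- The product Bernoulli measure with parameter `p` on bond configurations. -/
def perc (p : ℝ) : Measure BondConfig := Measure.infinitePi fun _ => bitLaw p

instance (p : ℝ) : IsProbabilityMeasure (perc p) := by unfold perc; infer_instance

/-- The probability that a Bernoulli bit with parameter `p` equals `b`. -/
def bitWeight (p : ℝ) (b : Bool) : ℝ := if b then p else 1 - p

theorem bitLaw_singleton {p : ℝ} (hp : p ∈ Icc (0 : ℝ) 1) (b : Bool) :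
    bitLaw p {b} = ENNReal.ofReal (bitWeight p b) := by
  have : max 0 (min p 1) = p := by rw [min_eq_left hp.2, max_eq_right hp.1]
  cases b <;> simp [bitLaw, this, bitWeight]

theorem bitWeight_nonneg {p : ℝ} (hp : p ∈ Icc (0 : ℝ) 1) (b : Bool) : 0 ≤ bitWeight p b := by
  have := hp.1; have := hp.2
  cases b <;> simp [bitWeight] <;> linarith

theorem perc_cylinder {p : ℝ} (hp : p ∈ Icc (0 : ℝ) 1) (s : Finset Bond) (g : BondConfig) :
    perc p {ω | ∀ e ∈ s, ω e = g e} = ∏ e ∈ s, ENNReal.ofReal (bitWeight p (g e)) := by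
  have h := Measure.infinitePi_pi (μ := fun _ : Bond => bitLaw p) (s := s)
    (t := fun e => {g e}) (fun _ _ => measurableSet_singleton _)
  simp only [bitLaw_singleton hp] at h
  rw [← h]; rfl

theorem measurableSet_cylinder (s : Finset Bond) (g : BondConfig) :
    MeasurableSet {ω : BondConfig | ∀ e ∈ s, ω e = g e} := by
  have : {ω : BondConfig | ∀ e ∈ s, ω e = g e} = ⋂ e ∈ s, {ω | ω e = g e} := by ext; simp
  rw [this]
  exact Finset.measurableSet_biInter _ fun e _ =>
    (measurable_pi_apply e : Measurable fun ω : BondConfig => ω e) (measurableSet_singleton (g e))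

theorem eq_perc_of_cylinder {p : ℝ} (hp : p ∈ Icc (0 : ℝ) 1) (P : Measure BondConfig)
    [IsProbabilityMeasure P]
    (hP : ∀ (s : Finset Bond) (g : BondConfig),
      P {ω | ∀ e ∈ s, ω e = g e} = ∏ e ∈ s, ENNReal.ofReal (bitWeight p (g e))) :
    P = perc p := by
  have hlim : IsProjectiveLimit (perc p) fun I : Finset Bond => Measure.pi fun _ : I => bitLaw p :=
    Measure.isProjectiveLimit_infinitePi _
  refine IsProjectiveLimit.unique (fun I => ?_) hlim
  refine Measure.ext_of_singleton fun σ => ?_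
  classical
  let g : BondConfig := fun e => if h : e ∈ I then σ ⟨e, h⟩ else true
  have hg : ∀ e : I, g e = σ e := fun e => by simp [g]
  have hpre : (I.restrict : BondConfig → _) ⁻¹' {σ} = {ω | ∀ e ∈ I, ω e = g e} := by
    ext ω
    simp only [mem_preimage, mem_singleton_iff, mem_ofPred_eq, funext_iff, Subtype.forall,
      Finset.restrict]
    exact forall₂_congr fun e he => by rw [hg ⟨e, he⟩]
  rw [Measure.map_apply (Finset.measurable_restrict I) (measurableSet_singleton _), hpre, hP,
    Measure.pi_singleton]
  simp only [bitLaw_singleton hp, ← hg]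
  exact (Finset.prod_coe_sort I fun e => ENNReal.ofReal (bitWeight p (g e))).symm

theorem measurable_update_bond (e : Bond) (b : Bool) :
    Measurable fun ω : BondConfig => Function.update ω e b :=
  measurable_update'.comp (measurable_id.prodMk measurable_const)

/-- Resampling one bond leaves the Bernoulli measure invariant. -/
theorem perc_eq_resample {p : ℝ} (hp : p ∈ Icc (0 : ℝ) 1) (e : Bond) :
    perc p = ENNReal.ofReal p • (perc p).map (fun ω => Function.update ω e true) +
      ENNReal.ofReal (1 - p) • (perc p).map (fun ω => Function.update ω e false) := by
  have hone : ENNReal.ofReal p + ENNReal.ofReal (1 - p) = 1 := by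
    rw [← ENNReal.ofReal_add hp.1 (by linarith [hp.2])]; simp
  set Q := ENNReal.ofReal p • (perc p).map (fun ω => Function.update ω e true) +
      ENNReal.ofReal (1 - p) • (perc p).map (fun ω => Function.update ω e false) with hQ
  have : IsProbabilityMeasure Q := by
    constructor
    simp [hQ, Measure.map_apply (measurable_update_bond e _) MeasurableSet.univ, hone]
  symm
  refine eq_perc_of_cylinder hp Q fun s g => ?_
  rw [hQ, Measure.add_apply, Measure.smul_apply, Measure.smul_apply,
    Measure.map_apply (measurable_update_bond e _) (measurableSet_cylinder s g),
    Measure.map_apply (measurable_update_bond e _) (measurableSet_cylinder s g)]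
  by_cases he : e ∈ s
  · have hpre : ∀ b, (fun ω : BondConfig => Function.update ω e b) ⁻¹' {ω | ∀ e ∈ s, ω e = g e} =
        if b = g e then {ω | ∀ e' ∈ s.erase e, ω e' = g e'} else ∅ := by
      intro b
      ext ω
      simp only [mem_preimage, mem_ofPred_eq]
      split_ifs with hb
      · simp only [mem_ofPred_eq, Finset.mem_erase]
        constructor
        · rintro h e' ⟨hne, h'⟩
          simpa [hne] using h e' h'
        · intro h e' h'
          by_cases hne : e' = e
          · subst hne; simpa using hb
          · simpa [hne] using h e' ⟨hne, h'⟩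
      · simp only [mem_empty_iff_false, iff_false, not_forall]
        exact ⟨e, he, by simpa using hb⟩
    rw [hpre, hpre, ← Finset.mul_prod_erase s _ he]
    cases hge : g e <;>
      simp only [reduceCtorEq, if_true, if_false, perc_cylinder hp, measure_empty] <;>
      simp [bitWeight]
  · have hpre : ∀ b, (fun ω : BondConfig => Function.update ω e b) ⁻¹' {ω | ∀ e ∈ s, ω e = g e} =
        {ω | ∀ e ∈ s, ω e = g e} := by
      intro b
      ext ω
      refine forall₂_congr fun e' h' => ?_
      beta_reduce
      rw [Function.update_of_ne (by rintro rfl; exact he h')]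
    rw [hpre, hpre, smul_eq_mul, smul_eq_mul, ← add_mul, hone, one_mul, perc_cylinder hp]

/-- A function of finitely many bonds is measurable. -/
theorem DependsOn.measurable_of_finset {α : Type*} [MeasurableSpace α] [Nonempty α]
    {f : BondConfig → α} {F : Finset Bond} (hf : DependsOn f (F : Set Bond)) : Measurable f := by
  obtain ⟨g, rfl⟩ := dependsOn_iff_exists_comp.1 hf
  refine Measurable.comp (g := g) ?_ (measurable_pi_lambda _ fun i => measurable_pi_apply _)
  exact measurable_of_finite _

/-- The event `A` is determined by the bonds in `F`. -/
def Determined (A : Set BondConfig) (F : Set Bond) : Prop := DependsOn (· ∈ A) F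

theorem Determined.measurableSet {A : Set BondConfig} {F : Finset Bond}
    (h : Determined A (F : Set Bond)) : MeasurableSet A :=
  measurableSet_setOfPred.2 (DependsOn.measurable_of_finset h)

theorem determined_iff {A : Set BondConfig} {F : Set Bond} :
    Determined A F ↔ ∀ ω ω', (∀ e ∈ F, ω e = ω' e) → ω ∈ A → ω' ∈ A :=
  ⟨fun h _ _ he ha => (h he).mp ha, fun h _ _ he =>
    propext ⟨h _ _ he, h _ _ fun e h' => (he e h').symm⟩⟩

/-- The event obtained from `A` by forcing the state of `e` to be `b`. -/
def forced (A : Set BondConfig) (e : Bond) (b : Bool) : Set BondConfig :=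
  {ω | Function.update ω e b ∈ A}

theorem DependsOn.comp_update {α : Type*} {f : BondConfig → α} {F : Set Bond} {e : Bond}
    (hf : DependsOn f (insert e F)) (b : Bool) :
    DependsOn (fun ω => f (Function.update ω e b)) F := by
  intro x y h
  refine hf fun i hi => ?_
  by_cases hie : i = e
  · subst hie; simp
  · simpa [hie] using h i (hi.resolve_left hie)

theorem Determined.forced {A : Set BondConfig} {F : Set Bond} {e : Bond}
    (hA : Determined A (insert e F)) (b : Bool) : Determined (forced A e b) F :=
  DependsOn.comp_update hA b

theorem perc_real_resample {p : ℝ} (hp : p ∈ Icc (0 : ℝ) 1) (e : Bond) {A : Set BondConfig}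
    (hA : MeasurableSet A) :
    (perc p).real A =
      p * (perc p).real (forced A e true) + (1 - p) * (perc p).real (forced A e false) := by
  have h := congrArg (fun μ => Measure.real μ A) (perc_eq_resample hp e)
  simp only [measureReal_def, Measure.add_apply, Measure.smul_apply, smul_eq_mul,
    Measure.map_apply (measurable_update_bond e _) hA] at h ⊢
  rw [h, ENNReal.toReal_add (by finiteness) (by finiteness), ENNReal.toReal_mul,
    ENNReal.toReal_mul, ENNReal.toReal_ofReal hp.1, ENNReal.toReal_ofReal (by linarith [hp.2])]
  rfl

theorem DependsOn.integrable {f : BondConfig → ℝ} {F : Finset Bond}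
    (hf : DependsOn f (F : Set Bond)) (p : ℝ) : Integrable f (perc p) := by
  have hm := hf.measurable_of_finset
  obtain ⟨g, hg⟩ := dependsOn_iff_exists_comp.1 hf
  have hfin : (range g).Finite := finite_range g
  obtain ⟨C, hC⟩ := (hfin.image fun x => ‖x‖).bddAbove
  refine Integrable.of_bound hm.aestronglyMeasurable C (Filter.Eventually.of_forall fun ω => ?_)
  exact hC ⟨f ω, by rw [hg]; exact ⟨_, rfl⟩, rfl⟩

theorem integral_perc_resample {p : ℝ} (hp : p ∈ Icc (0 : ℝ) 1) (e : Bond) {f : BondConfig → ℝ}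
    {F : Finset Bond} (hf : DependsOn f (F : Set Bond)) :
    ∫ ω, f ω ∂perc p = p * ∫ ω, f (Function.update ω e true) ∂perc p +
      (1 - p) * ∫ ω, f (Function.update ω e false) ∂perc p := by
  have hm := hf.measurable_of_finset
  have hu : ∀ b, Integrable f ((perc p).map fun ω => Function.update ω e b) := fun b => by
    rw [integrable_map_measure hm.aestronglyMeasurable (measurable_update_bond e b).aemeasurable]
    refine DependsOn.integrable (F := F) (fun x y h => hf fun i hi => ?_) p
    by_cases hie : i = e
    · subst hie; simp
    · simpa [hie] using h i hi
  conv_lhs => rw [perc_eq_resample hp e]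
  rw [integral_add_measure ((hu _).smul_measure (by finiteness))
    ((hu _).smul_measure (by finiteness)), integral_smul_measure, integral_smul_measure,
    integral_map (measurable_update_bond e _).aemeasurable hm.aestronglyMeasurable,
    integral_map (measurable_update_bond e _).aemeasurable hm.aestronglyMeasurable,
    ENNReal.toReal_ofReal hp.1, ENNReal.toReal_ofReal (by linarith [hp.2])]
  rfl

end BernoulliMeasure

section Inequalities

/-! ### Independence, positive association, Russo's formula -/

theorem measurableSet_forced {A : Set BondConfig} (hA : MeasurableSet A) (e : Bond) (b : Bool) :
    MeasurableSet (forced A e b) := measurable_update_bond e b hA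

theorem determined_empty {A : Set BondConfig} (hA : Determined A ∅) : A = ∅ ∨ A = univ := by
  rcases A.eq_empty_or_nonempty with h | ⟨ω, h⟩
  · exact Or.inl h
  · exact Or.inr (eq_univ_of_forall fun ω' => determined_iff.1 hA ω ω' (by simp) h)

/-- An event determined by finitely many bonds is independent of every event that is insensitive to
those bonds. -/
theorem perc_real_inter_of_forced {p : ℝ} (hp : p ∈ Icc (0 : ℝ) 1) {B : Set BondConfig}
    (hB : MeasurableSet B) (F : Finset Bond) (hBF : ∀ e ∈ F, ∀ b, forced B e b = B)
    {A : Set BondConfig} (hA : Determined A (F : Set Bond)) :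
    (perc p).real (A ∩ B) = (perc p).real A * (perc p).real B := by
  induction F using Finset.induction_on generalizing A with
  | empty =>
    rcases determined_empty (by simpa using hA) with rfl | rfl <;> simp
  | insert e F he ih =>
    have hm := hA.measurableSet
    rw [Finset.coe_insert] at hA
    have hF : ∀ e ∈ F, ∀ b, forced B e b = B := fun e' h' => hBF e' (Finset.mem_insert_of_mem h')
    have hfor : ∀ b, forced (A ∩ B) e b = forced A e b ∩ B := fun b => by
      conv_rhs => rw [← hBF e (Finset.mem_insert_self _ _) b]
      rfl
    rw [perc_real_resample hp e (hm.inter hB), perc_real_resample hp e hm, hfor, hfor,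
      ih hF (hA.forced true), ih hF (hA.forced false)]
    ring

theorem Determined.forced_eq {A : Set BondConfig} {F : Set Bond} (hA : Determined A F) {e : Bond}
    (he : e ∉ F) (b : Bool) : _root_.forced A e b = A := by
  ext ω
  refine Iff.of_eq (hA fun i hi => ?_)
  rw [Function.update_of_ne (by rintro rfl; exact he hi)]

theorem perc_real_inter {p : ℝ} (hp : p ∈ Icc (0 : ℝ) 1) {A B : Set BondConfig} {F G : Finset Bond}
    (hA : Determined A (F : Set Bond)) (hB : Determined B (G : Set Bond))
    (hFG : ∀ e ∈ F, e ∉ G) :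
    (perc p).real (A ∩ B) = (perc p).real A * (perc p).real B :=
  perc_real_inter_of_forced hp hB.measurableSet F
    (fun e he b => hB.forced_eq (by simpa using hFG e he) b) hA

theorem update_le_update_bond {ω ω' : BondConfig} (h : ω ≤ ω') {b b' : Bool} (hb : b ≤ b')
    (e : Bond) : Function.update ω e b ≤ Function.update ω' e b' := fun e' => by
  by_cases he : e' = e
  · subst he; simpa using hb
  · simpa [he] using h e'

theorem isUpperSet_forced {A : Set BondConfig} (hA : IsUpperSet A) (e : Bond) (b : Bool) :
    IsUpperSet (forced A e b) := fun _ _ h hω =>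
  hA (update_le_update_bond h le_rfl e) hω

theorem forced_false_subset {A : Set BondConfig} (hA : IsUpperSet A) (e : Bond) :
    forced A e false ⊆ forced A e true := fun _ hω =>
  hA (update_le_update_bond le_rfl (Bool.false_le true) e) hω

/-- Harris' inequality: increasing events are positively correlated. -/
theorem perc_real_mul_le_inter {p : ℝ} (hp : p ∈ Icc (0 : ℝ) 1) (F : Finset Bond)
    {A B : Set BondConfig} (hA : Determined A (F : Set Bond)) (hB : Determined B (F : Set Bond))
    (hAu : IsUpperSet A) (hBu : IsUpperSet B) :
    (perc p).real A * (perc p).real B ≤ (perc p).real (A ∩ B) := by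
  induction F using Finset.induction_on generalizing A B with
  | empty =>
    rcases determined_empty (by simpa using hA) with rfl | rfl <;> simp
  | insert e F he ih =>
    have hmA := hA.measurableSet
    have hmB := hB.measurableSet
    rw [Finset.coe_insert] at hA hB
    rw [perc_real_resample hp e hmA, perc_real_resample hp e hmB,
      perc_real_resample hp e (hmA.inter hmB)]
    have h1 := ih (hA.forced true) (hB.forced true) (isUpperSet_forced hAu e _)
      (isUpperSet_forced hBu e _)
    have h0 := ih (hA.forced false) (hB.forced false) (isUpperSet_forced hAu e _)
      (isUpperSet_forced hBu e _)
    have hA' := measureReal_mono (μ := perc p) (forced_false_subset hAu e) (by finiteness)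
    have hB' := measureReal_mono (μ := perc p) (forced_false_subset hBu e) (by finiteness)
    change _ ≤ p * (perc p).real (forced A e true ∩ forced B e true) +
      (1 - p) * (perc p).real (forced A e false ∩ forced B e false)
    obtain ⟨hp0, hp1⟩ := hp
    nlinarith [mul_le_mul_of_nonneg_left h1 hp0,
      mul_le_mul_of_nonneg_left h0 (sub_nonneg.2 hp1),
      mul_nonneg (mul_nonneg hp0 (sub_nonneg.2 hp1))
        (mul_nonneg (sub_nonneg.2 hA') (sub_nonneg.2 hB'))]

theorem perc_real_mono {p q : ℝ} (hp : p ∈ Icc (0 : ℝ) 1) (hq : q ∈ Icc (0 : ℝ) 1) (hpq : p ≤ q)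
    (F : Finset Bond) {A : Set BondConfig} (hA : Determined A (F : Set Bond))
    (hAu : IsUpperSet A) : (perc p).real A ≤ (perc q).real A := by
  induction F using Finset.induction_on generalizing A with
  | empty =>
    rcases determined_empty (by simpa using hA) with rfl | rfl <;> simp
  | insert e F he ih =>
    have hmA := hA.measurableSet
    rw [Finset.coe_insert] at hA
    rw [perc_real_resample hp e hmA, perc_real_resample hq e hmA]
    have h1 := ih (hA.forced true) (isUpperSet_forced hAu e _)
    have h0 := ih (hA.forced false) (isUpperSet_forced hAu e _)
    have hA' := measureReal_mono (μ := perc p) (forced_false_subset hAu e) (by finiteness)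
    have hA'' := measureReal_mono (μ := perc q) (forced_false_subset hAu e) (by finiteness)
    nlinarith [mul_le_mul_of_nonneg_left h1 hp.1,
      mul_le_mul_of_nonneg_left h0 (sub_nonneg.2 hp.2),
      mul_nonneg (sub_nonneg.2 hpq) (sub_nonneg.2 hA'')]

/-- An event insensitive to the state of each single bond has probability zero or one. -/
theorem perc_real_zero_or_one {p : ℝ} (hp : p ∈ Icc (0 : ℝ) 1) {A : Set BondConfig}
    (hA : MeasurableSet A) (hinv : ∀ e b, forced A e b = A) :
    perc p A = 0 ∨ perc p A = 1 := by
  by_cases h0 : perc p A = 0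
  · exact Or.inl h0
  right
  have := ProbabilityTheory.cond_isProbabilityMeasure h0
  have hcond : ProbabilityTheory.cond (perc p) A = perc p := by
    refine eq_perc_of_cylinder hp _ fun s g => ?_
    rw [← perc_cylinder hp, ProbabilityTheory.cond_apply hA]
    have hdet : Determined {ω : BondConfig | ∀ e ∈ s, ω e = g e} (s : Set Bond) :=
      determined_iff.2 fun ω ω' he h e hes => by rw [← he e (by simpa using hes), h e hes]
    have h := perc_real_inter_of_forced hp hA s (fun e _ b => hinv e b) hdet
    simp only [measureReal_def] at h
    rw [← ENNReal.toReal_mul, ENNReal.toReal_eq_toReal_iff' (by finiteness) (by finiteness)] at h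
    rw [inter_comm, h, mul_comm _ (perc p A), ← mul_assoc,
      ENNReal.inv_mul_cancel h0 (by finiteness), one_mul]
  have h1 : ProbabilityTheory.cond (perc p) A A = 1 := by
    rw [ProbabilityTheory.cond_apply hA, inter_self, ENNReal.inv_mul_cancel h0 (by finiteness)]
  rwa [hcond] at h1

theorem DependsOn.update_mem {α : Type*} {f : BondConfig → α} {F : Set Bond}
    (hf : DependsOn f F) (e : Bond) (b : Bool) :
    DependsOn (fun ω => f (Function.update ω e b)) F :=
  DependsOn.comp_update (hf.mono (subset_insert _ _)) b

/-- Russo's formula. -/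
theorem hasDerivAt_integral_perc {p : ℝ} (hp : p ∈ Ioo (0 : ℝ) 1) (F : Finset Bond)
    {f : BondConfig → ℝ} (hf : DependsOn f (F : Set Bond)) :
    HasDerivAt (fun q => ∫ ω, f ω ∂perc q)
      (∑ e ∈ F, ∫ ω, (f (Function.update ω e true) - f (Function.update ω e false)) ∂perc p) p := by
  induction F using Finset.induction_on generalizing f with
  | empty =>
    have : f = fun _ => f default := funext fun ω => hf (by simp)
    rw [this]
    simpa using hasDerivAt_const p (f default)
  | insert e F he ih =>
    have hf' := hf
    rw [Finset.coe_insert] at hf'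
    have h1 := ih (hf'.comp_update true)
    have h0 := ih (hf'.comp_update false)
    have hev : (fun q => ∫ ω, f ω ∂perc q) =ᶠ[nhds p] fun q =>
        q * ∫ ω, f (Function.update ω e true) ∂perc q +
          (1 - q) * ∫ ω, f (Function.update ω e false) ∂perc q := by
      filter_upwards [Ioo_mem_nhds hp.1 hp.2] with q hq
      exact integral_perc_resample (Ioo_subset_Icc_self hq) e hf
    have hd := ((hasDerivAt_id p).mul h1).add (((hasDerivAt_id p).const_sub 1).mul h0)
    refine (hd.congr_of_eventuallyEq hev).congr_deriv ?_
    rw [Finset.sum_insert he, integral_sub]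
    · have hsum : ∑ e' ∈ F, ∫ ω, (f (Function.update ω e' true) - f (Function.update ω e' false)) ∂perc p
          = p * ∑ e' ∈ F, ∫ ω, (f (Function.update (Function.update ω e' true) e true) -
            f (Function.update (Function.update ω e' false) e true)) ∂perc p +
          (1 - p) * ∑ e' ∈ F, ∫ ω, (f (Function.update (Function.update ω e' true) e false) -
            f (Function.update (Function.update ω e' false) e false)) ∂perc p := by
        rw [Finset.mul_sum, Finset.mul_sum, ← Finset.sum_add_distrib]
        refine Finset.sum_congr rfl fun e' he' => ?_
        have hne : e' ≠ e := by rintro rfl; exact he he'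
        have hdep : DependsOn (fun ω => f (Function.update ω e' true) - f (Function.update ω e' false))
            ((insert e F : Finset Bond) : Set Bond) := fun x y h => by
          exact congrArg₂ (· - ·) (hf.update_mem e' true h) (hf.update_mem e' false h)
        rw [integral_perc_resample (Ioo_subset_Icc_self hp) e hdep]
        simp only [Function.update_comm hne]
      rw [hsum]
      simp only [id_eq]
      ring
    · exact (hf.update_mem e true).integrable p
    · exact (hf.update_mem e false).integrable p

/-- The configuration obtained from `ω` by setting every bond of `B` to the state `b`. -/
def setOn (B : Finset Bond) (b : Bool) (ω : BondConfig) : BondConfig :=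
  fun e => if e ∈ B then b else ω e

@[simp] theorem setOn_empty (b : Bool) (ω : BondConfig) : setOn ∅ b ω = ω := by
  ext; simp [setOn]

theorem setOn_insert (B : Finset Bond) (e : Bond) (b : Bool) (ω : BondConfig) :
    setOn (insert e B) b ω = Function.update (setOn B b ω) e b := by
  ext e'
  by_cases h : e' = e
  · subst h; simp [setOn]
  · simp [setOn, h]

theorem DependsOn.comp_setOn {α : Type*} {f : BondConfig → α} {F : Set Bond}
    (hf : DependsOn f F) (B : Finset Bond) (b : Bool) :
    DependsOn (fun ω => f (setOn B b ω)) F := fun x y h => hf fun i hi => by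
  simp only [setOn, h i hi]

theorem mul_integral_update_le {p m : ℝ} (hp : p ∈ Icc (0 : ℝ) 1) (hm : m ≤ p) (hm' : m ≤ 1 - p)
    {F : Finset Bond} {f : BondConfig → ℝ} (hf : DependsOn f (F : Set Bond)) (h0 : ∀ ω, 0 ≤ f ω)
    (e : Bond) (b : Bool) :
    m * ∫ ω, f (Function.update ω e b) ∂perc p ≤ ∫ ω, f ω ∂perc p := by
  rw [integral_perc_resample hp e hf]
  have hn : ∀ b, 0 ≤ ∫ ω, f (Function.update ω e b) ∂perc p := fun b =>
    integral_nonneg fun ω => h0 _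
  have h1 := mul_le_mul_of_nonneg_right hm (hn true)
  have h2 := mul_le_mul_of_nonneg_right hm' (hn false)
  have h3 := mul_nonneg hp.1 (hn true)
  have h4 := mul_nonneg (sub_nonneg.2 hp.2) (hn false)
  cases b <;> linarith

theorem pow_mul_integral_setOn_le {p m : ℝ} (hp : p ∈ Icc (0 : ℝ) 1) (hm0 : 0 ≤ m) (hm : m ≤ p)
    (hm' : m ≤ 1 - p) {F : Finset Bond} {f : BondConfig → ℝ} (hf : DependsOn f (F : Set Bond))
    (h0 : ∀ ω, 0 ≤ f ω) (B : Finset Bond) (b : Bool) :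
    m ^ B.card * ∫ ω, f (setOn B b ω) ∂perc p ≤ ∫ ω, f ω ∂perc p := by
  induction B using Finset.induction_on generalizing f with
  | empty => simp
  | insert e B he ih =>
    simp only [setOn_insert]
    rw [Finset.card_insert_of_notMem he, pow_succ', mul_assoc]
    have h := ih (hf.update_mem e b) fun ω => h0 _
    exact (mul_le_mul_of_nonneg_left h hm0).trans (mul_integral_update_le hp hm hm' hf h0 e b)

/-- The effect of closing rather than opening all bonds of a block is controlled by the influences
of its bonds. -/
theorem pow_mul_integral_block_le {p m : ℝ} (hp : p ∈ Icc (0 : ℝ) 1) (hm0 : 0 ≤ m) (hm : m ≤ p)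
    (hm' : m ≤ 1 - p) {F : Finset Bond} {f : BondConfig → ℝ} (hf : DependsOn f (F : Set Bond))
    (hanti : Antitone f) (B : Finset Bond) :
    m ^ B.card * ∫ ω, (f (setOn B false ω) - f (setOn B true ω)) ∂perc p ≤
      ∑ e ∈ B, ∫ ω, (f (Function.update ω e false) - f (Function.update ω e true)) ∂perc p := by
  induction B using Finset.induction_on generalizing f with
  | empty => simp
  | insert e B he ih =>
    have hupd : ∀ (ω : BondConfig) (e : Bond), Function.update ω e false ≤ Function.update ω e true :=
      fun ω e => update_le_update_bond le_rfl (Bool.false_le true) e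
    have hanti' : Antitone fun ω => f (Function.update ω e false) := fun ω ω' h =>
      hanti (update_le_update_bond h le_rfl e)
    have hm1 : m ≤ 1 := by linarith [hp.2]
    have ih' := ih (hf.update_mem e false) hanti'
    have hdiff : ∀ e', DependsOn (fun ω => f (Function.update ω e' false) -
        f (Function.update ω e' true)) (F : Set Bond) := fun e' x y h => by
      exact congrArg₂ (· - ·) (hf.update_mem e' false h) (hf.update_mem e' true h)
    have hpos : ∀ e' ω, 0 ≤ f (Function.update ω e' false) - f (Function.update ω e' true) :=
      fun e' ω => sub_nonneg.2 (hanti (hupd ω e'))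
    have hset := pow_mul_integral_setOn_le hp hm0 hm hm' (hdiff e) (hpos e) B true
    have hsum : m * ∑ e' ∈ B, ∫ ω, (f (Function.update (Function.update ω e' false) e false) -
        f (Function.update (Function.update ω e' true) e false)) ∂perc p ≤
        ∑ e' ∈ B, ∫ ω, (f (Function.update ω e' false) - f (Function.update ω e' true)) ∂perc p := by
      rw [Finset.mul_sum]
      refine Finset.sum_le_sum fun e' he' => ?_
      have hne : e' ≠ e := by rintro rfl; exact he he'
      have := mul_integral_update_le hp hm hm' (hdiff e') (hpos e') e false
      simpa only [Function.update_comm hne] using this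
    rw [Finset.sum_insert he, Finset.card_insert_of_notMem he, pow_succ', mul_assoc]
    simp only [setOn_insert]
    have hsplit : ∫ ω, (f (Function.update (setOn B false ω) e false) -
          f (Function.update (setOn B true ω) e true)) ∂perc p =
        ∫ ω, (f (Function.update (setOn B false ω) e false) -
          f (Function.update (setOn B true ω) e false)) ∂perc p +
        ∫ ω, (f (Function.update (setOn B true ω) e false) -
          f (Function.update (setOn B true ω) e true)) ∂perc p := by
      rw [← integral_add]
      · simp
      · exact (((hf.update_mem e false).comp_setOn B false).integrable p).sub
          (((hf.update_mem e false).comp_setOn B true).integrable p)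
      · exact ((hdiff e).comp_setOn B true).integrable p
    rw [hsplit, mul_add, mul_add]
    have hpos' : 0 ≤ m ^ B.card * ∫ ω, (f (Function.update (setOn B true ω) e false) -
          f (Function.update (setOn B true ω) e true)) ∂perc p :=
      mul_nonneg (by positivity) (integral_nonneg fun ω => hpos e _)
    have := mul_le_mul_of_nonneg_left ih' hm0
    nlinarith

end Inequalities

section Lattice

/-! ### Connections in bond configurations -/

/-- The second endpoint of a bond. -/
def bondEnd (e : Bond) : ℤ × ℤ := if e.2 then (e.1.1, e.1.2 + 1) else (e.1.1 + 1, e.1.2)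

/-- The bond `e` joins `u` and `v`. -/
def Joins (e : Bond) (u v : ℤ × ℤ) : Prop :=
  (u = e.1 ∧ v = bondEnd e) ∨ (v = e.1 ∧ u = bondEnd e)

/-- `u` and `v` are joined by an open bond. -/
def Op (ω : BondConfig) (u v : ℤ × ℤ) : Prop := ∃ e, Joins e u v ∧ ω e = true

/-- `u` and `v` are connected by an open path inside `W`. -/
def Conn (ω : BondConfig) (W : Set (ℤ × ℤ)) (u v : ℤ × ℤ) : Prop :=
  Relation.ReflTransGen (fun a b => Op ω a b ∧ a ∈ W ∧ b ∈ W) u v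

/-- Some open path starts in `U`, stays inside `W`, and finally steps from `W` to `T`. -/
def exitEvent (U W T : Set (ℤ × ℤ)) : Set BondConfig :=
  {ω | ∃ u ∈ U, ∃ v ∈ W, ∃ w ∈ T, Conn ω W u v ∧ Op ω v w}

variable {ω ω' : BondConfig} {U W X T : Set (ℤ × ℤ)} {u v w : ℤ × ℤ} {e : Bond}

theorem Joins.symm (h : Joins e u v) : Joins e v u := Or.symm h

theorem Joins.touches (h : Joins e u v) (hu : u ∈ W) : e.1 ∈ W ∨ bondEnd e ∈ W := by
  rcases h with ⟨rfl, rfl⟩ | ⟨rfl, rfl⟩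
  · exact Or.inl hu
  · exact Or.inr hu

theorem Joins.inside (h : Joins e u v) (hu : u ∈ W) (hv : v ∈ W) : e.1 ∈ W ∧ bondEnd e ∈ W := by
  rcases h with ⟨rfl, rfl⟩ | ⟨rfl, rfl⟩
  · exact ⟨hu, hv⟩
  · exact ⟨hv, hu⟩

theorem Op.symm (h : Op ω u v) : Op ω v u := let ⟨e, h1, h2⟩ := h; ⟨e, h1.symm, h2⟩

theorem Op.mono (h : Op ω u v) (hω : ω ≤ ω') : Op ω' u v :=
  let ⟨e, h1, h2⟩ := h; ⟨e, h1, Bool.eq_true_of_true_le (h2 ▸ hω e)⟩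

theorem Conn.refl (ω : BondConfig) (W : Set (ℤ × ℤ)) (u : ℤ × ℤ) : Conn ω W u u :=
  Relation.ReflTransGen.refl

theorem Conn.single (h : Op ω u v) (hu : u ∈ W) (hv : v ∈ W) : Conn ω W u v :=
  Relation.ReflTransGen.single ⟨h, hu, hv⟩

theorem Conn.trans (h : Conn ω W u v) (h' : Conn ω W v w) : Conn ω W u w :=
  Relation.ReflTransGen.trans h h'

theorem Conn.symm (h : Conn ω W u v) : Conn ω W v u := by
  induction h with
  | refl => exact Conn.refl _ _ _
  | tail _ h ih => exact (Conn.single h.1.symm h.2.2 h.2.1).trans ih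

theorem Conn.congr (hω : ∀ e, e.1 ∈ W → bondEnd e ∈ W → ω e = true → ω' e = true) (hWX : W ⊆ X)
    (h : Conn ω W u v) : Conn ω' X u v := by
  refine Relation.ReflTransGen.mono ?_ _ _ h
  rintro a b ⟨⟨e, hj, he⟩, ha, hb⟩
  obtain ⟨h1, h2⟩ := hj.inside ha hb
  exact ⟨⟨e, hj, hω e h1 h2 he⟩, hWX ha, hWX hb⟩

theorem Conn.mono (hω : ω ≤ ω') (hWX : W ⊆ X) (h : Conn ω W u v) : Conn ω' X u v :=
  h.congr (fun e _ _ he => Bool.eq_true_of_true_le (he ▸ hω e)) hWX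

theorem Conn.mem (h : Conn ω W u v) (hu : u ∈ W) : v ∈ W := by
  induction h with
  | refl => exact hu
  | tail _ h _ => exact h.2.2

/-- A path starting in `W` stays there or has a first exit. -/
theorem Conn.inside_or_exit (h : Conn ω X u v) (hu : u ∈ W) : Conn ω (X ∩ W) u v ∨
    ∃ a ∈ W, ∃ b ∉ W, a ∈ X ∧ b ∈ X ∧ Conn ω (X ∩ W) u a ∧ Op ω a b ∧ Conn ω X b v := by
  induction h using Relation.ReflTransGen.head_induction_on with
  | refl => exact Or.inl (Conn.refl _ _ _)
  | @head a c hstep hrest ih =>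
    by_cases hc : c ∈ W
    · have hac : Conn ω (X ∩ W) a c := Conn.single hstep.1 ⟨hstep.2.1, hu⟩ ⟨hstep.2.2, hc⟩
      obtain h | ⟨a', ha', b', hb', h1, h2, h3, h4, h5⟩ := ih hc
      · exact Or.inl (hac.trans h)
      · exact Or.inr ⟨a', ha', b', hb', h1, h2, hac.trans h3, h4, h5⟩
    · exact Or.inr ⟨a, hu, c, hc, hstep.2.1, hstep.2.2, Conn.refl _ _ _, hstep.1, hrest⟩

/-- A path leaving `W` has a first exit. -/
theorem Conn.first_exit (h : Conn ω X u v) (hu : u ∈ W) (hv : v ∉ W) :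
    ∃ a ∈ W, ∃ b ∉ W, a ∈ X ∧ b ∈ X ∧ Conn ω (X ∩ W) u a ∧ Op ω a b ∧ Conn ω X b v :=
  (h.inside_or_exit hu).resolve_left fun h' =>
    hv (Conn.mem (h'.mono le_rfl inter_subset_right) hu)

/-- A path leaving `W` has a last exit. -/
theorem Conn.last_exit (h : Conn ω X u v) (hu : u ∈ W) (hv : v ∉ W) :
    ∃ a ∈ W, ∃ b ∉ W, a ∈ X ∧ b ∈ X ∧ Conn ω X u a ∧ Op ω a b ∧ Conn ω (X ∩ Wᶜ) b v := by
  obtain ⟨b, hb, a, ha, hbX, haX, h1, h2, h3⟩ :=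
    h.symm.first_exit (W := Wᶜ) hv (by simpa using hu)
  exact ⟨a, by simpa using ha, b, hb, haX, hbX, h3.symm, h2.symm, h1.symm⟩

theorem isUpperSet_exitEvent (U W T : Set (ℤ × ℤ)) : IsUpperSet (exitEvent U W T) := by
  rintro ω ω' h ⟨u, hu, v, hv, w, hw, hc, ho⟩
  exact ⟨u, hu, v, hv, w, hw, hc.mono h le_rfl, ho.mono h⟩

theorem exitEvent_mono {U' T' : Set (ℤ × ℤ)} (hU : U ⊆ U') (hT : T ⊆ T') :
    exitEvent U W T ⊆ exitEvent U' W T' := by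
  rintro ω ⟨u, hu, v, hv, w, hw, h⟩
  exact ⟨u, hU hu, v, hv, w, hT hw, h⟩

/-- A connection from `W` to its complement exits `W`. -/
theorem Conn.mem_exitEvent (h : Conn ω X u v) (hu : u ∈ W) (hv : v ∉ W) :
    ω ∈ exitEvent {u} W Wᶜ := by
  obtain ⟨a, ha, b, hb, -, -, h1, h2, -⟩ := h.first_exit hu hv
  exact ⟨u, rfl, a, ha, b, hb, h1.mono le_rfl inter_subset_right, h2⟩

/-- The bonds having at least one endpoint in `W`. -/
def touching (W : Finset (ℤ × ℤ)) : Finset Bond :=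
  W ×ˢ Finset.univ ∪ W.image (fun v => ((v.1 - 1, v.2), false)) ∪
    W.image (fun v => ((v.1, v.2 - 1), true))

theorem mem_touching {W : Finset (ℤ × ℤ)} {e : Bond} :
    e ∈ touching W ↔ e.1 ∈ W ∨ bondEnd e ∈ W := by
  obtain ⟨⟨a, b⟩, o⟩ := e
  simp only [touching, Finset.union_assoc, Finset.mem_union, Finset.mem_product, Finset.mem_univ,
    and_true, Finset.mem_image, Prod.mk.injEq, Prod.exists]
  refine or_congr Iff.rfl ?_
  cases o
  · simp only [bondEnd, and_true, reduceCtorEq, and_false, exists_false, or_false,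
      if_false]
    constructor
    · rintro ⟨c, d, h, h1, rfl⟩
      rwa [← h1, sub_add_cancel]
    · intro h
      exact ⟨_, _, h, by simp, rfl⟩
  · simp only [bondEnd, and_true, reduceCtorEq, and_false, exists_false, false_or,
      if_true]
    constructor
    · rintro ⟨c, d, h, rfl, h1⟩
      rwa [← h1, sub_add_cancel]
    · intro h
      exact ⟨_, _, h, rfl, by simp⟩

theorem determined_exitEvent (U T : Set (ℤ × ℤ)) (W : Finset (ℤ × ℤ)) :
    Determined (exitEvent U (W : Set (ℤ × ℤ)) T) (touching W : Set Bond) := by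
  rw [determined_iff]
  rintro ω ω' h ⟨u, hu, v, hv, w, hw, hc, e, hj, he⟩
  have hW : ∀ e, (e.1 ∈ W ∨ bondEnd e ∈ W) → ω e = ω' e := fun e he =>
    h e (by simpa using mem_touching.2 he)
  exact ⟨u, hu, v, hv, w, hw, hc.congr (fun e h1 _ h2 => by rw [← hW e (Or.inl h1), h2]) le_rfl,
    e, hj, by rw [← hW e (hj.touches hv), he]⟩

theorem measurableSet_exitEvent (U T : Set (ℤ × ℤ)) (W : Finset (ℤ × ℤ)) :
    MeasurableSet (exitEvent U (W : Set (ℤ × ℤ)) T) :=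
  (determined_exitEvent U T W).measurableSet

/-! ### Symmetries of the lattice -/

theorem map_perc_reindex {p q : ℝ} (hp : p ∈ Icc (0 : ℝ) 1) (σ : Bond ≃ Bond) (β : Bool ≃ Bool)
    (hβ : ∀ b, bitWeight p b = bitWeight q (β b)) :
    (perc p).map (fun ω e => β (ω (σ e))) = perc q := by
  have hmeas : Measurable fun (ω : BondConfig) (e : Bond) => β (ω (σ e)) :=
    measurable_pi_lambda _ fun e => (measurable_of_finite β).comp (measurable_pi_apply _)
  have : IsProbabilityMeasure ((perc p).map fun ω e => β (ω (σ e))) :=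
    Measure.isProbabilityMeasure_map hmeas.aemeasurable
  have hq : q ∈ Icc (0 : ℝ) 1 := by
    have h1 := hβ (β.symm true)
    have h2 := hβ (β.symm false)
    rw [Equiv.apply_symm_apply] at h1 h2
    have h1' := bitWeight_nonneg hp (β.symm true)
    have h2' := bitWeight_nonneg hp (β.symm false)
    rw [h1] at h1'
    rw [h2] at h2'
    simp only [bitWeight, if_true, Bool.false_eq_true, if_false] at h1' h2'
    exact ⟨h1', by linarith⟩
  refine eq_perc_of_cylinder hq _ fun s g => ?_
  rw [Measure.map_apply hmeas (measurableSet_cylinder s g)]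
  have hpre : (fun (ω : BondConfig) (e : Bond) => β (ω (σ e))) ⁻¹' {ω | ∀ e ∈ s, ω e = g e} =
      {ω | ∀ e ∈ s.map σ.toEmbedding, ω e = β.symm (g (σ.symm e))} := by
    ext ω
    simp only [mem_preimage, mem_ofPred_eq, Finset.mem_map, Equiv.coe_toEmbedding,
      forall_exists_index, and_imp, forall_apply_eq_imp_iff₂, Equiv.symm_apply_apply,
      Equiv.eq_symm_apply]
  rw [hpre, perc_cylinder hp, Finset.prod_map]
  simp [hβ]

/-- `g` is an automorphism of the lattice acting on bonds by `σ`. -/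
def IsLatticeSymm (g : ℤ × ℤ → ℤ × ℤ) (σ : Bond ≃ Bond) : Prop :=
  ∀ e u v, Joins (σ e) (g u) (g v) ↔ Joins e u v

theorem IsLatticeSymm.op {g : ℤ × ℤ → ℤ × ℤ} {σ : Bond ≃ Bond} (h : IsLatticeSymm g σ) :
    Op ω (g u) (g v) ↔ Op (fun e => ω (σ e)) u v := by
  constructor
  · rintro ⟨e, hj, he⟩
    exact ⟨σ.symm e, by rw [← h, σ.apply_symm_apply]; exact hj, by simpa using he⟩
  · rintro ⟨e, hj, he⟩
    exact ⟨σ e, (h _ _ _).2 hj, he⟩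

theorem IsLatticeSymm.conn {g : ℤ × ℤ ≃ ℤ × ℤ} {σ : Bond ≃ Bond} (h : IsLatticeSymm g σ) :
    Conn ω W (g u) (g v) ↔ Conn (fun e => ω (σ e)) (g ⁻¹' W) u v := by
  constructor
  · intro hc
    have := Relation.ReflTransGen.lift (p := fun a b => Op (fun e => ω (σ e)) a b ∧ a ∈ g ⁻¹' W ∧
      b ∈ g ⁻¹' W) g.symm (fun a b hab => by
        simp only [Function.onFun]
        rw [← h.op]; simpa using hab) _ _ hc
    simp only [Function.onFun, Equiv.symm_apply_apply] at this
    exact this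
  · exact fun hc => Relation.ReflTransGen.lift (p := fun a b => Op ω a b ∧ a ∈ W ∧ b ∈ W) g
      (fun a b hab => ⟨h.op.2 hab.1, hab.2⟩) _ _ hc

theorem IsLatticeSymm.mem_exitEvent {g : ℤ × ℤ ≃ ℤ × ℤ} {σ : Bond ≃ Bond}
    (h : IsLatticeSymm g σ) :
    (fun e => ω (σ e)) ∈ exitEvent (g ⁻¹' U) (g ⁻¹' W) (g ⁻¹' T) ↔ ω ∈ exitEvent U W T := by
  constructor
  · rintro ⟨u, hu, v, hv, w, hw, hc, ho⟩
    exact ⟨g u, hu, g v, hv, g w, hw, h.conn.2 hc, h.op.2 ho⟩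
  · rintro ⟨u, hu, v, hv, w, hw, hc, ho⟩
    refine ⟨g.symm u, by simpa using hu, g.symm v, by simpa using hv, g.symm w, by simpa using hw,
      h.conn.1 (by simpa using hc), h.op.1 (by simpa using ho)⟩

theorem IsLatticeSymm.perc_real_exitEvent {p : ℝ} (hp : p ∈ Icc (0 : ℝ) 1) {g : ℤ × ℤ ≃ ℤ × ℤ}
    {σ : Bond ≃ Bond} (h : IsLatticeSymm g σ) {U T : Set (ℤ × ℤ)} {W W' : Finset (ℤ × ℤ)}
    (hW' : (W' : Set (ℤ × ℤ)) = g ⁻¹' W) :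
    (perc p).real (exitEvent (g ⁻¹' U) W' (g ⁻¹' T)) = (perc p).real (exitEvent U W T) := by
  have hmap : (perc p).map (fun ω e => ω (σ e)) = perc p :=
    map_perc_reindex hp σ (Equiv.refl Bool) fun _ => rfl
  have hmeas : Measurable fun (ω : BondConfig) (e : Bond) => ω (σ e) :=
    measurable_pi_lambda _ fun e => measurable_pi_apply _
  conv_lhs => rw [← hmap]
  rw [map_measureReal_apply hmeas (measurableSet_exitEvent _ _ _)]
  congr 1
  ext ω
  rw [mem_preimage, hW']
  exact h.mem_exitEvent

/-- Translation of bonds. -/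
def bondShift (x : ℤ × ℤ) : Bond ≃ Bond := (Equiv.addRight x).prodCongr (Equiv.refl Bool)

theorem isLatticeSymm_shift (x : ℤ × ℤ) : IsLatticeSymm (Equiv.addRight x) (bondShift x) := by
  rintro ⟨⟨a, b⟩, o⟩ ⟨u1, u2⟩ ⟨v1, v2⟩
  obtain ⟨x1, x2⟩ := x
  cases o <;> simp [Joins, bondEnd, bondShift] <;> omega

/-- The reflection `(a, b) ↦ (-s - a, b)`. -/
def reflect (s : ℤ) : ℤ × ℤ ≃ ℤ × ℤ := (Equiv.subLeft (-s)).prodCongr (Equiv.refl ℤ)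

/-- The action of `reflect s` on bonds. -/
def bondReflect (s : ℤ) : Bond ≃ Bond where
  toFun e := ((-s - e.1.1 - (if e.2 then 0 else 1), e.1.2), e.2)
  invFun e := ((-s - e.1.1 - (if e.2 then 0 else 1), e.1.2), e.2)
  left_inv := by rintro ⟨⟨a, b⟩, o⟩; cases o <;> simp; ring
  right_inv := by rintro ⟨⟨a, b⟩, o⟩; cases o <;> simp; ring

theorem isLatticeSymm_reflect (s : ℤ) : IsLatticeSymm (reflect s) (bondReflect s) := by
  rintro ⟨⟨a, b⟩, o⟩ ⟨u1, u2⟩ ⟨v1, v2⟩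
  cases o <;> simp [Joins, bondEnd, bondReflect, reflect]; omega

/-- The action on bonds of the exchange of coordinates. -/
def bondSwap : Bond ≃ Bond := (Equiv.prodComm ℤ ℤ).prodCongr Equiv.boolNot

theorem isLatticeSymm_swap : IsLatticeSymm (Equiv.prodComm ℤ ℤ) bondSwap := by
  rintro ⟨⟨a, b⟩, o⟩ ⟨u1, u2⟩ ⟨v1, v2⟩
  cases o <;> simp [Joins, bondEnd, bondSwap] <;> omega

/-! ### Duality -/

/-- The bond crossed by the dual bond `e`, where the dual vertex `(a, b)` is the centre of the unit
square with lower left corner `(a, b)`. -/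
def dualBond : Bond ≃ Bond where
  toFun e := if e.2 then ((e.1.1, e.1.2 + 1), false) else ((e.1.1 + 1, e.1.2), true)
  invFun e := if e.2 then ((e.1.1 - 1, e.1.2), false) else ((e.1.1, e.1.2 - 1), true)
  left_inv := by rintro ⟨⟨a, b⟩, o⟩; cases o <;> simp
  right_inv := by rintro ⟨⟨a, b⟩, o⟩; cases o <;> simp

/-- The dual configuration: a dual bond is open when the bond it crosses is closed. -/
def dual (ω : BondConfig) : BondConfig := fun e => !ω (dualBond e)

theorem measurable_dual : Measurable dual :=
  measurable_pi_lambda _ fun _ => (measurable_of_finite Bool.not).comp (measurable_pi_apply _)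

theorem map_dual_perc {p : ℝ} (hp : p ∈ Icc (0 : ℝ) 1) : (perc p).map dual = perc (1 - p) :=
  map_perc_reindex hp dualBond Equiv.boolNot fun b => by cases b <;> simp [bitWeight]

theorem perc_real_dual {p : ℝ} (hp : p ∈ Icc (0 : ℝ) 1) {A : Set BondConfig}
    (hA : MeasurableSet A) : (perc p).real (dual ⁻¹' A) = (perc (1 - p)).real A := by
  rw [← map_dual_perc hp, map_measureReal_apply measurable_dual hA]

theorem dual_anti (h : ω ≤ ω') : dual ω' ≤ dual ω := fun e => by
  have := h (dualBond e)
  simp only [dual]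
  revert this
  cases ω (dualBond e) <;> cases ω' (dualBond e) <;> simp

/-! ### Boxes and infinite clusters -/

/-- The box `[-k - s, k]²`. -/
def box (s k : ℤ) : Finset (ℤ × ℤ) := Finset.Icc (-k - s) k ×ˢ Finset.Icc (-k - s) k

theorem mem_box {s k : ℤ} {v : ℤ × ℤ} :
    v ∈ box s k ↔ (-k - s ≤ v.1 ∧ v.1 ≤ k) ∧ (-k - s ≤ v.2 ∧ v.2 ≤ k) := by
  simp [box, Finset.mem_product, Finset.mem_Icc]

theorem box_subset_box {s s' k k' : ℤ} (hs : k + s ≤ k' + s') (hk : k ≤ k') :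
    box s k ⊆ box s' k' := fun v hv => by
  rw [mem_box] at *
  omega

theorem exists_subset_box {S : Set (ℤ × ℤ)} (hS : S.Finite) (n : ℕ) :
    ∃ N : ℕ, n ≤ N ∧ S ⊆ box 0 N := by
  induction S, hS using Set.Finite.induction_on with
  | empty => exact ⟨n, le_rfl, by simp⟩
  | @insert a S _ _ ih =>
    obtain ⟨N, hn, hN⟩ := ih
    refine ⟨N + a.1.natAbs + a.2.natAbs, by omega, insert_subset ?_ (hN.trans ?_)⟩
    · simp only [Finset.mem_coe, mem_box]
      omega
    · exact Finset.coe_subset.2 (box_subset_box (by omega) (by omega))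

/-- The open cluster of `u`. -/
def openCluster (ω : BondConfig) (u : ℤ × ℤ) : Set (ℤ × ℤ) := {v | Conn ω univ u v}

theorem exists_infinite_iff (ω : BondConfig) (k : ℕ) :
    (∃ u ∈ box 0 k, (openCluster ω u).Infinite) ↔
      ∀ N : ℕ, k ≤ N → ω ∈ exitEvent (box 0 k) (box 0 N) (box 0 N : Set (ℤ × ℤ))ᶜ := by
  constructor
  · rintro ⟨u, hu, hinf⟩ N hN
    obtain ⟨v, hv, hvN⟩ := hinf.exists_notMem_finset (box 0 N)
    have hsub : box 0 k ⊆ box 0 N := box_subset_box (by omega) (by omega)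
    exact exitEvent_mono (singleton_subset_iff.2 hu) le_rfl (Conn.mem_exitEvent hv (hsub hu) hvN)
  · intro h
    by_contra! hfin
    have hS : (⋃ u ∈ box 0 k, openCluster ω u).Finite :=
      (box 0 k).finite_toSet.biUnion fun u hu => hfin u hu
    obtain ⟨N, hkN, hN⟩ := exists_subset_box hS k
    obtain ⟨u, hu, v, hv, w, hw, hc, ho⟩ := h N hkN
    refine hw (hN ?_)
    simp only [mem_iUnion]
    exact ⟨u, hu, (hc.mono le_rfl (subset_univ _)).trans (Conn.single ho trivial trivial)⟩

/-- The event that there is an infinite open cluster meeting the box of radius `k`. -/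
def infiniteFrom (k : ℕ) : Set BondConfig := {ω | ∃ u ∈ box 0 k, (openCluster ω u).Infinite}

theorem measurableSet_infiniteFrom (k : ℕ) : MeasurableSet (infiniteFrom k) := by
  have : infiniteFrom k = ⋂ N : ℕ, ⋂ _ : k ≤ N,
      exitEvent (box 0 k) (box 0 N) (box 0 N : Set (ℤ × ℤ))ᶜ := by
    ext ω
    simp only [mem_iInter]
    exact exists_infinite_iff ω k
  rw [this]
  exact MeasurableSet.iInter fun N => MeasurableSet.iInter fun _ => measurableSet_exitEvent _ _ _

/-- The event that there is an infinite open cluster. -/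
def percolates : Set BondConfig := {ω | ∃ u, (openCluster ω u).Infinite}

theorem percolates_eq : percolates = ⋃ k, infiniteFrom k := by
  ext ω
  simp only [mem_iUnion]
  constructor
  · rintro ⟨u, hu⟩
    obtain ⟨k, -, hk⟩ := exists_subset_box (finite_singleton u) 0
    exact ⟨k, u, by simpa using hk, hu⟩
  · rintro ⟨k, u, -, hu⟩
    exact ⟨u, hu⟩

theorem measurableSet_percolates : MeasurableSet percolates := by
  rw [percolates_eq]
  exact MeasurableSet.iUnion measurableSet_infiniteFrom

theorem percolates_mono (h : ω ≤ ω') (hω : ω ∈ percolates) : ω' ∈ percolates :=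
  let ⟨u, hu⟩ := hω
  ⟨u, hu.mono fun _ hv => hv.mono h le_rfl⟩

theorem percolates_of_update (ω : BondConfig) (e : Bond)
    (h : Function.update ω e true ∈ percolates) : Function.update ω e false ∈ percolates := by
  obtain ⟨u, hu⟩ := h
  by_contra hno
  have hfin : ∀ v, (openCluster (Function.update ω e false) v).Finite := fun v =>
    Set.not_infinite.1 fun hv => hno ⟨v, hv⟩
  refine hu (((hfin u).union ((hfin e.1).union (hfin (bondEnd e)))).subset ?_)
  intro v hv
  induction hv with
  | refl => exact Or.inl (Conn.refl _ _ _)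
  | @tail b c _ hstep ih =>
    obtain ⟨⟨e', hj, he'⟩, -⟩ := hstep
    by_cases hee : e' = e
    · subst hee
      rcases hj with ⟨-, rfl⟩ | ⟨rfl, -⟩
      · exact Or.inr (Or.inr (Conn.refl _ _ _))
      · exact Or.inr (Or.inl (Conn.refl _ _ _))
    · have hbc : Conn (Function.update ω e false) univ b c :=
        Conn.single ⟨e', hj, by simpa [hee] using he'⟩ trivial trivial
      rcases ih with h | h | h
      · exact Or.inl (h.trans hbc)
      · exact Or.inr (Or.inl (h.trans hbc))
      · exact Or.inr (Or.inr (h.trans hbc))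

theorem forced_percolates (e : Bond) (b : Bool) : forced percolates e b = percolates := by
  have key : ∀ ω : BondConfig, ∀ b b', Function.update ω e b ∈ percolates →
      Function.update ω e b' ∈ percolates := by
    intro ω b b' h
    have h1 : Function.update ω e false ∈ percolates := by
      cases b
      · exact h
      · exact percolates_of_update ω e h
    exact percolates_mono (update_le_update_bond le_rfl (Bool.false_le b') e) h1
  ext ω
  constructor
  · intro h
    have := key ω b (ω e) h
    rwa [Function.update_eq_self] at this
  · intro h
    exact key ω (ω e) b (by rwa [Function.update_eq_self])

theorem perc_percolates_zero_or_one {p : ℝ} (hp : p ∈ Icc (0 : ℝ) 1) :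
    perc p percolates = 0 ∨ perc p percolates = 1 :=
  perc_real_zero_or_one hp measurableSet_percolates forced_percolates

theorem exists_box_exit_prob {p : ℝ} (h : perc p percolates = 1) {ε : ℝ} (hε : 0 < ε) :
    ∃ k : ℕ, ∀ s : ℕ, ∀ N : ℕ, k ≤ N → 1 - ε <
      (perc p).real (exitEvent (box s k) (box s N) (box s N : Set (ℤ × ℤ))ᶜ) := by
  have hmono : Monotone infiniteFrom := fun k l hkl ω ⟨u, hu, hinf⟩ =>
    ⟨u, box_subset_box (by simpa using hkl) (by simpa using hkl) hu, hinf⟩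
  have ht := tendsto_measure_iUnion_atTop (μ := perc p) hmono
  rw [← percolates_eq, h] at ht
  have ht' := (ENNReal.tendsto_toReal ENNReal.one_ne_top).comp ht
  rw [ENNReal.toReal_one] at ht'
  obtain ⟨k, hk⟩ := (ht'.eventually (lt_mem_nhds (show 1 - ε < 1 by linarith))).exists
  refine ⟨k, fun s N hN => hk.trans_le ?_⟩
  refine measureReal_mono ?_ (by finiteness)
  rintro ω ⟨u, hu, hinf⟩
  obtain ⟨v, hv, hvN⟩ := hinf.exists_notMem_finset (box s N)
  have hks : box 0 k ⊆ box s k := box_subset_box (by simp) le_rfl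
  have hsub : box s k ⊆ box s N := box_subset_box (by omega) (by omega)
  exact exitEvent_mono (singleton_subset_iff.2 (hks hu)) le_rfl
    (Conn.mem_exitEvent hv (hsub (hks hu)) hvN)

end Lattice

section PlanarExclusion

variable {ω ω' : BondConfig} {U W X T : Set (ℤ × ℤ)} {u v w : ℤ × ℤ} {e : Bond}

/-! ### Planar exclusion of crossings -/

/-- The four directions of a step along an open bond. -/
theorem Op.cases (h : Op ω u v) :
    (v = (u.1 + 1, u.2) ∧ ω (u, false) = true) ∨ (v = (u.1, u.2 + 1) ∧ ω (u, true) = true) ∨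
      (u = (v.1 + 1, v.2) ∧ ω (v, false) = true) ∨ (u = (v.1, v.2 + 1) ∧ ω (v, true) = true) := by
  obtain ⟨⟨a, o⟩, hj, he⟩ := h
  cases o <;> simp only [Joins, bondEnd, if_true, Bool.false_eq_true, if_false] at hj
  · rcases hj with ⟨rfl, rfl⟩ | ⟨rfl, rfl⟩
    · exact Or.inl ⟨rfl, he⟩
    · exact Or.inr (Or.inr (Or.inl ⟨rfl, he⟩))
  · rcases hj with ⟨rfl, rfl⟩ | ⟨rfl, rfl⟩
    · exact Or.inr (Or.inl ⟨rfl, he⟩)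
    · exact Or.inr (Or.inr (Or.inr ⟨rfl, he⟩))

theorem dual_false (f : ℤ × ℤ) : dual ω (f, false) = !ω ((f.1 + 1, f.2), true) := rfl

theorem dual_true (f : ℤ × ℤ) : dual ω (f, true) = !ω ((f.1, f.2 + 1), false) := rfl

/-- `h` behaves like the parity of the number of crossings of the ray to the right of a vertex with
a dual path from `g` to `f` inside the vertical strip `[-N - 1, N] × ℤ`. -/
structure CrossingParity (ω : BondConfig) (N : ℤ) (g f : ℤ × ℤ) (h : ℤ × ℤ → Prop) : Prop where
  horizontal : ∀ v : ℤ × ℤ, ω (v, false) = true → (h v ↔ h (v.1 + 1, v.2))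
  vertical : ∀ v : ℤ × ℤ, ω (v, true) = true → ((h v ↔ h (v.1, v.2 + 1)) ↔
    ((g.2 = v.2 ∧ v.1 ≤ g.1) ↔ (f.2 = v.2 ∧ v.1 ≤ f.1)))
  right : ∀ v : ℤ × ℤ, N < v.1 → ¬ h v
  left : ∀ v : ℤ × ℤ, v.1 ≤ -N - 1 → (h v ↔ ¬ (v.2 ≤ g.2 ↔ v.2 ≤ f.2))

variable {N : ℤ} {g f : ℤ × ℤ} {h : ℤ × ℤ → Prop}

theorem CrossingParity.horizontal_step (H : CrossingParity ω N g f h) {f' : ℤ × ℤ}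
    (hrow : f'.2 = f.2)
    (hstep : ∀ v : ℤ × ℤ, ω (v, true) = true → v.2 = f.2 → (v.1 ≤ f.1 ↔ v.1 ≤ f'.1)) :
    CrossingParity ω N g f' h where
  horizontal := H.horizontal
  right := H.right
  left v hv := by rw [H.left v hv, hrow]
  vertical v hv := by
    rw [H.vertical v hv, hrow]
    refine iff_congr Iff.rfl ⟨fun hc => ⟨hc.1, ?_⟩, fun hc => ⟨hc.1, ?_⟩⟩
    · exact (hstep v hv hc.1.symm).1 hc.2
    · exact (hstep v hv hc.1.symm).2 hc.2

theorem CrossingParity.vertical_step (H : CrossingParity ω N g f h) {f' : ℤ × ℤ} {r : ℤ}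
    (hcol : f'.1 = f.1) (hrow : (f.2 = r - 1 ∧ f'.2 = r) ∨ (f.2 = r ∧ f'.2 = r - 1))
    (hclosed : ω ((f.1, r), false) = false) (hl : -N - 1 ≤ f.1) (hr : f.1 ≤ N) :
    CrossingParity ω N g f' fun v => (h v ↔ ¬ (v.2 = r ∧ v.1 ≤ f.1)) where
  horizontal v hv := by
    have h1 : v.2 = r ∧ v.1 ≤ f.1 ↔ v.2 = r ∧ v.1 + 1 ≤ f.1 := by
      refine ⟨fun hc => ⟨hc.1, ?_⟩, fun hc => ⟨hc.1, by omega⟩⟩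
      by_contra hlt
      have : v = (f.1, r) := Prod.ext (by simp; omega) hc.1
      rw [this, hclosed] at hv
      exact Bool.false_ne_true hv
    simp only [h1, H.horizontal v hv]
  right v hv := by
    have := H.right v hv
    have h2 : ¬ (v.2 = r ∧ v.1 ≤ f.1) := by omega
    tauto
  left v hv := by
    have h1 := H.left v hv
    have h2 : (v.2 = r ∧ v.1 ≤ f.1) ↔ ¬ (v.2 ≤ f.2 ↔ v.2 ≤ f'.2) := by omega
    tauto
  vertical v hv := by
    have h1 := H.vertical v hv
    have h2 : (¬ (v.2 = r ∧ v.1 ≤ f.1) ↔ ¬ (v.2 + 1 = r ∧ v.1 ≤ f.1)) ↔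
      ((f.2 = v.2 ∧ v.1 ≤ f.1) ↔ (f'.2 = v.2 ∧ v.1 ≤ f'.1)) := by
      rw [hcol]
      omega
    generalize (¬ (v.2 = r ∧ v.1 ≤ f.1)) = a at *
    generalize (¬ (v.2 + 1 = r ∧ v.1 ≤ f.1)) = b at *
    generalize (f.2 = v.2 ∧ v.1 ≤ f.1) = c at *
    generalize (f'.2 = v.2 ∧ v.1 ≤ f'.1) = d at *
    generalize (g.2 = v.2 ∧ v.1 ≤ g.1) = k at *
    generalize h v = x at *
    generalize h (v.1, v.2 + 1) = y at *
    by_cases a <;> by_cases b <;> by_cases c <;> by_cases d <;> by_cases k <;> by_cases x <;>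
      by_cases y <;> simp_all

theorem exists_crossingParity (hc : Conn (dual ω) {f | -N - 1 ≤ f.1 ∧ f.1 ≤ N} g f) :
    ∃ h, CrossingParity ω N g f h := by
  induction hc with
  | refl => exact ⟨fun _ => False, by simp, by simp, by simp, by simp⟩
  | @tail a b _ hstep ih =>
    obtain ⟨h, H⟩ := ih
    obtain ⟨hop, ⟨ha1, ha2⟩, -⟩ := hstep
    rcases hop.cases with ⟨rfl, ho⟩ | ⟨rfl, ho⟩ | ⟨rfl, ho⟩ | ⟨rfl, ho⟩
    · rw [dual_false, Bool.not_eq_true'] at ho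
      refine ⟨h, H.horizontal_step rfl fun v hv hrow => ?_⟩
      by_cases hva : v = (a.1 + 1, a.2)
      · rw [hva, ho] at hv
        exact absurd hv Bool.false_ne_true
      · have : v.1 ≠ a.1 + 1 := fun hh => hva (Prod.ext hh hrow)
        simp only
        omega
    · rw [dual_true, Bool.not_eq_true'] at ho
      exact ⟨_, H.vertical_step (r := a.2 + 1) rfl (Or.inl ⟨by ring, rfl⟩) ho ha1 ha2⟩
    · rw [dual_false, Bool.not_eq_true'] at ho
      refine ⟨h, H.horizontal_step rfl fun v hv hrow => ?_⟩
      by_cases hva : v = (b.1 + 1, b.2)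
      · rw [hva, ho] at hv
        exact absurd hv Bool.false_ne_true
      · have : v.1 ≠ b.1 + 1 := fun hh => hva (Prod.ext hh hrow)
        simp only
        omega
    · rw [dual_true, Bool.not_eq_true'] at ho
      exact ⟨_, H.vertical_step (r := b.2 + 1) rfl (Or.inr ⟨rfl, by ring⟩) ho ha1 ha2⟩

/-- A horizontal open crossing and a vertical dual open crossing exclude each other. -/
theorem not_crossings {g' w' : ℤ × ℤ} (hc : Conn ω {v | -N ≤ v.2 ∧ v.2 ≤ N} w w') (hw : N < w.1)
    (hw' : w'.1 < -N) (hw2 : -N ≤ w.2 ∧ w.2 ≤ N)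
    (hd : Conn (dual ω) {f | -N - 1 ≤ f.1 ∧ f.1 ≤ N} g g') (hg : N < g.2)
    (hg' : g'.2 < -N - 1) : False := by
  obtain ⟨h, H⟩ := exists_crossingParity hd
  have hvert : ∀ v : ℤ × ℤ, -N ≤ v.2 → v.2 + 1 ≤ N → ω (v, true) = true →
      (h v ↔ h (v.1, v.2 + 1)) := fun v h1 h2 hv => by
    rw [H.vertical v hv]
    exact iff_of_false (fun hc => by omega) fun hc => by omega
  have hconst : ¬ h w' ∧ (-N ≤ w'.2 ∧ w'.2 ≤ N) := by
    clear hw'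
    induction hc with
    | refl => exact ⟨H.right w hw, hw2⟩
    | @tail a b _ hstep ih =>
      obtain ⟨hop, ha, hb⟩ := hstep
      refine ⟨?_, hb⟩
      have ih := ih.1
      rcases hop.cases with ⟨rfl, ho⟩ | ⟨rfl, ho⟩ | ⟨rfl, ho⟩ | ⟨rfl, ho⟩
      · rwa [← H.horizontal a ho]
      · rwa [← hvert a ha.1 hb.2 ho]
      · rwa [H.horizontal b ho]
      · rwa [hvert b hb.1 ha.2 ho]
  refine hconst.1 ((H.left w' (by omega)).2 ?_)
  omega

end PlanarExclusion

section Arms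

variable {ω ω' : BondConfig} {U W X T : Set (ℤ × ℤ)} {u v w : ℤ × ℤ} {e : Bond} {N : ℤ}

/-! ### Closing a block separates two arms -/

theorem Op.near (h : Op ω u v) :
    (u.1 - 1 ≤ v.1 ∧ v.1 ≤ u.1 + 1) ∧ (u.2 - 1 ≤ v.2 ∧ v.2 ≤ u.2 + 1) := by
  rcases h.cases with ⟨rfl, -⟩ | ⟨rfl, -⟩ | ⟨rfl, -⟩ | ⟨rfl, -⟩ <;> simp <;> omega

theorem conn_horizontal {x x' y : ℤ} (hx : x ≤ x') (hW : ∀ t, x ≤ t → t ≤ x' → (t, y) ∈ W) :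
    Conn (fun _ => true) W (x, y) (x', y) := by
  induction x', hx using Int.leInduction with
  | base => exact Conn.refl _ _ _
  | succ k hk ih =>
    refine (ih fun t h1 h2 => hW t h1 (by omega)).trans (Conn.single ?_ (hW _ hk (by omega))
      (hW _ (by omega) le_rfl))
    exact ⟨((k, y), false), Or.inl ⟨rfl, rfl⟩, rfl⟩

theorem conn_vertical {x y y' : ℤ} (hy : y ≤ y') (hW : ∀ t, y ≤ t → t ≤ y' → (x, t) ∈ W) :
    Conn (fun _ => true) W (x, y) (x, y') := by
  induction y', hy using Int.leInduction with
  | base => exact Conn.refl _ _ _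
  | succ k hk ih =>
    refine (ih fun t h1 h2 => hW t h1 (by omega)).trans (Conn.single ?_ (hW _ hk (by omega))
      (hW _ (by omega) le_rfl))
    exact ⟨((x, k), true), Or.inl ⟨rfl, rfl⟩, rfl⟩

/-- Rectangles, bounded or not, are connected. -/
theorem conn_prod {I J : Set ℤ} (hI : I.OrdConnected) (hJ : J.OrdConnected) (hu : u ∈ I ×ˢ J)
    (hv : v ∈ I ×ˢ J) : Conn (fun _ => true) (I ×ˢ J) u v := by
  obtain ⟨u1, u2⟩ := u
  obtain ⟨v1, v2⟩ := v
  have h1 : Conn (fun _ => true) (I ×ˢ J) (u1, u2) (v1, u2) := by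
    rcases le_total u1 v1 with h | h
    · exact conn_horizontal h fun t ht ht' => ⟨hI.out hu.1 hv.1 ⟨ht, ht'⟩, hu.2⟩
    · exact (conn_horizontal (W := I ×ˢ J) h fun t ht ht' => ⟨hI.out hv.1 hu.1 ⟨ht, ht'⟩, hu.2⟩).symm
  have h2 : Conn (fun _ => true) (I ×ˢ J) (v1, u2) (v1, v2) := by
    rcases le_total u2 v2 with h | h
    · exact conn_vertical h fun t ht ht' => ⟨hv.1, hJ.out hu.2 hv.2 ⟨ht, ht'⟩⟩
    · exact (conn_vertical (W := I ×ˢ J) h fun t ht ht' => ⟨hv.1, hJ.out hv.2 hu.2 ⟨ht, ht'⟩⟩).symm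
  exact h1.trans h2

theorem conn_box {s k : ℤ} (hω : ∀ e, e.1 ∈ box s k → bondEnd e ∈ box s k → ω e = true)
    (hu : u ∈ box s k) (hv : v ∈ box s k) : Conn ω (box s k) u v := by
  have h : (box s k : Set (ℤ × ℤ)) = Icc (-k - s) k ×ˢ Icc (-k - s) k := by
    simp [box]
  have hu' : u ∈ (box s k : Set (ℤ × ℤ)) := hu
  have hv' : v ∈ (box s k : Set (ℤ × ℤ)) := hv
  rw [h] at hu' hv'
  refine (conn_prod ordConnected_Icc ordConnected_Icc hu' hv').congr ?_ h.ge
  intro e h1 h2 _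
  rw [← h] at h1 h2
  exact hω e h1 h2

/-- The vertices of `W` having a neighbour outside `W`. -/
def bdry (W : Finset (ℤ × ℤ)) : Finset (ℤ × ℤ) :=
  open Classical in W.filter fun v => ∃ w ∉ W, ∃ e, Joins e v w

theorem mem_bdry {W : Finset (ℤ × ℤ)} : v ∈ bdry W ↔ v ∈ W ∧ ∃ w ∉ W, ∃ e, Joins e v w := by
  classical
  simp [bdry]

theorem setOn_false_le_true (B : Finset Bond) (ω : BondConfig) : setOn B false ω ≤ setOn B true ω :=
  fun e => by
    by_cases h : e ∈ B <;> simp [setOn, h]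

theorem setOn_false_le (B : Finset Bond) (ω : BondConfig) : setOn B false ω ≤ ω :=
  fun e => by
    by_cases h : e ∈ B <;> simp [setOn, h]

theorem le_setOn_true (B : Finset Bond) (ω : BondConfig) : ω ≤ setOn B true ω :=
  fun e => by
    by_cases h : e ∈ B <;> simp [setOn, h, Bool.le_true]

theorem setOn_touching_of_notMem {B : Finset (ℤ × ℤ)} {b : Bool} (h1 : e.1 ∉ B)
    (h2 : bondEnd e ∉ B) : setOn (touching B) b ω e = ω e := by
  have : e ∉ touching B := by
    rw [mem_touching]
    tauto
  simp [setOn, this]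

theorem Op.setOn_touching {B : Finset (ℤ × ℤ)} (b : Bool) (h : Op ω u v) (hu : u ∉ B)
    (hv : v ∉ B) : Op (setOn (touching B) b ω) u v := by
  obtain ⟨e, hj, he⟩ := h
  obtain ⟨h1, h2⟩ := hj.inside (W := (B : Set (ℤ × ℤ))ᶜ) hu hv
  exact ⟨e, hj, by rw [setOn_touching_of_notMem h1 h2, he]⟩

theorem Conn.setOn_touching {B : Finset (ℤ × ℤ)} (b : Bool)
    (h : Conn ω (X ∩ (B : Set (ℤ × ℤ))ᶜ) u v) :
    Conn (setOn (touching B) b ω) (X ∩ (B : Set (ℤ × ℤ))ᶜ) u v := by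
  refine h.congr (fun e h1 h2 he => ?_) le_rfl
  rw [setOn_touching_of_notMem h1.2 h2.2, he]

variable {n : ℤ}

/-- An arm from the block to the outside of the large box visits the boundary of any intermediate
region. -/
theorem exists_arm {W : Finset (ℤ × ℤ)} (hn : box 0 (n + 1) ⊆ W) (hN : W ⊆ box 0 N) (hnN : n < N)
    (h : ω ∈ exitEvent (box 0 n) (box 0 N) T) (hT : T ⊆ (box 0 N : Set (ℤ × ℤ))ᶜ) :
    ∃ c ∈ bdry W, ∃ a ∈ box 0 n, ∃ v ∈ box 0 N, ∃ w ∈ T,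
      Conn (setOn (touching (box 0 n)) true ω) W a c ∧
      Conn (setOn (touching (box 0 n)) false ω) (box 0 N) c v ∧
      Op (setOn (touching (box 0 n)) false ω) v w := by
  obtain ⟨u, hu, v, hv, w, hw, hc, ho⟩ := h
  have hwN : w ∉ box 0 N := hT hw
  have hsub : box 0 n ⊆ box 0 N := box_subset_box (by omega) (by omega)
  have hvn : v ∉ box 0 n := fun hvn => hwN <| by
    have := ho.near
    rw [mem_box] at hvn ⊢
    omega
  obtain ⟨a, ha, b, hb, -, hbN, -, hab, hbv⟩ :=
    hc.last_exit (W := (box 0 n : Set (ℤ × ℤ))) hu hvn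
  have hbW : b ∈ W := hn <| by
    have := hab.near
    have ha' : a ∈ box 0 n := ha
    rw [mem_box] at ha' ⊢
    omega
  have hovw := ho.setOn_touching false hvn fun hwn => hwN (hsub hwn)
  have hbv0 := hbv.setOn_touching false
  have haW : a ∈ W := hn (box_subset_box (by omega) (by omega) ha)
  have hab1 : Conn (setOn (touching (box 0 n)) true ω) W a b :=
    Conn.single (hab.mono (le_setOn_true _ _)) haW hbW
  obtain hbv1 | ⟨c, hcW, d, hd, hcN, hdN, h1, h2, h3⟩ :=
    hbv0.inside_or_exit (W := (W : Set (ℤ × ℤ))) hbW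
  · have hvW : v ∈ W := Conn.mem (hbv1.mono le_rfl inter_subset_right) hbW
    refine ⟨v, mem_bdry.2 ⟨hvW, w, fun hwW => hwN (hN hwW), ?_⟩, a, ha, v, hv, w, hw,
      hab1.trans (hbv1.mono (setOn_false_le_true _ _) inter_subset_right), Conn.refl _ _ _, hovw⟩
    obtain ⟨e, he, -⟩ := ho
    exact ⟨e, he⟩
  · refine ⟨c, mem_bdry.2 ⟨hcW, d, hd, ?_⟩, a, ha, v, hv, w, hw,
      hab1.trans (h1.mono (setOn_false_le_true _ _) inter_subset_right),
      (Conn.single h2 hcN.1 hdN.1).trans (h3.mono le_rfl inter_subset_left), hovw⟩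
    obtain ⟨e, he, -⟩ := h2
    exact ⟨e, he⟩

/-- The event that the block of radius `n` has open arms to the left and to the right of the box of
radius `N`, and dual open arms to the top and to the bottom. -/
def fourArms (n N : ℤ) : Set BondConfig :=
  (exitEvent (box 0 n) (box 0 N) {w | N < w.1} ∩ exitEvent (box 0 n) (box 0 N) {w | w.1 < -N}) ∩
    dual ⁻¹' (exitEvent (box 1 n) (box 1 N) {w | N < w.2} ∩
      exitEvent (box 1 n) (box 1 N) {w | w.2 < -N - 1})

/-- On the four arms event, the two open arms get connected when the block is opened, and
disconnected when it is closed. -/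
theorem exists_split {W : Finset (ℤ × ℤ)} (hn : box 0 (n + 1) ⊆ W) (hN : W ⊆ box 0 N) (hnN : n < N)
    (h : ω ∈ fourArms n N) : ∃ a ∈ bdry W, ∃ b ∈ bdry W,
      Conn (setOn (touching (box 0 n)) true ω) W a b ∧
      ¬ Conn (setOn (touching (box 0 n)) false ω) W a b := by
  obtain ⟨⟨hR, hL⟩, hT, hB⟩ := h
  have hout : ∀ {w : ℤ × ℤ}, N < w.1 ∨ w.1 < -N → w ∈ (box 0 N : Set (ℤ × ℤ))ᶜ := fun hw hwN => by
    have hwN' := mem_box.1 hwN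
    omega
  obtain ⟨c, hc, a, ha, v, hv, w, hw, hac, hcv, hvw⟩ :=
    exists_arm hn hN hnN hR fun w hw => hout (Or.inl hw)
  obtain ⟨c', hc', a', ha', v', hv', w', hw', hac', hcv', hvw'⟩ :=
    exists_arm hn hN hnN hL fun w hw => hout (Or.inr hw)
  have hsub : box 0 n ⊆ W := (box_subset_box (by omega) (by omega)).trans hn
  refine ⟨c, hc, c', hc', ?_, fun hcc => ?_⟩
  · refine hac.symm.trans (Conn.trans (Conn.mono le_rfl ?_ (conn_box (fun e he _ => ?_) ha ha'))
      hac')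
    · exact Finset.coe_subset.2 hsub
    · rw [setOn, if_pos (mem_touching.2 (Or.inl he))]
  · obtain ⟨f, hf, g, hg, k, hk, hfg, hgk⟩ := hT
    obtain ⟨f', hf', g', hg', k', hk', hfg', hgk'⟩ := hB
    have hle := dual_anti (setOn_false_le (touching (box 0 n)) ω)
    have hff : Conn (dual (setOn (touching (box 0 n)) false ω)) (box 1 n) f f' := by
      refine conn_box (fun e h1 h2 => ?_) hf hf'
      obtain ⟨⟨x, y⟩, o⟩ := e
      have ht : dualBond ((x, y), o) ∈ touching (box 0 n) := by
        rw [mem_touching]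
        cases o <;> simp only [dualBond, bondEnd, mem_box, Equiv.coe_fn_mk, if_true, if_false,
          Bool.false_eq_true] at * <;> omega
      simp [dual, setOn, ht]
    have hd : Conn (dual (setOn (touching (box 0 n)) false ω)) {f | -N - 1 ≤ f.1 ∧ f.1 ≤ N} k k' := by
      have hbox : (box 1 N : Set (ℤ × ℤ)) ⊆ {f | -N - 1 ≤ f.1 ∧ f.1 ≤ N} := fun f hf =>
        (mem_box.1 hf).1
      have hstep : ∀ {a b : ℤ × ℤ}, Op (dual ω) a b → a ∈ box 1 N → (N < b.2 ∨ b.2 < -N - 1) →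
          Conn (dual (setOn (touching (box 0 n)) false ω)) {f | -N - 1 ≤ f.1 ∧ f.1 ≤ N} a b := by
        intro a b hab ha hb
        have ha' := mem_box.1 ha
        refine Conn.single (hab.mono hle) ha'.1 ?_
        rcases hab.cases with ⟨rfl, -⟩ | ⟨rfl, -⟩ | ⟨rfl, -⟩ | ⟨rfl, -⟩ <;>
          simp only [mem_ofPred_eq] at * <;> omega
      have h1 := (hfg.mono hle hbox).trans (hstep hgk hg (Or.inl hk))
      have h2 := (hfg'.mono hle hbox).trans (hstep hgk' hg' (Or.inr hk'))
      refine h1.symm.trans (Conn.trans (hff.mono le_rfl (Subset.trans ?_ hbox)) h2)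
      exact Finset.coe_subset.2 (box_subset_box (by omega) (by omega))
    have hbox : (box 0 N : Set (ℤ × ℤ)) ⊆ {f | -N ≤ f.2 ∧ f.2 ≤ N} := fun f hf => by
      have := mem_box.1 hf
      simp only [mem_ofPred_eq]
      omega
    have hstep : ∀ {a b : ℤ × ℤ}, Op (setOn (touching (box 0 n)) false ω) a b → a ∈ box 0 N →
        (N < b.1 ∨ b.1 < -N) → b.2 = a.2 := by
      intro a b hab ha hb
      have ha' := mem_box.1 ha
      rcases hab.cases with ⟨rfl, -⟩ | ⟨rfl, -⟩ | ⟨rfl, -⟩ | ⟨rfl, -⟩ <;> simp only at * <;> omega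
    have hw2 := hstep hvw hv (Or.inl hw)
    have hw2' := hstep hvw' hv' (Or.inr hw')
    have hv2 := hbox hv
    have hv2' := hbox hv'
    have hcc' := (hcv.symm.trans (Conn.trans (hcc.mono le_rfl (Finset.coe_subset.2 hN)) hcv')).mono
      le_rfl hbox
    refine not_crossings (((Conn.single hvw hv2 ?_).symm.trans hcc').trans
      (Conn.single hvw' hv2' ?_)) hw hw' ?_ hd hk hk'
    · rw [mem_ofPred_eq, hw2]; exact hv2
    · rw [mem_ofPred_eq, hw2']; exact hv2'
    · rw [hw2]; exact hv2

end Arms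

section FourArms

variable {ω ω' : BondConfig} {U X T : Set (ℤ × ℤ)} {u v w : ℤ × ℤ} {e : Bond} {N n : ℤ}
  {p r : ℝ} {W : Finset (ℤ × ℤ)}

/-! ### Counting the clusters of a box that meet its boundary -/

/-- The number of open clusters of `W` meeting the boundary of `W`. -/
def clusterCount (W : Finset (ℤ × ℤ)) (ω : BondConfig) : ℕ :=
  open Classical in ((bdry W).image fun v => {x | Conn ω W v x}).card

theorem clusterCount_le (W : Finset (ℤ × ℤ)) (ω : BondConfig) :
    clusterCount W ω ≤ (bdry W).card := by
  classical
  exact Finset.card_image_le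

theorem image_clusters_of_le (h : ω ≤ ω') (v : ℤ × ℤ) :
    (⋃ y ∈ {x | Conn ω W v x}, {x | Conn ω' W y x}) = {x | Conn ω' W v x} := by
  ext x
  simp only [mem_iUnion, mem_ofPred_eq, exists_prop]
  exact ⟨fun ⟨y, h1, h2⟩ => (h1.mono h le_rfl).trans h2, fun hx => ⟨v, Conn.refl _ _ _, hx⟩⟩

theorem image_image_clusters (h : ω ≤ ω') : open Classical in
    ((bdry W).image fun v => {x | Conn ω W v x}).image (fun S => ⋃ y ∈ S, {x | Conn ω' W y x}) =
      (bdry W).image fun v => {x | Conn ω' W v x} := by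
  classical
  rw [Finset.image_image]
  exact Finset.image_congr fun v _ => image_clusters_of_le h v

theorem clusterCount_anti (W : Finset (ℤ × ℤ)) : Antitone (clusterCount W) := fun ω ω' h => by
  classical
  rw [clusterCount, ← image_image_clusters h]
  exact Finset.card_image_le

theorem clusterCount_lt (h : ω ≤ ω') (hu : u ∈ bdry W) (hv : v ∈ bdry W) (huv : Conn ω' W u v)
    (huv' : ¬ Conn ω W u v) : clusterCount W ω' < clusterCount W ω := by
  classical
  refine lt_of_le_of_ne (clusterCount_anti W h) fun heq => huv' ?_
  rw [clusterCount, ← image_image_clusters h] at heq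
  have hinj := Finset.card_image_iff.1 heq
  have := hinj (Finset.mem_coe.2 (Finset.mem_image_of_mem _ hu))
    (Finset.mem_coe.2 (Finset.mem_image_of_mem _ hv)) ?_
  · have hv' : v ∈ {x | Conn ω W v x} := Conn.refl _ _ _
    rw [← this] at hv'
    exact hv'
  · simp only [image_clusters_of_le h]
    ext x
    exact ⟨fun hx => huv.symm.trans hx, fun hx => huv.trans hx⟩

theorem dependsOn_clusterCount (W : Finset (ℤ × ℤ)) :
    DependsOn (fun ω => (clusterCount W ω : ℝ)) (touching W : Set Bond) := fun ω ω' h => by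
  have hW : ∀ e, e.1 ∈ W → ω e = ω' e := fun e he => h e (mem_touching.2 (Or.inl he))
  have : ∀ v, {x | Conn ω W v x} = {x | Conn ω' W v x} := fun v => by
    ext x
    exact ⟨fun hx => hx.congr (fun e he _ heq => by rw [← hW e he, heq]) le_rfl,
      fun hx => hx.congr (fun e he _ heq => by rw [hW e he, heq]) le_rfl⟩
  simp only [clusterCount, this]

theorem card_bdry_box_le (M : ℕ) : (bdry (box 0 M)).card ≤ 8 * M + 4 := by
  have hsub : bdry (box 0 M) ⊆ ({-(M : ℤ), (M : ℤ)} ×ˢ Finset.Icc (-(M : ℤ)) M) ∪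
      (Finset.Icc (-(M : ℤ)) M ×ˢ {-(M : ℤ), (M : ℤ)}) := fun v hv => by
    obtain ⟨hv, w, hw, e, he⟩ := mem_bdry.1 hv
    have hnear := Op.near (ω := fun _ => true) ⟨e, he, rfl⟩
    rw [mem_box] at hv hw
    simp only [Finset.mem_union, Finset.mem_product, Finset.mem_insert, Finset.mem_singleton,
      Finset.mem_Icc]
    omega
  refine (Finset.card_le_card hsub).trans ((Finset.card_union_le _ _).trans ?_)
  rw [Finset.card_product, Finset.card_product, Int.card_Icc]
  have h2 : ({-(M : ℤ), (M : ℤ)} : Finset ℤ).card ≤ 2 := Finset.card_le_two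
  have h3 : ((M : ℤ) + 1 - -(M : ℤ)).toNat = 2 * M + 1 := by omega
  rw [h3]
  nlinarith

/-! ### The probability of the four arms event -/

theorem perc_real_inter_ge (p : ℝ) {A B : Set BondConfig} (hB : MeasurableSet B) :
    (perc p).real A + (perc p).real B - 1 ≤ (perc p).real (A ∩ B) := by
  have h1 := measureReal_union_add_inter (μ := perc p) (s := A) hB
  have h2 : (perc p).real (A ∪ B) ≤ 1 := measureReal_le_one
  linarith

theorem perc_real_union_le (hp : p ∈ Icc (0 : ℝ) 1) (F : Finset Bond) {A B : Set BondConfig}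
    (hA : Determined A (F : Set Bond)) (hB : Determined B (F : Set Bond)) (hAu : IsUpperSet A)
    (hBu : IsUpperSet B) :
    (1 - (perc p).real A) * (1 - (perc p).real B) ≤ 1 - (perc p).real (A ∪ B) := by
  have h1 := measureReal_union_add_inter (μ := perc p) (s := A) hB.measurableSet
  have h2 := perc_real_mul_le_inter hp F hA hB hAu hBu
  linarith

theorem exitEvent_union {U W T T' : Set (ℤ × ℤ)} :
    exitEvent U W (T ∪ T') = exitEvent U W T ∪ exitEvent U W T' := by
  ext ω
  constructor
  · rintro ⟨u, hu, v, hv, w, hw | hw, h⟩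
    · exact Or.inl ⟨u, hu, v, hv, w, hw, h⟩
    · exact Or.inr ⟨u, hu, v, hv, w, hw, h⟩
  · rintro (⟨u, hu, v, hv, w, hw, h⟩ | ⟨u, hu, v, hv, w, hw, h⟩)
    · exact ⟨u, hu, v, hv, w, Or.inl hw, h⟩
    · exact ⟨u, hu, v, hv, w, Or.inr hw, h⟩

theorem preimage_swap_box (s k : ℤ) :
    (box s k : Set (ℤ × ℤ)) = Equiv.prodComm ℤ ℤ ⁻¹' (box s k) := by
  ext v
  simp only [mem_preimage, Finset.mem_coe, mem_box, Equiv.prodComm_apply, Prod.fst_swap,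
    Prod.snd_swap]
  tauto

theorem preimage_reflect_box (s k : ℤ) :
    (box s k : Set (ℤ × ℤ)) = reflect s ⁻¹' (box s k) := by
  ext v
  simp only [mem_preimage, Finset.mem_coe, mem_box, reflect, Equiv.prodCongr_apply, Prod.map,
    Equiv.subLeft_apply, Equiv.refl_apply]
  omega

/-- By symmetry, an arm to a given side of a box is likely as soon as an arm to the outside is. -/
theorem side_arms (hp : p ∈ Icc (0 : ℝ) 1) (s n N : ℤ) (h : 1 - 1 / 4096 <
    (perc p).real (exitEvent (box s n) (box s N) (box s N : Set (ℤ × ℤ))ᶜ)) :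
    7 / 8 ≤ (perc p).real (exitEvent (box s n) (box s N) {w | N < w.1}) ∧
    7 / 8 ≤ (perc p).real (exitEvent (box s n) (box s N) {w | w.1 < -N - s}) ∧
    7 / 8 ≤ (perc p).real (exitEvent (box s n) (box s N) {w | N < w.2}) ∧
    7 / 8 ≤ (perc p).real (exitEvent (box s n) (box s N) {w | w.2 < -N - s}) := by
  have hL : (perc p).real (exitEvent (box s n) (box s N) {w | w.1 < -N - s}) =
      (perc p).real (exitEvent (box s n) (box s N) {w | N < w.1}) := by
    rw [← (isLatticeSymm_reflect s).perc_real_exitEvent hp (preimage_reflect_box s N),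
      ← preimage_reflect_box]
    congr 2
    ext w
    simp only [mem_ofPred_eq, mem_preimage, reflect, Equiv.prodCongr_apply, Prod.map,
      Equiv.subLeft_apply]
    omega
  have hswap : ∀ T, (perc p).real (exitEvent (box s n) (box s N) (Equiv.prodComm ℤ ℤ ⁻¹' T)) =
      (perc p).real (exitEvent (box s n) (box s N) T) := fun T => by
    conv_rhs => rw [← isLatticeSymm_swap.perc_real_exitEvent hp (preimage_swap_box s N),
      ← preimage_swap_box]
  have hT := hswap {w | N < w.1}
  have hB := hswap {w | w.1 < -N - s}
  rw [hL] at hB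
  have hT' : Equiv.prodComm ℤ ℤ ⁻¹' {w | N < w.1} = {w | N < w.2} := rfl
  have hB' : Equiv.prodComm ℤ ℤ ⁻¹' {w | w.1 < -N - s} = {w | w.2 < -N - s} := rfl
  rw [hT'] at hT
  rw [hB'] at hB
  have hcompl : (box s N : Set (ℤ × ℤ))ᶜ = ({w | N < w.1} ∪ {w | w.1 < -N - s}) ∪
      ({w | N < w.2} ∪ {w | w.2 < -N - s}) := by
    ext w
    simp only [mem_compl_iff, Finset.mem_coe, mem_box, mem_union, mem_ofPred_eq]
    omega
  rw [hcompl, exitEvent_union] at h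
  have hdet : ∀ T, Determined (exitEvent (box s n) (box s N) T) (touching (box s N) : Set Bond) :=
    fun T => determined_exitEvent _ _ _
  have hup : ∀ T, IsUpperSet (exitEvent (box s n : Set (ℤ × ℤ)) (box s N) T) := fun T =>
    isUpperSet_exitEvent _ _ _
  have h1 := perc_real_union_le hp _ (hdet ({w | N < w.1} ∪ {w | w.1 < -N - s}))
    (hdet ({w | N < w.2} ∪ {w | w.2 < -N - s})) (hup _) (hup _)
  have h2 := perc_real_union_le hp _ (hdet {w | N < w.1}) (hdet {w | w.1 < -N - s}) (hup _) (hup _)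
  have h3 := perc_real_union_le hp _ (hdet {w | N < w.2}) (hdet {w | w.2 < -N - s}) (hup _) (hup _)
  rw [← exitEvent_union, hL] at h2
  rw [← exitEvent_union, hT, hB] at h3
  rw [hL, hT, hB]
  set x := (perc p).real (exitEvent (box s n) (box s N) {w | N < w.1})
  suffices 7 / 8 ≤ x from ⟨this, this, this, this⟩
  by_contra! hx
  have h4 : (1 / 8 : ℝ) ^ 2 ≤ (1 - x) * (1 - x) := by nlinarith
  nlinarith [mul_le_mul (h4.trans h2) (h4.trans h3) (by norm_num) ((by norm_num : (0:ℝ) ≤ (1/8)^2).trans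
    (h4.trans h2))]

theorem measurableSet_fourArms (n N : ℤ) : MeasurableSet (fourArms n N) :=
  ((measurableSet_exitEvent _ _ _).inter (measurableSet_exitEvent _ _ _)).inter
    (measurable_dual ((measurableSet_exitEvent _ _ _).inter (measurableSet_exitEvent _ _ _)))

theorem perc_real_fourArms (hp : p ∈ Icc (0 : ℝ) 1)
    (hr : r ∈ Icc p (1 - p)) (n N : ℤ) (h : ∀ s ∈ ({0, 1} : Set ℤ), 1 - 1 / 4096 <
      (perc p).real (exitEvent (box s n) (box s N) (box s N : Set (ℤ × ℤ))ᶜ)) :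
    1 / 2 ≤ (perc r).real (fourArms n N) := by
  have hr' : r ∈ Icc (0 : ℝ) 1 := ⟨hp.1.trans hr.1, hr.2.trans (by linarith [hp.1])⟩
  have hr'' : 1 - r ∈ Icc (0 : ℝ) 1 := ⟨by linarith [hr'.2], by linarith [hr'.1]⟩
  have hmono : ∀ q ∈ Icc (0 : ℝ) 1, p ≤ q → ∀ s ∈ ({0, 1} : Set ℤ), 1 - 1 / 4096 <
      (perc q).real (exitEvent (box s n) (box s N) (box s N : Set (ℤ × ℤ))ᶜ) :=
    fun q hq hpq s hs => (h s hs).trans_le (perc_real_mono hp hq hpq _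
      (determined_exitEvent _ _ _) (isUpperSet_exitEvent _ _ _))
  obtain ⟨h1, h2, -, -⟩ := side_arms hr' 0 n N (hmono r hr' hr.1 0 (by simp))
  obtain ⟨-, -, h3, h4⟩ := side_arms hr'' 1 n N (hmono (1 - r) hr'' (by linarith [hr.2]) 1 (by simp))
  rw [sub_zero] at h2
  rw [← perc_real_dual hr' (measurableSet_exitEvent _ _ _)] at h3 h4
  have hm : ∀ T, MeasurableSet (dual ⁻¹' exitEvent (box 1 n) (box 1 N) T) := fun T =>
    measurable_dual (measurableSet_exitEvent _ _ _)
  have h5 := perc_real_inter_ge r (A := exitEvent (box 0 n) (box 0 N) {w | N < w.1})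
    (measurableSet_exitEvent (box 0 n) {w | w.1 < -N} (box 0 N))
  have h6 := perc_real_inter_ge r (A := dual ⁻¹' exitEvent (box 1 n) (box 1 N) {w | N < w.2})
    (hm {w | w.2 < -N - 1})
  have h7 := perc_real_inter_ge r (A := exitEvent (box 0 n) (box 0 N) {w | N < w.1} ∩
    exitEvent (box 0 n) (box 0 N) {w | w.1 < -N}) ((hm {w | N < w.2}).inter (hm {w | w.2 < -N - 1}))
  rw [fourArms, preimage_inter]
  linarith

end FourArms

section Subcritical

variable {ω ω' : BondConfig} {U X T : Set (ℤ × ℤ)} {u v w : ℤ × ℤ} {e : Bond} {N n : ℤ}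
  {p r : ℝ} {W : Finset (ℤ × ℤ)}

/-! ### Absence of percolation below one half -/

/-- The bonds touching the block of radius `n` around `x`. -/
def block (n : ℤ) (x : ℤ × ℤ) : Finset Bond := (touching (box 0 n)).map (bondShift x).toEmbedding

theorem bondShift_mem_block (n : ℤ) (x : ℤ × ℤ) :
    bondShift x e ∈ block n x ↔ e ∈ touching (box 0 n) := by
  simp [block]

theorem exists_near_of_mem_block {x : ℤ × ℤ} (he : e ∈ block n x) :
    (x.1 - n - 1 ≤ e.1.1 ∧ e.1.1 ≤ x.1 + n) ∧ (x.2 - n - 1 ≤ e.1.2 ∧ e.1.2 ≤ x.2 + n) := by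
  obtain ⟨⟨⟨a, b⟩, o⟩, he', rfl⟩ := Finset.mem_map.1 he
  rw [mem_touching, mem_box, mem_box] at he'
  cases o <;> simp only [bondEnd, bondShift, if_true, if_false, Bool.false_eq_true,
    Equiv.coe_toEmbedding, Equiv.prodCongr_apply, Prod.map, Equiv.coe_addRight, Prod.fst_add,
    Prod.snd_add] at * <;> omega

theorem clusterCount_block_lt {x : ℤ × ℤ}
    (hn : ∀ v ∈ box 0 (n + 1), v + x ∈ W) (hN : ∀ v, v + x ∈ W → v ∈ box 0 N) (hnN : n < N)
    (h : (fun e => ω (bondShift x e)) ∈ fourArms n N) :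
    clusterCount W (setOn (block n x) true ω) < clusterCount W (setOn (block n x) false ω) := by
  set W' : Finset (ℤ × ℤ) := W.map (Equiv.addRight x).symm.toEmbedding with hW'
  have hmem : ∀ v, v ∈ W' ↔ v + x ∈ W := fun v => by
    rw [hW', Finset.mem_map_equiv]
    simp
  have hpre : (Equiv.addRight x) ⁻¹' (W : Set (ℤ × ℤ)) = W' := by
    ext v
    rw [Finset.mem_coe, hmem]
    rfl
  have hsymm := isLatticeSymm_shift x
  have hset : ∀ b, setOn (touching (box 0 n)) b (fun e => ω (bondShift x e)) =
      fun e => setOn (block n x) b ω (bondShift x e) := fun b => by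
    ext e
    simp [setOn, bondShift_mem_block]
  have hbdry : ∀ v, v ∈ bdry W' → v + x ∈ bdry W := fun v hv => by
    obtain ⟨hv, w, hw, e, he⟩ := mem_bdry.1 hv
    exact mem_bdry.2 ⟨(hmem v).1 hv, w + x, fun hwx => hw ((hmem w).2 hwx), bondShift x e,
      (hsymm e v w).2 he⟩
  obtain ⟨a, ha, b, hb, h1, h2⟩ := exists_split (fun v hv => (hmem v).2 (hn v hv))
    (fun v hv => hN v ((hmem v).1 hv)) hnN h
  rw [hset, ← hpre] at h1 h2
  exact clusterCount_lt (setOn_false_le_true _ _) (hbdry a ha) (hbdry b hb) (hsymm.conn.2 h1)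
    fun hc => h2 (hsymm.conn.1 hc)

theorem perc_real_shift (hp : p ∈ Icc (0 : ℝ) 1) (x : ℤ × ℤ) {A : Set BondConfig}
    (hA : MeasurableSet A) :
    (perc p).real {ω | (fun e => ω (bondShift x e)) ∈ A} = (perc p).real A := by
  have hmap : (perc p).map (fun ω e => ω (bondShift x e)) = perc p :=
    map_perc_reindex hp _ (Equiv.refl Bool) fun _ => rfl
  have hmeas : Measurable fun (ω : BondConfig) (e : Bond) => ω (bondShift x e) :=
    measurable_pi_lambda _ fun e => measurable_pi_apply _
  conv_rhs => rw [← hmap, map_measureReal_apply hmeas hA]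
  rfl

theorem le_integral_clusterCount_block (hp : p ∈ Icc (0 : ℝ) 1) {x : ℤ × ℤ} {c : ℝ}
    (hn : ∀ v ∈ box 0 (n + 1), v + x ∈ W) (hN : ∀ v, v + x ∈ W → v ∈ box 0 N) (hnN : n < N)
    (hc : c ≤ (perc p).real (fourArms n N)) :
    c ≤ ∫ ω, ((clusterCount W (setOn (block n x) false ω) : ℝ) -
      clusterCount W (setOn (block n x) true ω)) ∂perc p := by
  have hA : MeasurableSet {ω : BondConfig | (fun e => ω (bondShift x e)) ∈ fourArms n N} :=
    (measurable_pi_lambda (fun (ω : BondConfig) (e : Bond) => ω (bondShift x e))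
      fun e => measurable_pi_apply _) (measurableSet_fourArms n N)
  rw [← perc_real_shift hp x (measurableSet_fourArms n N)] at hc
  refine hc.trans ?_
  rw [← integral_indicator_one hA]
  refine integral_mono ((integrable_const (1 : ℝ)).indicator hA) ?_ fun ω => ?_
  · exact (((dependsOn_clusterCount W).comp_setOn _ false).integrable p).sub
      (((dependsOn_clusterCount W).comp_setOn _ true).integrable p)
  · by_cases hω : (fun e => ω (bondShift x e)) ∈ fourArms n N
    · rw [indicator_of_mem (by exact hω)]
      have := clusterCount_block_lt hn hN hnN hω
      have h1 : (clusterCount W (setOn (block n x) true ω) : ℝ) + 1 ≤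
        clusterCount W (setOn (block n x) false ω) := by exact_mod_cast this
      simp only [Pi.one_apply]
      linarith
    · rw [indicator_of_notMem (by exact hω), sub_nonneg]
      exact Nat.cast_le.2 (clusterCount_anti W (setOn_false_le_true _ _))

/-- The mean number of clusters decreases at a speed proportional to the number of disjoint
blocks. -/
theorem sum_influence_clusterCount_le (hp : p ∈ Icc (0 : ℝ) 1) {m c : ℝ} (hm0 : 0 ≤ m) (hm : m ≤ p)
    (hm' : m ≤ 1 - p) (A : Finset (ℤ × ℤ)) (hA : (A : Set (ℤ × ℤ)).PairwiseDisjoint (block n))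
    (hn : ∀ x ∈ A, ∀ v ∈ box 0 (n + 1), v + x ∈ W)
    (hN : ∀ x ∈ A, ∀ v, v + x ∈ W → v ∈ box 0 N) (hnN : n < N)
    (hc : c ≤ (perc p).real (fourArms n N)) :
    ∑ e ∈ touching W, ∫ ω, ((clusterCount W (Function.update ω e true) : ℝ) -
      clusterCount W (Function.update ω e false)) ∂perc p ≤
      -(A.card * (m ^ (touching (box 0 n)).card * c)) := by
  have hanti : Antitone fun ω => (clusterCount W ω : ℝ) := fun ω ω' h =>
    Nat.cast_le.2 (clusterCount_anti W h)
  have hpos : ∀ e, 0 ≤ ∫ ω, ((clusterCount W (Function.update ω e false) : ℝ) -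
      clusterCount W (Function.update ω e true)) ∂perc p := fun e => integral_nonneg fun ω =>
    sub_nonneg.2 (hanti (update_le_update_bond le_rfl (Bool.false_le true) e))
  have hsub : A.biUnion (block n) ⊆ touching W := fun e he => by
    obtain ⟨x, hx, he⟩ := Finset.mem_biUnion.1 he
    obtain ⟨e', he', rfl⟩ := Finset.mem_map.1 he
    have hsymm := isLatticeSymm_shift x
    have hj := (hsymm e' e'.1 (bondEnd e')).2 (Or.inl ⟨rfl, rfl⟩)
    have hsub' : box 0 n ⊆ box 0 (n + 1) := box_subset_box (by omega) (by omega)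
    rw [mem_touching] at he' ⊢
    rcases he' with h | h
    · exact hj.touches (W := (W : Set (ℤ × ℤ))) (hn x hx _ (hsub' h))
    · exact hj.symm.touches (W := (W : Set (ℤ × ℤ))) (hn x hx _ (hsub' h))
  have hblock : ∀ x ∈ A, m ^ (touching (box 0 n)).card * c ≤ ∑ e ∈ block n x,
      ∫ ω, ((clusterCount W (Function.update ω e false) : ℝ) -
        clusterCount W (Function.update ω e true)) ∂perc p := fun x hx => by
    refine le_trans ?_ (pow_mul_integral_block_le hp hm0 hm hm' (dependsOn_clusterCount W) hanti
      (block n x))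
    rw [show (block n x).card = (touching (box 0 n)).card from Finset.card_map _]
    exact mul_le_mul_of_nonneg_left
      (le_integral_clusterCount_block hp (hn x hx) (hN x hx) hnN hc) (by positivity)
  have h1 := Finset.sum_le_sum hblock
  rw [← Finset.sum_biUnion hA, Finset.sum_const, nsmul_eq_mul] at h1
  have h2 := h1.trans (Finset.sum_le_sum_of_subset_of_nonneg hsub fun e _ _ => hpos e)
  refine (le_of_eq ?_).trans (neg_le_neg h2)
  rw [← Finset.sum_neg_distrib]
  refine Finset.sum_congr rfl fun e _ => ?_
  rw [← integral_neg]
  simp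

theorem perc_percolates_of_lt_half (hp0 : 0 ≤ p) (hp : p < 1 / 2) : perc p percolates = 0 := by
  have hpI : p ∈ Icc (0 : ℝ) 1 := ⟨hp0, by linarith⟩
  refine (perc_percolates_zero_or_one hpI).resolve_right fun hone => ?_
  obtain ⟨k, hk⟩ := exists_box_exit_prob hone (ε := 1 / 4096) (by norm_num)
  obtain ⟨p', hpp', hp'⟩ := exists_between hp
  have hp'0 : 0 < p' := hp0.trans_lt hpp'
  set d : ℕ := 2 * k + 4 with hd
  set c : ℝ := p' ^ (touching (box 0 k)).card * (1 / 2) with hc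
  have hc0 : 0 < c := by positivity
  have key : ∀ K : ℕ, 1 ≤ K → (1 - 2 * p') * (K ^ 2 * c) ≤ 8 * (d * K) + 4 := by
    intro K hK
    set W := box 0 ((d * K : ℕ) : ℤ) with hW
    set A : Finset (ℤ × ℤ) := (Finset.range K ×ˢ Finset.range K).image
      (fun x => ((d * x.1 : ℤ), (d * x.2 : ℤ))) with hAdef
    have hinj : Function.Injective fun x : ℕ × ℕ => ((d * x.1 : ℤ), (d * x.2 : ℤ)) := by
      rintro ⟨a, b⟩ ⟨a', b'⟩ h
      have hd0 : (d : ℤ) ≠ 0 := by omega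
      simpa [hd0] using h
    have hAcard : A.card = K ^ 2 := by
      rw [hAdef, Finset.card_image_of_injective _ hinj]
      simp [sq]
    have hAmem : ∀ x ∈ A, ∃ a b : ℕ, a < K ∧ b < K ∧ x = ((d * a : ℤ), (d * b : ℤ)) := fun x hx => by
      obtain ⟨⟨a, b⟩, hab, rfl⟩ := Finset.mem_image.1 hx
      simp only [Finset.mem_product, Finset.mem_range] at hab
      exact ⟨a, b, hab.1, hab.2, rfl⟩
    have hmul : ∀ a : ℕ, a < K → (d * a : ℤ) + d ≤ d * K := fun a ha => by
      have : a + 1 ≤ K := ha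
      have h2 : d * (a + 1) ≤ d * K := Nat.mul_le_mul_left d this
      rw [mul_add, mul_one] at h2
      exact_mod_cast h2
    have hmul0 : ∀ a : ℕ, (0 : ℤ) ≤ d * a := fun a => by positivity
    have hsep : ∀ a a' : ℕ, a ≠ a' → (d * a : ℤ) + d ≤ d * a' ∨ (d * a' : ℤ) + d ≤ d * a := by
      intro a a' h
      rcases Nat.lt_or_gt_of_ne h with h | h
      · left
        have h2 : d * (a + 1) ≤ d * a' := Nat.mul_le_mul_left d h
        rw [mul_add, mul_one] at h2
        exact_mod_cast h2
      · right
        have h2 : d * (a' + 1) ≤ d * a := Nat.mul_le_mul_left d h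
        rw [mul_add, mul_one] at h2
        exact_mod_cast h2
    have hAdisj : (A : Set (ℤ × ℤ)).PairwiseDisjoint (block k) := by
      intro x hx y hy hxy
      refine Finset.disjoint_left.2 fun e hex hey => ?_
      have h1 := exists_near_of_mem_block hex
      have h2 := exists_near_of_mem_block hey
      obtain ⟨a, b, -, -, rfl⟩ := hAmem x hx
      obtain ⟨a', b', -, -, rfl⟩ := hAmem y hy
      by_cases ha : a = a'
      · have hb : b ≠ b' := fun hb => hxy (by rw [ha, hb])
        have := hsep b b' hb
        simp only at h1 h2
        omega
      · have := hsep a a' ha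
        simp only at h1 h2
        omega
    have hWn : ∀ x ∈ A, ∀ v ∈ box 0 ((k : ℤ) + 1), v + x ∈ W := by
      intro x hx v hv
      obtain ⟨a, b, ha, hb, rfl⟩ := hAmem x hx
      have h1 := hmul a ha
      have h2 := hmul b hb
      have h3 := hmul0 a
      have h4 := hmul0 b
      rw [mem_box] at hv
      rw [hW, mem_box]
      push_cast
      simp only [Prod.fst_add, Prod.snd_add]
      omega
    have hWN : ∀ x ∈ A, ∀ v, v + x ∈ W → v ∈ box 0 ((2 * (d * K) : ℕ) : ℤ) := by
      intro x hx v hv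
      obtain ⟨a, b, ha, hb, rfl⟩ := hAmem x hx
      have h1 := hmul a ha
      have h2 := hmul b hb
      have h3 := hmul0 a
      have h4 := hmul0 b
      rw [hW, mem_box] at hv
      rw [mem_box]
      push_cast at hv ⊢
      simp only [Prod.fst_add, Prod.snd_add] at hv
      omega
    have hkN : k < 2 * (d * K) := by nlinarith
    have hderiv : ∀ r ∈ Icc p' (1 - p'), HasDerivAt (fun q => ∫ ω, (clusterCount W ω : ℝ) ∂perc q)
        (∑ e ∈ touching W, ∫ ω, ((clusterCount W (Function.update ω e true) : ℝ) -
          clusterCount W (Function.update ω e false)) ∂perc r) r := fun r hr =>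
      hasDerivAt_integral_perc ⟨by linarith [hr.1], by linarith [hr.2]⟩ _ (dependsOn_clusterCount W)
    obtain ⟨r, hr, hslope⟩ := exists_hasDerivAt_eq_slope _ _ (by linarith : p' < 1 - p')
      (fun r hr => (hderiv r hr).continuousAt.continuousWithinAt)
      (fun r hr => hderiv r (Ioo_subset_Icc_self hr))
    have hle := sum_influence_clusterCount_le (p := r) (N := ((2 * (d * K) : ℕ) : ℤ)) (c := 1 / 2)
      ⟨by linarith [hr.1], by linarith [hr.2]⟩ hp'0.le hr.1.le (by linarith [hr.2]) A hAdisj hWn hWN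
      (by exact_mod_cast hkN) (perc_real_fourArms hpI ⟨by linarith [hr.1], by linarith [hr.2]⟩ _ _ ?_)
    · rw [hslope, hAcard, div_le_iff₀ (by linarith)] at hle
      have hlow : 0 ≤ ∫ ω, (clusterCount W ω : ℝ) ∂perc (1 - p') :=
        integral_nonneg fun ω => Nat.cast_nonneg _
      have hhigh : ∫ ω, (clusterCount W ω : ℝ) ∂perc p' ≤ 8 * (d * K) + 4 := by
        calc ∫ ω, (clusterCount W ω : ℝ) ∂perc p' ≤ ∫ ω, (8 * (d * K) + 4 : ℝ) ∂perc p' := by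
              refine integral_mono ((dependsOn_clusterCount W).integrable _) (integrable_const _)
                fun ω => ?_
              have := (clusterCount_le W ω).trans (card_bdry_box_le (d * K))
              simp only
              exact_mod_cast this
          _ = 8 * (d * K) + 4 := by simp
      push_cast at hle
      have heq : (1 - 2 * p') * (K ^ 2 * c) =
          (K ^ 2 * (p' ^ (touching (box 0 k)).card * (1 / 2))) * (1 - p' - p') := by
        rw [hc]
        ring
      linarith
    · intro s hs
      rcases hs with rfl | rfl
      · exact hk 0 _ hkN.le
      · exact hk 1 _ hkN.le
  have hpos : 0 < (1 - 2 * p') * c := mul_pos (by linarith) hc0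
  obtain ⟨K, hK⟩ := exists_nat_gt ((8 * d + 4) / ((1 - 2 * p') * c))
  rw [div_lt_iff₀ hpos] at hK
  have hK0 : 1 ≤ K := by
    rcases Nat.eq_zero_or_pos K with rfl | h
    · rw [Nat.cast_zero, zero_mul] at hK
      have : (0 : ℝ) ≤ 8 * d + 4 := by positivity
      linarith
    · exact h
  have h1 := key K hK0
  have hK1 : (1 : ℝ) ≤ K := by exact_mod_cast hK0
  nlinarith

end Subcritical

section ExitRate

variable {ω ω' : BondConfig} {U X T : Set (ℤ × ℤ)} {u v w : ℤ × ℤ} {e : Bond} {N n : ℤ}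
  {p q : ℝ} {W S : Finset (ℤ × ℤ)}

/-! ### The exit rate of a finite set -/

/-- The bonds with both endpoints in `S`. -/
def innerBonds (S : Finset (ℤ × ℤ)) : Finset Bond :=
  (touching S).filter fun e => e.1 ∈ S ∧ bondEnd e ∈ S

/-- The bonds with exactly one endpoint in `S`. -/
def edgeBdry (S : Finset (ℤ × ℤ)) : Finset Bond :=
  (touching S).filter fun e => ¬ (e.1 ∈ S ∧ bondEnd e ∈ S)

/-- The endpoint in `S` of a bond in `edgeBdry S`. -/
def innerEnd (S : Finset (ℤ × ℤ)) (e : Bond) : ℤ × ℤ := if e.1 ∈ S then e.1 else bondEnd e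

/-- The event that `u` and `v` are connected inside `S`. -/
def connEvent (S : Finset (ℤ × ℤ)) (u v : ℤ × ℤ) : Set BondConfig := {ω | Conn ω S u v}

/-- The mean number of boundary bonds of `S` reached from the origin inside `S`. -/
def exitRate (p : ℝ) (S : Finset (ℤ × ℤ)) : ℝ :=
  ∑ e ∈ edgeBdry S, (perc p).real (connEvent S 0 (innerEnd S e))

theorem mem_innerBonds : e ∈ innerBonds S ↔ e.1 ∈ S ∧ bondEnd e ∈ S := by
  simp only [innerBonds, Finset.mem_filter, mem_touching]
  tauto

theorem mem_edgeBdry : e ∈ edgeBdry S ↔ ∃ v ∉ S, innerEnd S e ∈ S ∧ Joins e (innerEnd S e) v := by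
  simp only [edgeBdry, Finset.mem_filter, mem_touching, innerEnd]
  constructor
  · rintro ⟨h1, h2⟩
    by_cases h : e.1 ∈ S
    · rw [if_pos h]
      exact ⟨bondEnd e, fun h3 => h2 ⟨h, h3⟩, h, Or.inl ⟨rfl, rfl⟩⟩
    · rw [if_neg h]
      exact ⟨e.1, h, h1.resolve_left h, Or.inr ⟨rfl, rfl⟩⟩
  · rintro ⟨v, hv, h1, h2⟩
    refine ⟨h2.touches (W := (S : Set (ℤ × ℤ))) h1, fun h3 => hv ?_⟩
    rcases h2 with ⟨-, rfl⟩ | ⟨rfl, -⟩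
    · exact h3.2
    · exact h3.1

theorem Joins.mem_edgeBdry (h : Joins e u v) (hu : u ∈ S) (hv : v ∉ S) :
    e ∈ edgeBdry S ∧ innerEnd S e = u := by
  rcases h with ⟨rfl, rfl⟩ | ⟨rfl, rfl⟩
  · have : innerEnd S e = e.1 := if_pos hu
    exact ⟨_root_.mem_edgeBdry.2 ⟨_, hv, by rwa [this], by rw [this]; exact Or.inl ⟨rfl, rfl⟩⟩, this⟩
  · have : innerEnd S e = bondEnd e := if_neg hv
    exact ⟨_root_.mem_edgeBdry.2 ⟨_, hv, by rwa [this], by rw [this]; exact Or.inr ⟨rfl, rfl⟩⟩, this⟩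

theorem determined_connEvent (S : Finset (ℤ × ℤ)) (u v : ℤ × ℤ) :
    Determined (connEvent S u v) (innerBonds S : Set Bond) := by
  rw [determined_iff]
  intro ω ω' h hc
  exact Conn.congr (fun e h1 h2 he => by rw [← h e (mem_innerBonds.2 ⟨h1, h2⟩), he]) le_rfl hc

theorem isUpperSet_connEvent (S : Finset (ℤ × ℤ)) (u v : ℤ × ℤ) : IsUpperSet (connEvent S u v) :=
  fun _ _ h hc => Conn.mono h le_rfl hc

theorem exitRate_mono (hp : p ∈ Icc (0 : ℝ) 1) (hq : q ∈ Icc (0 : ℝ) 1) (hpq : p ≤ q)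
    (S : Finset (ℤ × ℤ)) : exitRate p S ≤ exitRate q S :=
  Finset.sum_le_sum fun _ _ => perc_real_mono hp hq hpq _ (determined_connEvent _ _ _)
    (isUpperSet_connEvent _ _ _)

/-! ### Differential inequality -/

/-- The vertices of `W` which are not connected to the outside of `W`. -/
def blocked (W : Finset (ℤ × ℤ)) (ω : BondConfig) : Finset (ℤ × ℤ) :=
  open Classical in W.filter fun v => ω ∉ exitEvent {v} W (W : Set (ℤ × ℤ))ᶜ

theorem mem_blocked : v ∈ blocked W ω ↔ v ∈ W ∧ ω ∉ exitEvent {v} W (W : Set (ℤ × ℤ))ᶜ := by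
  classical
  simp [blocked]

theorem Conn.exits (h : Conn ω W u v) (hv : ω ∈ exitEvent {v} W T) : ω ∈ exitEvent {u} W T := by
  obtain ⟨v, rfl, a, ha, b, hb, hc, ho⟩ := hv
  exact ⟨u, rfl, a, ha, b, hb, h.trans hc, ho⟩

theorem Op.exits_of_notMem_blocked (h : Op ω u v) (hu : u ∈ W) (hv : v ∉ blocked W ω) :
    ω ∈ exitEvent {u} W (W : Set (ℤ × ℤ))ᶜ := by
  by_cases hvW : v ∈ W
  · rw [mem_blocked, not_and, not_not] at hv
    exact (Conn.single h hu hvW).exits (hv hvW)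
  · exact ⟨u, rfl, u, hu, v, hvW, Conn.refl _ _ _, h⟩

theorem Conn.avoids_blocked (h : Conn ω W u v) (hv : v ∉ blocked W ω) :
    Conn ω ((W : Set (ℤ × ℤ)) ∩ (blocked W ω : Set (ℤ × ℤ))ᶜ) u v := by
  rcases h.symm.inside_or_exit (W := (blocked W ω : Set (ℤ × ℤ))ᶜ) hv with h' |
    ⟨a, ha, b, hb, haW, hbW, -, hab, -⟩
  · exact h'.symm
  · rw [mem_compl_iff, not_not] at hb
    exact absurd (hab.symm.exits_of_notMem_blocked hbW ha) (mem_blocked.1 hb).2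

theorem blocked_eq_of_eqOn (h : ∀ e ∈ touching W, e ∉ innerBonds (blocked W ω) → ω e = ω' e) :
    blocked W ω' = blocked W ω := by
  ext v
  by_cases hvW : v ∈ W
  swap
  · simp [mem_blocked, hvW]
  constructor
  · intro hv
    by_contra hv'
    have hex : ω ∈ exitEvent {v} W (W : Set (ℤ × ℤ))ᶜ := by
      by_contra hno
      exact hv' (mem_blocked.2 ⟨hvW, hno⟩)
    obtain ⟨v, rfl, a, ha, b, hb, hc, ho⟩ := hex
    refine (mem_blocked.1 hv).2 ⟨v, rfl, a, ha, b, hb, ?_, ?_⟩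
    · refine (hc.symm.avoids_blocked hv').symm.congr (fun e h1 h2 he => ?_) inter_subset_left
      rw [← h e (mem_touching.2 (Or.inl h1.1)) fun hin => h1.2 (mem_innerBonds.1 hin).1, he]
    · obtain ⟨e, hj, he⟩ := ho
      refine ⟨e, hj, ?_⟩
      rw [← h e (mem_touching.2 (hj.touches (W := (W : Set (ℤ × ℤ))) ha)) fun hin => ?_, he]
      have hsub : ∀ x ∈ blocked W ω, x ∈ W := fun x hx => (mem_blocked.1 hx).1
      obtain ⟨h1, h2⟩ := mem_innerBonds.1 hin
      rcases hj with ⟨-, rfl⟩ | ⟨rfl, -⟩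
      · exact hb (hsub _ h2)
      · exact hb (hsub _ h1)
  · intro hv
    by_contra hv'
    have hex : ω' ∈ exitEvent {v} W (W : Set (ℤ × ℤ))ᶜ := by
      by_contra hno
      exact hv' (mem_blocked.2 ⟨hvW, hno⟩)
    have hstep : ∀ a b, a ∈ blocked W ω → b ∉ blocked W ω → ¬ Op ω' a b := by
      rintro a b ha hb ⟨e, hj, he⟩
      have haW := (mem_blocked.1 ha).1
      have hop : Op ω a b := by
        refine ⟨e, hj, ?_⟩
        rw [h e (mem_touching.2 (hj.touches (W := (W : Set (ℤ × ℤ))) haW)) fun hin => ?_, he]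
        obtain ⟨h1, h2⟩ := mem_innerBonds.1 hin
        rcases hj with ⟨-, rfl⟩ | ⟨rfl, -⟩
        · exact hb h2
        · exact hb h1
      exact (mem_blocked.1 ha).2 (hop.exits_of_notMem_blocked haW hb)
    obtain ⟨v, rfl, a, ha, b, hb, hc, ho⟩ := hex
    rcases hc.inside_or_exit (W := (blocked W ω : Set (ℤ × ℤ))) hv with h' |
      ⟨c, hc, d, hd, -, -, -, hcd, -⟩
    · have ha' : a ∈ blocked W ω := Conn.mem (h'.mono le_rfl inter_subset_right) hv
      exact hstep a b ha' (fun hb' => hb (mem_blocked.1 hb').1) ho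
    · exact hstep c d hc hd hcd

theorem determined_blocked_eq (W S : Finset (ℤ × ℤ)) :
    Determined {ω | blocked W ω = S} ((touching W \ innerBonds S : Finset Bond) : Set Bond) := by
  rw [determined_iff]
  rintro ω ω' h rfl
  exact blocked_eq_of_eqOn fun e h1 h2 => h e (by simpa using ⟨h1, h2⟩)

theorem pivotal_of_blocked (h0 : 0 ∈ blocked W ω) (he : e ∈ edgeBdry (blocked W ω))
    (hc : Conn ω (blocked W ω) 0 (innerEnd (blocked W ω) e)) :
    Function.update ω e true ∈ exitEvent {0} W (W : Set (ℤ × ℤ))ᶜ ∧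
      Function.update ω e false ∉ exitEvent {0} W (W : Set (ℤ × ℤ))ᶜ := by
  have hsub : (blocked W ω : Set (ℤ × ℤ)) ⊆ W := fun x hx => (mem_blocked.1 hx).1
  have hle : ω ≤ Function.update ω e true := by
    simp
  have hle' : Function.update ω e false ≤ ω := by
    simp
  refine ⟨?_, fun h => (mem_blocked.1 h0).2 (isUpperSet_exitEvent _ _ _ hle' h)⟩
  obtain ⟨y, hy, hx, hj⟩ := mem_edgeBdry.1 he
  refine (hc.mono hle hsub).exits ?_
  have hop : Op (Function.update ω e true) (innerEnd (blocked W ω) e) y := ⟨e, hj, by simp⟩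
  refine hop.exits_of_notMem_blocked (hsub hx) fun hy' => hy ?_
  rw [mem_blocked] at hy' ⊢
  exact ⟨hy'.1, fun h => hy'.2 (isUpperSet_exitEvent _ _ _ hle h)⟩

/-- If all exit rates are large, then so is the derivative of the exit probability. -/
theorem le_sum_influence_exitEvent (hp : p ∈ Icc (0 : ℝ) 1) (h0 : 0 ∈ W)
    (hS : ∀ S : Finset (ℤ × ℤ), 0 ∈ S → 1 ≤ exitRate p S) :
    1 - (perc p).real (exitEvent {0} W (W : Set (ℤ × ℤ))ᶜ) ≤ ∑ e ∈ touching W, ∫ ω,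
      ((exitEvent {0} W (W : Set (ℤ × ℤ))ᶜ).indicator 1 (Function.update ω e true) -
        (exitEvent {0} W (W : Set (ℤ × ℤ))ᶜ).indicator (1 : BondConfig → ℝ)
          (Function.update ω e false)) ∂perc p := by
  classical
  set A := exitEvent {0} (W : Set (ℤ × ℤ)) (W : Set (ℤ × ℤ))ᶜ with hA
  have hAm : MeasurableSet A := measurableSet_exitEvent _ _ _
  set 𝒮 : Finset (Finset (ℤ × ℤ)) := W.powerset.filter fun S => 0 ∈ S
  have hsubW : ∀ ω, blocked W ω ⊆ W := fun ω => Finset.filter_subset _ _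
  have hDm : ∀ S, MeasurableSet {ω | blocked W ω = S} := fun S =>
    (determined_blocked_eq W S).measurableSet
  have hcm : ∀ S u v, MeasurableSet (connEvent S u v) := fun S u v =>
    (determined_connEvent S u v).measurableSet
  have hAc : 1 - (perc p).real A ≤ ∑ S ∈ 𝒮, (perc p).real {ω | blocked W ω = S} := by
    rw [← probReal_compl_eq_one_sub hAm]
    refine (measureReal_mono ?_ (measure_ne_top _ _)).trans (measureReal_biUnion_finset_le 𝒮 _)
    intro ω hω
    simp only [mem_iUnion]
    refine ⟨blocked W ω, ?_, rfl⟩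
    exact Finset.mem_filter.2 ⟨Finset.mem_powerset.2 (hsubW ω), mem_blocked.2 ⟨h0, hω⟩⟩
  have hpiv : ∀ e ∈ touching W, ∑ S ∈ 𝒮, (if e ∈ edgeBdry S then
      (perc p).real ({ω | blocked W ω = S} ∩ connEvent S 0 (innerEnd S e)) else 0) ≤
      ∫ ω, (A.indicator 1 (Function.update ω e true) -
        A.indicator (1 : BondConfig → ℝ) (Function.update ω e false)) ∂perc p := by
    intro e _
    have hF : Determined A (touching W : Set Bond) := determined_exitEvent _ _ _
    have hpm : MeasurableSet (forced A e true \ forced A e false) :=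
      (measurableSet_forced hAm e true).diff (measurableSet_forced hAm e false)
    have h_int : ∫ ω, (A.indicator 1 (Function.update ω e true) -
        A.indicator (1 : BondConfig → ℝ) (Function.update ω e false)) ∂perc p =
        (perc p).real (forced A e true \ forced A e false) := by
      rw [← integral_indicator_one hpm]
      refine integral_congr_ae (Filter.Eventually.of_forall fun ω => ?_)
      have hsub := forced_false_subset (isUpperSet_exitEvent {0} (W : Set (ℤ × ℤ)) (W : Set (ℤ × ℤ))ᶜ) e
      by_cases h1 : Function.update ω e true ∈ A <;> by_cases h2 : Function.update ω e false ∈ A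
      · simp [indicator, forced, h1, h2]
      · simp [indicator, forced, h1, h2]
      · exact absurd (hsub h2) h1
      · simp [indicator, forced, h1, h2]
    rw [h_int, ← Finset.sum_filter, ← measureReal_biUnion_finset]
    · refine measureReal_mono ?_ (by finiteness)
      intro ω hω
      simp only [mem_iUnion] at hω
      obtain ⟨S, hSm, hSω, hc⟩ := hω
      rw [Finset.mem_filter, Finset.mem_filter] at hSm
      have hSω' : blocked W ω = S := hSω
      subst hSω'
      exact pivotal_of_blocked hSm.1.2 hSm.2 hc
    · intro S _ S' _ hne
      refine disjoint_left.2 fun ω h1 h2 => hne ?_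
      exact h1.1.symm.trans h2.1
    · exact fun S _ => (hDm S).inter (hcm _ _ _)
  refine hAc.trans (le_trans ?_ (Finset.sum_le_sum hpiv))
  rw [Finset.sum_comm]
  refine Finset.sum_le_sum fun S hSm => ?_
  rw [Finset.mem_filter, Finset.mem_powerset] at hSm
  have hsub : edgeBdry S ⊆ touching W := fun e he => by
    have := (Finset.mem_filter.1 he).1
    rw [mem_touching] at this ⊢
    exact this.imp (fun h => hSm.1 h) fun h => hSm.1 h
  rw [← Finset.sum_filter, Finset.filter_mem_eq_inter, Finset.inter_eq_right.2 hsub]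
  have hind : ∀ e, (perc p).real ({ω | blocked W ω = S} ∩ connEvent S 0 (innerEnd S e)) =
      (perc p).real {ω | blocked W ω = S} * (perc p).real (connEvent S 0 (innerEnd S e)) := fun e =>
    perc_real_inter hp (determined_blocked_eq W S) (determined_connEvent _ _ _)
      fun e he => (Finset.mem_sdiff.1 he).2
  simp only [hind]
  rw [← Finset.mul_sum]
  exact le_mul_of_one_le_right measureReal_nonneg (hS S hSm.2)

theorem perc_real_exitEvent_ge (hp : p ∈ Ioo (1 / 2 : ℝ) 1) (h0 : 0 ∈ W)
    (hS : ∀ S : Finset (ℤ × ℤ), 0 ∈ S → 1 ≤ exitRate (1 / 2) S) :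
    (p - 1 / 2) / (p + 1 / 2) ≤ (perc p).real (exitEvent {0} W (W : Set (ℤ × ℤ))ᶜ) := by
  set A := exitEvent {0} (W : Set (ℤ × ℤ)) (W : Set (ℤ × ℤ))ᶜ with hA
  have hdet : Determined A (touching W : Set Bond) := determined_exitEvent _ _ _
  have hdep : DependsOn (A.indicator (1 : BondConfig → ℝ)) (touching W : Set Bond) :=
    fun ω ω' h => by
      classical
      have : (ω ∈ A) = (ω' ∈ A) := hdet h
      simp only [indicator_apply, this, Pi.one_apply]
  have hmem : ∀ r ∈ Icc (1 / 2) p, r ∈ Ioo (0 : ℝ) 1 := fun r hr =>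
    ⟨by linarith [hr.1], by linarith [hr.2, hp.2]⟩
  have hderiv := fun r hr => hasDerivAt_integral_perc (hmem r hr) (touching W) hdep
  obtain ⟨r, hr, hslope⟩ := exists_hasDerivAt_eq_slope _ _ hp.1
    (fun r hr => (hderiv r hr).continuousAt.continuousWithinAt)
    (fun r hr => hderiv r (Ioo_subset_Icc_self hr))
  have hrI : r ∈ Icc (0 : ℝ) 1 := Ioo_subset_Icc_self (hmem r (Ioo_subset_Icc_self hr))
  have hle := le_sum_influence_exitEvent (p := r) hrI h0 fun S h => (hS S h).trans
    (exitRate_mono (by constructor <;> norm_num) hrI hr.1.le S)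
  have hAm : MeasurableSet A := hdet.measurableSet
  rw [← hA] at hle
  rw [hslope, integral_indicator_one hAm, integral_indicator_one hAm,
    le_div_iff₀ (by linarith [hp.1])] at hle
  have hmono : (perc r).real A ≤ (perc p).real A :=
    perc_real_mono hrI ⟨by linarith [hp.1], hp.2.le⟩ hr.2.le _ hdet (isUpperSet_exitEvent _ _ _)
  have hnn : 0 ≤ (perc (1 / 2)).real A := measureReal_nonneg
  rw [div_le_iff₀ (by linarith [hp.1])]
  nlinarith [hp.1]

/-- If all exit rates at one half are at least one, there is percolation above one half. -/
theorem perc_percolates_of_exitRate (hp : p ∈ Ioc (1 / 2 : ℝ) 1)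
    (hS : ∀ S : Finset (ℤ × ℤ), 0 ∈ S → 1 ≤ exitRate (1 / 2) S) : perc p percolates = 1 := by
  have hpI : p ∈ Icc (0 : ℝ) 1 := ⟨by linarith [hp.1], hp.2⟩
  obtain ⟨q, hq, hqp⟩ := exists_between hp.1
  have hq1 : q < 1 := hqp.trans_le hp.2
  set c := (q - 1 / 2) / (q + 1 / 2) with hc
  have hc0 : 0 < c := div_pos (by linarith) (by linarith)
  have hbound : ∀ N : ℕ, c ≤ (perc p).real (exitEvent {0} (box 0 N) (box 0 N : Set (ℤ × ℤ))ᶜ) :=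
    fun N => (perc_real_exitEvent_ge ⟨hq, hq1⟩ (by simp [mem_box]) hS).trans
      (perc_real_mono ⟨by linarith, hq1.le⟩ hpI hqp.le _ (determined_exitEvent _ _ _)
        (isUpperSet_exitEvent _ _ _))
  refine (perc_percolates_zero_or_one hpI).resolve_left fun hzero => ?_
  have hanti : Antitone fun N : ℕ => exitEvent {0} (box 0 N) (box 0 N : Set (ℤ × ℤ))ᶜ := by
    rintro N M hNM ω ⟨u, rfl, v, hv, w, hw, hcon, ho⟩
    have hsub : box 0 N ⊆ box 0 M := box_subset_box (by omega) (by omega)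
    refine Conn.mem_exitEvent (X := univ) ((hcon.mono le_rfl (subset_univ _)).trans
      (Conn.single ho trivial trivial)) (by simp [mem_box]) fun hw' => hw (hsub hw')
  have hInter : (⋂ N : ℕ, exitEvent {0} (box 0 N) (box 0 N : Set (ℤ × ℤ))ᶜ) ⊆ percolates := by
    intro ω hω
    rw [percolates_eq]
    refine mem_iUnion.2 ⟨0, (exists_infinite_iff ω 0).2 fun N _ => ?_⟩
    exact exitEvent_mono (singleton_subset_iff.2 (by simp [mem_box])) le_rfl (mem_iInter.1 hω N)
  have ht := tendsto_measure_iInter_atTop (μ := perc p)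
    (fun N : ℕ => (measurableSet_exitEvent {0} (box 0 N : Set (ℤ × ℤ))ᶜ (box 0 N)).nullMeasurableSet)
    hanti ⟨0, by finiteness⟩
  rw [measure_mono_null hInter hzero] at ht
  have ht' := (ENNReal.tendsto_toReal ENNReal.zero_ne_top).comp ht
  rw [ENNReal.toReal_zero] at ht'
  have := ge_of_tendsto' ht' hbound
  linarith

end ExitRate

section ArmDecay

variable {ω ω' : BondConfig} {U X T : Set (ℤ × ℤ)} {u v w : ℤ × ℤ} {e : Bond}
  {p : ℝ} {W S C : Finset (ℤ × ℤ)}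

/-! ### Summability of the arm probabilities -/

/-- The vertices connected to the origin inside `S`. -/
def clusterIn (S : Finset (ℤ × ℤ)) (ω : BondConfig) : Finset (ℤ × ℤ) :=
  open Classical in S.filter fun v => ω ∈ connEvent S 0 v

theorem mem_clusterIn : v ∈ clusterIn S ω ↔ v ∈ S ∧ Conn ω S 0 v := by
  classical
  rw [clusterIn, Finset.mem_filter]
  rfl

theorem determined_clusterIn_eq (h0 : 0 ∈ S) (C : Finset (ℤ × ℤ)) :
    Determined {ω | clusterIn S ω = C} (touching C : Set Bond) := by
  rw [determined_iff]
  rintro ω ω' h rfl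
  have hstep : ∀ {a b}, a ∈ clusterIn S ω → (Op ω a b ↔ Op ω' a b) := by
    intro a b ha
    refine exists_congr fun e => and_congr_right fun hj => ?_
    rw [h e (mem_touching.2 (hj.touches (W := (clusterIn S ω : Set (ℤ × ℤ))) ha))]
  have h0C : 0 ∈ clusterIn S ω := mem_clusterIn.2 ⟨h0, Conn.refl _ _ _⟩
  ext v
  constructor
  · intro hv
    rcases (mem_clusterIn.1 hv).2.inside_or_exit (W := (clusterIn S ω : Set (ℤ × ℤ))) h0C with h' |
      ⟨a, ha, b, hb, haS, hbS, -, hab, -⟩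
    · exact (h'.mem ⟨h0, h0C⟩).2
    · exact absurd (mem_clusterIn.2 ⟨hbS, (mem_clusterIn.1 ha).2.trans
        (Conn.single ((hstep ha).2 hab) haS hbS)⟩) hb
  · intro hv
    obtain ⟨hvS, hc⟩ := mem_clusterIn.1 hv
    rcases hc.symm.inside_or_exit (W := (clusterIn S ω : Set (ℤ × ℤ))) hv with h' |
      ⟨a, ha, b, hb, haS, hbS, -, hab, -⟩
    · refine mem_clusterIn.2 ⟨hvS, h'.symm.congr (fun e h1 _ he => ?_) inter_subset_left⟩
      rw [← h e (mem_touching.2 (Or.inl h1.2)), he]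
    · exact absurd (mem_clusterIn.2 ⟨hbS, (mem_clusterIn.1 ha).2.trans
        (Conn.single hab haS hbS)⟩) hb

theorem connEvent_eq_biUnion (hv : v ∈ S) :
    connEvent S 0 v = ⋃ C ∈ S.powerset.filter (v ∈ ·), {ω | clusterIn S ω = C} := by
  ext ω
  simp only [mem_iUnion, mem_ofPred_eq, exists_prop, exists_eq_right', Finset.mem_filter,
    Finset.mem_powerset]
  exact ⟨fun h => ⟨fun x hx => (mem_clusterIn.1 hx).1, mem_clusterIn.2 ⟨hv, h⟩⟩,
    fun h => (mem_clusterIn.1 h.2).2⟩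

theorem perc_real_connEvent (p : ℝ) (h0 : 0 ∈ S) (hv : v ∈ S) : (perc p).real (connEvent S 0 v) =
    ∑ C ∈ S.powerset.filter (v ∈ ·), (perc p).real {ω | clusterIn S ω = C} := by
  rw [connEvent_eq_biUnion hv, measureReal_biUnion_finset]
  · rintro C - D - hCD
    exact Set.disjoint_left.2 fun ω h1 h2 => hCD (h1.symm.trans h2)
  · exact fun C _ => (determined_clusterIn_eq h0 C).measurableSet

/-- The event that an open path starting at `u` exits the box `u + box 0 k`. -/
def arm (u : ℤ × ℤ) (k : ℕ) : Set BondConfig :=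
  exitEvent {u} ((box 0 k).map (Equiv.addRight u).toEmbedding : Finset (ℤ × ℤ))
    ((box 0 k).map (Equiv.addRight u).toEmbedding : Set (ℤ × ℤ))ᶜ

theorem mem_map_box {k : ℕ} : v ∈ (box 0 k).map (Equiv.addRight u).toEmbedding ↔
    |v.1 - u.1| ≤ k ∧ |v.2 - u.2| ≤ k := by
  rw [Finset.mem_map_equiv, mem_box, abs_le, abs_le]
  simp [sub_eq_add_neg]

theorem self_mem_map_box (u : ℤ × ℤ) (k : ℕ) :
    u ∈ (box 0 k).map (Equiv.addRight u).toEmbedding :=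
  mem_map_box.2 (by simp only [sub_self, abs_zero]; omega)

theorem measurableSet_arm (u : ℤ × ℤ) (k : ℕ) : MeasurableSet (arm u k) :=
  measurableSet_exitEvent _ _ _

theorem perc_real_arm (hp : p ∈ Icc (0 : ℝ) 1) (u : ℤ × ℤ) (k : ℕ) :
    (perc p).real (arm u k) = (perc p).real (arm 0 k) := by
  have h0 : (box 0 k).map (Equiv.addRight (0 : ℤ × ℤ)).toEmbedding = box 0 k := by
    ext v
    rw [mem_map_box, mem_box, abs_le, abs_le]
    simp
  have hpre : ((box 0 k : Finset (ℤ × ℤ)) : Set (ℤ × ℤ)) =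
      (Equiv.addRight u) ⁻¹' ((box 0 k).map (Equiv.addRight u).toEmbedding) := by
    ext v
    simp
  rw [arm, arm, ← (isLatticeSymm_shift u).perc_real_exitEvent hp hpre, h0, preimage_compl,
    ← hpre]
  congr 2
  ext v
  simp

/-- The endpoint outside `S` of a bond in `edgeBdry S`. -/
def outerEnd (S : Finset (ℤ × ℤ)) (e : Bond) : ℤ × ℤ := if e.1 ∈ S then bondEnd e else e.1

theorem Joins.outerEnd_eq (h : Joins e u v) (hu : u ∈ S) (hv : v ∉ S) : outerEnd S e = v := by
  rcases h with ⟨rfl, rfl⟩ | ⟨rfl, rfl⟩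
  · exact if_pos hu
  · exact if_neg hv

/-- The event that an open path starting at `u` exits the box `u + box 0 k` without meeting `C`. -/
def armAvoiding (u : ℤ × ℤ) (k : ℕ) (C : Finset (ℤ × ℤ)) : Set BondConfig :=
  exitEvent {u} ((box 0 k).map (Equiv.addRight u).toEmbedding \ C : Finset (ℤ × ℤ))
    ((box 0 k).map (Equiv.addRight u).toEmbedding ∪ C : Finset (ℤ × ℤ))ᶜ

theorem armAvoiding_subset_arm (u : ℤ × ℤ) (k : ℕ) (C : Finset (ℤ × ℤ)) :
    armAvoiding u k C ⊆ arm u k := by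
  rintro ω ⟨v, hv, a, ha, b, hb, hc, ho⟩
  refine ⟨v, hv, a, (Finset.mem_sdiff.1 ha).1, b, fun hb' => hb ?_, hc.mono le_rfl ?_, ho⟩
  · exact Finset.mem_union_left _ hb'
  · exact fun x hx => (Finset.mem_sdiff.1 hx).1

theorem determined_armAvoiding (u : ℤ × ℤ) (k : ℕ) (C : Finset (ℤ × ℤ)) :
    Determined (armAvoiding u k C) ((touching ((box 0 k).map (Equiv.addRight u).toEmbedding) \
      touching C : Finset Bond) : Set Bond) := by
  rw [determined_iff]
  rintro ω ω' h ⟨v, hv, a, ha, b, hb, hc, ho⟩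
  have hW : ∀ {x}, x ∈ (box 0 k).map (Equiv.addRight u).toEmbedding \ C →
      x ∈ (box 0 k).map (Equiv.addRight u).toEmbedding ∧ x ∉ C := fun hx => Finset.mem_sdiff.1 hx
  refine ⟨v, hv, a, ha, b, hb, hc.congr (fun e h1 h2 he => ?_) le_rfl, ?_⟩
  · rw [← h e ?_, he]
    refine Finset.mem_sdiff.2 ⟨mem_touching.2 (Or.inl (hW h1).1), fun hC => ?_⟩
    exact (mem_touching.1 hC).elim (hW h1).2 (hW h2).2
  · obtain ⟨e, hj, he⟩ := ho
    refine ⟨e, hj, ?_⟩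
    rw [← h e ?_, he]
    refine Finset.mem_sdiff.2 ⟨mem_touching.2 (hj.touches
      (W := ((box 0 k).map (Equiv.addRight u).toEmbedding : Set (ℤ × ℤ))) (hW ha).1), fun hC => ?_⟩
    have hbC : b ∉ C := fun hb' => hb (Finset.mem_union_right _ hb')
    rw [mem_touching] at hC
    rcases hj with ⟨rfl, rfl⟩ | ⟨rfl, rfl⟩
    · exact hC.elim (hW ha).2 hbC
    · exact hC.elim hbC (hW ha).2

theorem exists_armAvoiding_of_arm {L k : ℕ} (h0 : 0 ∈ S) (hS : S ⊆ box 0 L)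
    (hω : ω ∈ arm 0 (k + (L + 1))) : ∃ e ∈ edgeBdry S, innerEnd S e ∈ clusterIn S ω ∧
      ω ∈ armAvoiding (outerEnd S e) k (clusterIn S ω) := by
  obtain ⟨_, rfl, v, hv, w, hw, hc, ho⟩ := hω
  have hw' : ¬ (|w.1 - 0| ≤ ((k + (L + 1) : ℕ) : ℤ) ∧ |w.2 - 0| ≤ ((k + (L + 1) : ℕ) : ℤ)) :=
    fun h => hw (mem_map_box.2 h)
  have h0C : 0 ∈ clusterIn S ω := mem_clusterIn.2 ⟨h0, Conn.refl _ _ _⟩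
  have hCS : ∀ x ∈ clusterIn S ω, x ∈ S := fun x hx => (mem_clusterIn.1 hx).1
  have hbox : ∀ x ∈ S, |x.1| ≤ L ∧ |x.2| ≤ L := fun x hx => by
    have := mem_box.1 (hS hx)
    rw [abs_le, abs_le]
    omega
  have hwS : w ∉ S := fun h => hw' (by have := hbox w h; push_cast; simp only [sub_zero]; omega)
  have hc' : Conn ω univ 0 w :=
    (hc.mono le_rfl (subset_univ _)).trans (Conn.single ho trivial trivial)
  obtain ⟨a, ha, b, hb, -, -, -, hab, hbw⟩ :=
    hc'.last_exit (W := (clusterIn S ω : Set (ℤ × ℤ))) h0C fun h => hwS (hCS w h)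
  have hbS : b ∉ S := fun h => hb (mem_clusterIn.2 ⟨h, (mem_clusterIn.1 ha).2.trans
    (Conn.single hab (hCS a ha) h)⟩)
  have hnear := hab.near
  obtain ⟨e, hj, -⟩ := hab
  obtain ⟨he, hin⟩ := hj.mem_edgeBdry (hCS a ha) hbS
  refine ⟨e, he, hin ▸ ha, ?_⟩
  rw [hj.outerEnd_eq (hCS a ha) hbS]
  have haL := hbox a (hCS a ha)
  have hwb : w ∉ (box 0 k).map (Equiv.addRight b).toEmbedding := fun h => hw' (by
    have := mem_map_box.1 h
    simp only [abs_le] at this haL ⊢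
    omega)
  have hbb : b ∈ (box 0 k).map (Equiv.addRight b).toEmbedding := self_mem_map_box b k
  obtain ⟨c, hc, d, hd, hcX, hdX, h1, h2, -⟩ := hbw.first_exit
    (W := ((box 0 k).map (Equiv.addRight b).toEmbedding : Set (ℤ × ℤ))) hbb hwb
  refine ⟨b, rfl, c, Finset.mem_sdiff.2 ⟨hc, hcX.2⟩, d, ?_, h1.mono le_rfl ?_, h2⟩
  · exact fun h => (Finset.mem_union.1 h).elim hd hdX.2
  · exact fun x hx => Finset.mem_sdiff.2 ⟨hx.2, hx.1.2⟩

theorem perc_real_arm_add_le (hp : p ∈ Icc (0 : ℝ) 1) {L k : ℕ} (h0 : 0 ∈ S) (hS : S ⊆ box 0 L) :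
    (perc p).real (arm 0 (k + (L + 1))) ≤ exitRate p S * (perc p).real (arm 0 k) := by
  classical
  have hsub : arm 0 (k + (L + 1)) ⊆ ⋃ e ∈ edgeBdry S, ⋃ C ∈ S.powerset.filter (innerEnd S e ∈ ·),
      {ω | clusterIn S ω = C} ∩ armAvoiding (outerEnd S e) k C := by
    intro ω hω
    obtain ⟨e, he, h1, h2⟩ := exists_armAvoiding_of_arm h0 hS hω
    simp only [mem_iUnion]
    refine ⟨e, he, clusterIn S ω, ?_, rfl, h2⟩
    exact Finset.mem_filter.2 ⟨Finset.mem_powerset.2 fun x hx => (mem_clusterIn.1 hx).1, h1⟩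
  refine (measureReal_mono hsub (measure_ne_top _ _)).trans
    ((measureReal_biUnion_finset_le _ _).trans ?_)
  rw [exitRate, Finset.sum_mul]
  refine Finset.sum_le_sum fun e he => (measureReal_biUnion_finset_le _ _).trans ?_
  obtain ⟨-, -, hin, -⟩ := mem_edgeBdry.1 he
  rw [perc_real_connEvent p h0 hin, Finset.sum_mul]
  refine Finset.sum_le_sum fun C _ => ?_
  rw [perc_real_inter hp (determined_clusterIn_eq h0 C) (determined_armAvoiding _ _ _)
    fun e h1 h2 => (Finset.mem_sdiff.1 h2).2 h1, ← perc_real_arm hp (outerEnd S e)]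
  exact mul_le_mul_of_nonneg_left (measureReal_mono (armAvoiding_subset_arm _ _ _))
    measureReal_nonneg

theorem summable_perc_real_arm (hp : p ∈ Icc (0 : ℝ) 1) (h0 : 0 ∈ S) (hS : exitRate p S < 1) :
    Summable fun k => (perc p).real (arm 0 k) := by
  obtain ⟨L, -, hL⟩ := exists_subset_box S.finite_toSet 0
  refine summable_of_sum_range_le (c := (L + 1) / (1 - exitRate p S))
    (fun _ => measureReal_nonneg) fun n => ?_
  rw [le_div_iff₀ (by linarith)]
  have h1 : ∑ k ∈ Finset.range n, (perc p).real (arm 0 k) ≤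
      ∑ k ∈ Finset.range ((L + 1) + n), (perc p).real (arm 0 k) :=
    Finset.sum_le_sum_of_subset_of_nonneg (Finset.range_mono (by omega))
      fun _ _ _ => measureReal_nonneg
  rw [Finset.sum_range_add] at h1
  have h2 : ∑ k ∈ Finset.range (L + 1), (perc p).real (arm 0 k) ≤ L + 1 := by
    simpa using Finset.sum_le_card_nsmul (Finset.range (L + 1)) _ 1
      fun k _ => measureReal_le_one (μ := perc p) (s := arm 0 k)
  have h3 : ∑ k ∈ Finset.range n, (perc p).real (arm 0 (L + 1 + k)) ≤
      exitRate p S * ∑ k ∈ Finset.range n, (perc p).real (arm 0 k) := by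
    rw [Finset.mul_sum]
    refine Finset.sum_le_sum fun k _ => ?_
    rw [add_comm (L + 1)]
    exact perc_real_arm_add_le hp h0 (by exact_mod_cast hL)
  linarith

theorem mem_arm_of_infinite (h : (openCluster ω u).Infinite) (k : ℕ) : ω ∈ arm u k := by
  obtain ⟨v, hv, hvk⟩ :=
    h.exists_notMem_finset ((box 0 k).map (Equiv.addRight u).toEmbedding)
  exact Conn.mem_exitEvent hv (self_mem_map_box u k) hvk

theorem perc_percolates_of_summable_arm (hp : p ∈ Icc (0 : ℝ) 1)
    (h : Summable fun k => (perc p).real (arm 0 k)) : perc p percolates = 0 := by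
  have hset : percolates = ⋃ u, {ω | (openCluster ω u).Infinite} := by
    ext ω
    simp [percolates]
  rw [hset]
  refine measure_iUnion_null fun u => ?_
  rw [← measureReal_eq_zero_iff (measure_ne_top _ _)]
  refine le_antisymm (ge_of_tendsto' h.tendsto_atTop_zero fun k => ?_) measureReal_nonneg
  rw [← perc_real_arm hp u k]
  exact measureReal_mono fun ω hω => mem_arm_of_infinite hω k

end ArmDecay

section Separation

variable {ω : BondConfig} {S A : Set (ℤ × ℤ)} {u v y : ℤ × ℤ} {e : Bond} {a b c d : ℤ}

/-! ### Separating dual clusters -/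

/-- The closed form `dχ · κ` has a potential supported in any rectangle containing the support
of `κ`. -/
theorem exists_potential {χ κ : ℤ × ℤ → ℤ}
    (hh : ∀ x y, (χ (x + 1, y + 1) - χ (x, y + 1)) * (κ (x, y + 1) - κ (x, y)) = 0)
    (hv : ∀ x y, (χ (x + 1, y + 1) - χ (x + 1, y)) * (κ (x + 1, y) - κ (x, y)) = 0)
    (hκ : ∀ f, κ f ≠ 0 → f ∈ Icc a b ×ˢ Icc c d) : ∃ h : ℤ × ℤ → ℤ,
      (∀ x y, h (x + 1, y) - h (x, y) = (χ (x + 1, y) - χ (x, y)) * κ (x, y)) ∧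
      (∀ x y, h (x, y + 1) - h (x, y) = (χ (x, y + 1) - χ (x, y)) * κ (x, y)) ∧
      ∀ v ∉ Icc a b ×ˢ Icc c d, h v = 0 := by
  have hκ0 : ∀ x y, ((a ≤ x ∧ x ≤ b) ∧ c ≤ y ∧ y ≤ d → False) → κ (x, y) = 0 := fun x y h => by
    by_contra h0
    exact h (hκ _ h0)
  let h : ℤ × ℤ → ℤ := fun v =>
    -∑ t ∈ Finset.Ico v.1 (b + 1), (χ (t + 1, v.2) - χ (t, v.2)) * κ (t, v.2)
  have hright : ∀ x y, b < x → h (x, y) = 0 := fun x y hx => by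
    simp only [h]
    rw [Finset.Ico_eq_empty (by omega), Finset.sum_empty, neg_zero]
  have hrow : ∀ x y, (c ≤ y ∧ y ≤ d → False) → h (x, y) = 0 := fun x y hy => by
    simp only [h, neg_eq_zero]
    exact Finset.sum_eq_zero fun t _ => by rw [hκ0 t y fun h => hy h.2, mul_zero]
  have hhor : ∀ x y, h (x + 1, y) - h (x, y) = (χ (x + 1, y) - χ (x, y)) * κ (x, y) := by
    intro x y
    by_cases hx : x ≤ b
    · simp only [h]
      rw [← Finset.insert_Ico_add_one_left_eq_Ico (show x < b + 1 by omega),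
        Finset.sum_insert (by simp)]
      ring
    · rw [hright _ _ (by omega), hright _ _ (by omega), hκ0 x y (by omega)]
      simp
  have hver : ∀ x y, h (x, y + 1) - h (x, y) = (χ (x, y + 1) - χ (x, y)) * κ (x, y) := by
    intro x y
    have hper : Function.Periodic
        (fun x => h (x, y + 1) - h (x, y) - (χ (x, y + 1) - χ (x, y)) * κ (x, y)) 1 := by
      intro x
      linear_combination hhor x (y + 1) - hhor x y + hh x y - hv x y
    have := hper.int_mul (b + 1 - x) x
    simp only [mul_one, Int.cast_id, add_sub_cancel] at this
    rw [hright _ _ (by omega), hright _ _ (by omega), hκ0 _ y (by omega)] at this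
    linarith
  refine ⟨h, hhor, hver, ?_⟩
  rintro ⟨x, y⟩ hxy
  simp only [mem_prod, mem_Icc] at hxy
  by_cases hx : b < x
  · exact hright x y hx
  by_cases hxa : x < a
  · have hper : Function.Periodic (fun y => h (x, y)) 1 := fun y => by
      have := hver x y
      rw [hκ0 x y (by omega), mul_zero] at this
      exact sub_eq_zero.1 this
    have := hper.int_mul (d + 1 - y) y
    simp only [mul_one, Int.cast_id, add_sub_cancel] at this
    rw [← this]
    exact hrow x _ (by omega)
  · exact hrow x y (by omega)

/-- If two complementary connected sets are separated by closed bonds, and one of these bonds is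
crossed by a dual cluster contained in a rectangle, then one of the sets lies in the rectangle. -/
theorem subset_or_compl_subset_of_dual (hA : ∀ u ∈ A, ∀ v ∈ A, Conn (fun _ => true) A u v)
    (hA' : ∀ u ∈ Aᶜ, ∀ v ∈ Aᶜ, Conn (fun _ => true) Aᶜ u v)
    (hcl : ∀ u ∈ A, ∀ v ∉ A, ¬ Op ω u v) (he : ¬ (e.1 ∈ A ↔ bondEnd e ∈ A))
    (hK : openCluster (dual ω) e.1 ⊆ Icc a b ×ˢ Icc c d) :
    A ⊆ Icc a b ×ˢ Icc c d ∨ Aᶜ ⊆ Icc a b ×ˢ Icc c d := by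
  classical
  let χ : ℤ × ℤ → ℤ := fun v => if v ∈ A then 1 else 0
  let κ : ℤ × ℤ → ℤ := fun f => if f ∈ openCluster (dual ω) e.1 then 1 else 0
  have hκ : ∀ f, κ f ≠ 0 → f ∈ Icc a b ×ˢ Icc c d := fun f hf => hK (by
    by_contra h
    exact hf (if_neg h))
  have hclosed : ∀ e', ¬ (e'.1 ∈ A ↔ bondEnd e' ∈ A) → ω e' = false := by
    intro e' h'
    by_contra hne
    have hop : Op ω e'.1 (bondEnd e') := ⟨e', Or.inl ⟨rfl, rfl⟩, by simpa using hne⟩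
    by_cases h1 : e'.1 ∈ A
    · exact hcl _ h1 _ (fun h2 => h' (iff_of_true h1 h2)) hop
    · exact hcl _ (by by_contra h2; exact h' (iff_of_false h1 h2)) _ h1 hop.symm
  have hκeq : ∀ f g, Op (dual ω) f g → κ f = κ g := fun f g hfg => by
    have : f ∈ openCluster (dual ω) e.1 ↔ g ∈ openCluster (dual ω) e.1 :=
      ⟨fun h => Conn.trans h (Conn.single hfg trivial trivial),
        fun h => Conn.trans h (Conn.single hfg.symm trivial trivial)⟩
    simp only [κ, this]
  have hχ : ∀ u v, (u ∈ A ↔ v ∈ A) → χ u = χ v := fun u v h => by simp only [χ, h]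
  have hh : ∀ x y, (χ (x + 1, y + 1) - χ (x, y + 1)) * (κ (x, y + 1) - κ (x, y)) = 0 := by
    intro x y
    by_cases hiff : ((x, y + 1) ∈ A ↔ (x + 1, y + 1) ∈ A)
    · rw [hχ _ _ hiff, sub_self, zero_mul]
    · rw [hκeq (x, y + 1) (x, y), sub_self, mul_zero]
      refine Op.symm ⟨((x, y), true), Or.inl ⟨rfl, rfl⟩, ?_⟩
      rw [dual_true, hclosed _ hiff, Bool.not_false]
  have hv : ∀ x y, (χ (x + 1, y + 1) - χ (x + 1, y)) * (κ (x + 1, y) - κ (x, y)) = 0 := by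
    intro x y
    by_cases hiff : ((x + 1, y) ∈ A ↔ (x + 1, y + 1) ∈ A)
    · rw [hχ _ _ hiff, sub_self, zero_mul]
    · rw [hκeq (x + 1, y) (x, y), sub_self, mul_zero]
      refine Op.symm ⟨((x, y), false), Or.inl ⟨rfl, rfl⟩, ?_⟩
      rw [dual_false, hclosed _ hiff, Bool.not_false]
  obtain ⟨h, hhor, hver, hsupp⟩ := exists_potential hh hv hκ
  have hbond : ∀ e', h (bondEnd e') - h e'.1 = (χ (bondEnd e') - χ e'.1) * κ e'.1 := by
    rintro ⟨⟨x, y⟩, o⟩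
    cases o
    · exact hhor x y
    · exact hver x y
  have hconst : ∀ B : Set (ℤ × ℤ), (∀ u ∈ B, ∀ v ∈ B, (u ∈ A ↔ v ∈ A)) →
      ∀ u v, Conn (fun _ => true) B u v → h u = h v := by
    intro B hB u v huv
    induction huv with
    | refl => rfl
    | tail _ hstep ih =>
      obtain ⟨⟨e', hj, -⟩, hu, hv⟩ := hstep
      have := hbond e'
      rw [ih]
      rcases hj with ⟨rfl, rfl⟩ | ⟨rfl, rfl⟩ <;>
      · rw [hχ _ _ (hB _ hu _ hv), sub_self, zero_mul] at this
        linarith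
  have hcA : ∀ u ∈ A, ∀ v ∈ A, h u = h v := fun u hu v hv =>
    hconst A (fun _ h1 _ h2 => iff_of_true h1 h2) u v (hA u hu v hv)
  have hcA' : ∀ u ∈ Aᶜ, ∀ v ∈ Aᶜ, h u = h v := fun u hu v hv =>
    hconst Aᶜ (fun _ h1 _ h2 => iff_of_false h1 h2) u v (hA' u hu v hv)
  have hne : h (bondEnd e) ≠ h e.1 := by
    have hκe : κ e.1 = 1 := if_pos (Conn.refl _ _ _)
    have := hbond e
    rw [hκe, mul_one] at this
    intro heq
    rw [heq, sub_self] at this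
    simp only [χ] at this
    split_ifs at this with h1 h2 h2 <;> first | omega | exact he (by tauto)
  by_contra hno
  rw [not_or, not_subset, not_subset] at hno
  obtain ⟨⟨x, hx, hxR⟩, ⟨z, hz, hzR⟩⟩ := hno
  have hzero : ∀ v, h v = 0 := fun v => by
    by_cases hv : v ∈ A
    · rw [hcA v hv x hx, hsupp x hxR]
    · rw [hcA' v hv z hz, hsupp z hzR]
  exact hne (by rw [hzero, hzero])

theorem conn_univ (u v : ℤ × ℤ) : Conn (fun _ => true) univ u v := by
  have := conn_prod (u := u) (v := v) ordConnected_univ ordConnected_univ (by simp) (by simp)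
  rwa [univ_prod_univ] at this

/-- The vertices connected to `y` by a lattice path avoiding `S`. -/
def side (S : Set (ℤ × ℤ)) (y : ℤ × ℤ) : Set (ℤ × ℤ) := {v | Conn (fun _ => true) Sᶜ y v}

theorem subset_compl_side (hy : y ∉ S) : S ⊆ (side S y)ᶜ := fun _ hv h => Conn.mem h hy hv

theorem conn_side (hu : u ∈ side S y) (hv : v ∈ side S y) :
    Conn (fun _ => true) (side S y) u v := by
  have key : ∀ w ∈ side S y, Conn (fun _ => true) (side S y) y w := by
    intro w hw
    induction hw with
    | refl => exact Conn.refl _ _ _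
    | @tail b c hb hstep ih =>
      exact ih.trans (Conn.single hstep.1 hb (Relation.ReflTransGen.tail hb hstep))
  exact (key u hu).symm.trans (key v hv)

theorem mem_of_adj_side (hy : y ∉ S) (hu : u ∈ side S y) (hv : v ∉ side S y)
    (h : Op (fun _ => true) u v) : v ∈ S := by
  by_contra hvS
  exact hv (Conn.trans hu (Conn.single h (Conn.mem hu hy) hvS))

theorem conn_compl_side (hy : y ∉ S) (hS : ∀ u ∈ S, ∀ v ∈ S, Conn (fun _ => true) S u v)
    (hS0 : S.Nonempty) (hu : u ∈ (side S y)ᶜ) (hv : v ∈ (side S y)ᶜ) :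
    Conn (fun _ => true) (side S y)ᶜ u v := by
  have key : ∀ w ∈ (side S y)ᶜ, ∃ s ∈ S, Conn (fun _ => true) (side S y)ᶜ w s := by
    intro w hw
    obtain ⟨s, hs⟩ := hS0
    rcases (conn_univ w s).inside_or_exit hw with h | ⟨a, ha, b, hb, -, -, h, hab, -⟩
    · exact ⟨s, hs, h.mono le_rfl inter_subset_right⟩
    · rw [mem_compl_iff, not_not] at hb
      exact ⟨a, mem_of_adj_side hy hb ha hab.symm, h.mono le_rfl inter_subset_right⟩
  obtain ⟨s, hs, hus⟩ := key u hu
  obtain ⟨t, ht, hvt⟩ := key v hv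
  exact hus.trans (((hS s hs t ht).mono le_rfl (subset_compl_side hy)).trans hvt.symm)

/-- A bond at the boundary of a side of a union of clusters is crossed by a dual cluster which
surrounds one of the two sides. -/
theorem side_subset_or_compl_subset (hy : y ∉ S)
    (hS : ∀ u ∈ S, ∀ v ∈ S, Conn (fun _ => true) S u v) (hS0 : S.Nonempty)
    (hcl : ∀ u ∈ S, ∀ v ∉ S, ¬ Op ω u v) (he : ¬ (e.1 ∈ side S y ↔ bondEnd e ∈ side S y))
    (hK : openCluster (dual ω) e.1 ⊆ Icc a b ×ˢ Icc c d) :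
    side S y ⊆ Icc a b ×ˢ Icc c d ∨ (side S y)ᶜ ⊆ Icc a b ×ˢ Icc c d := by
  refine subset_or_compl_subset_of_dual (fun u hu v hv => conn_side hu hv)
    (fun u hu v hv => conn_compl_side hy hS hS0 hu hv) (fun u hu v hv h => ?_) he hK
  exact hcl v (mem_of_adj_side hy hu hv (h.mono fun _ => Bool.le_true _)) u
    (Conn.mem hu hy) h.symm

end Separation

section InfiniteCluster

variable {ω : BondConfig} {u v x y : ℤ × ℤ} {p : ℝ}

/-! ### Existence and uniqueness of the infinite cluster -/

theorem conn_openCluster (h : v ∈ openCluster ω u) : Conn ω (openCluster ω u) u v := by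
  induction h with
  | refl => exact Conn.refl _ _ _
  | @tail b c hb hstep ih =>
    exact ih.trans (Conn.single hstep.1 hb (Relation.ReflTransGen.tail hb hstep))

theorem Op.mem_openCluster (h : Op ω u v) (hu : u ∈ openCluster ω x) : v ∈ openCluster ω x :=
  Conn.trans hu (Conn.single h trivial trivial)

theorem openCluster_subset_of_notMem_arm {k : ℕ} (h : ω ∉ arm u k) :
    openCluster ω u ⊆ Icc (u.1 - k) (u.1 + k) ×ˢ Icc (u.2 - k) (u.2 + k) := by
  intro v hv
  by_contra hno
  refine h (Conn.mem_exitEvent hv (self_mem_map_box u k) fun hv' => hno ?_)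
  have := mem_map_box.1 hv'
  rw [abs_le, abs_le] at this
  simp only [mem_prod, mem_Icc]
  omega

theorem exists_dual_arm (hω : ω ∉ percolates) (n : ℕ) :
    ∃ k ≥ n, dual ω ∈ arm ((k : ℤ) + 1, 0) k := by
  classical
  have hfin : ∀ u, (openCluster ω u).Finite := fun u =>
    Set.not_infinite.1 fun h => hω ⟨u, h⟩
  let S : Set (ℤ × ℤ) := ⋃ u ∈ box 0 ((n : ℤ) + 1), openCluster ω u
  have hS : S.Finite := (box 0 ((n : ℤ) + 1)).finite_toSet.biUnion fun u _ => hfin u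
  have hmemS : ∀ {u}, u ∈ S ↔ ∃ v ∈ box 0 ((n : ℤ) + 1), u ∈ openCluster ω v := by
    simp [S]
  have hboxS : (box 0 ((n : ℤ) + 1) : Set (ℤ × ℤ)) ⊆ S := fun u hu =>
    hmemS.2 ⟨u, hu, Conn.refl _ _ _⟩
  obtain ⟨N, -, hN⟩ := exists_subset_box hS 0
  have hout : ∀ t : ℤ, N < t → (t, 0) ∉ S := fun t ht h => by
    have := (mem_box.1 (hN h)).1.2
    simp at this
    omega
  have hSconn : ∀ u ∈ S, ∀ v ∈ S, Conn (fun _ => true) S u v := by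
    intro u hu v hv
    obtain ⟨u', hu', huu⟩ := hmemS.1 hu
    obtain ⟨v', hv', hvv⟩ := hmemS.1 hv
    have hsub : ∀ w ∈ box 0 ((n : ℤ) + 1), openCluster ω w ⊆ S := fun w hw z hz =>
      hmemS.2 ⟨w, hw, hz⟩
    have h1 := (conn_openCluster huu).mono (fun e => Bool.le_true (ω e)) (hsub u' hu')
    have h2 := (conn_openCluster hvv).mono (fun e => Bool.le_true (ω e)) (hsub v' hv')
    have h3 := (conn_box (ω := fun _ => true) (fun _ _ _ => rfl) hu' hv').mono le_rfl hboxS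
    exact h1.symm.trans (h3.trans h2)
  have hcl : ∀ u ∈ S, ∀ v ∉ S, ¬ Op ω u v := by
    intro u hu v hv h
    obtain ⟨u', hu', huu⟩ := hmemS.1 hu
    exact hv (hmemS.2 ⟨u', hu', h.mem_openCluster huu⟩)
  have hy : ((N : ℤ) + 1, (0 : ℤ)) ∉ S := hout _ (by omega)
  have hright : ∀ t : ℤ, N < t → (t, 0) ∈ side S ((N : ℤ) + 1, 0) := fun t ht =>
    conn_horizontal (by omega) fun s hs _ => hout s (by omega)
  have hex : ∃ j : ℕ, ((j : ℤ), (0 : ℤ)) ∈ side S ((N : ℤ) + 1, 0) :=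
    ⟨N + 1, hright _ (by push_cast; omega)⟩
  have hboxA : ∀ w ∈ box 0 ((n : ℤ) + 1), w ∉ side S ((N : ℤ) + 1, 0) := fun w hw =>
    subset_compl_side hy (hboxS hw)
  have hlarge : n + 1 < Nat.find hex := by
    by_contra hle
    refine hboxA _ (mem_box.2 ?_) (Nat.find_spec hex)
    simp only
    omega
  obtain ⟨k, hk⟩ : ∃ k, Nat.find hex = k + 2 := ⟨Nat.find hex - 2, by omega⟩
  have hk1 : ((k : ℤ) + 1, (0 : ℤ)) ∉ side S ((N : ℤ) + 1, 0) := by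
    have := Nat.find_min hex (m := k + 1) (by omega)
    exact_mod_cast this
  have hk2 : ((k : ℤ) + 1 + 1, (0 : ℤ)) ∈ side S ((N : ℤ) + 1, 0) := by
    have := Nat.find_spec hex
    rw [hk] at this
    convert this using 2
    push_cast
    ring
  refine ⟨k, by omega, ?_⟩
  by_contra hno
  have he : ¬ ((((k : ℤ) + 1, (0 : ℤ)), false).1 ∈ side S ((N : ℤ) + 1, 0) ↔
      bondEnd (((k : ℤ) + 1, (0 : ℤ)), false) ∈ side S ((N : ℤ) + 1, 0)) :=
    fun h => hk1 (h.2 hk2)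
  rcases side_subset_or_compl_subset hy hSconn ⟨_, hboxS (show (0 : ℤ × ℤ) ∈ box 0 ((n : ℤ) + 1) from
    mem_box.2 (by simp; omega))⟩ hcl he (openCluster_subset_of_notMem_arm hno) with h | h
  · have := h (hright (N + 1 + (k + 1 + k + 1)) (by omega))
    simp only [mem_prod, mem_Icc] at this
    omega
  · have := h (hboxA 0 (mem_box.2 (by simp; omega)))
    simp only [mem_prod, mem_Icc, Prod.fst_zero, Prod.snd_zero] at this
    omega

theorem conn_of_infinite (hω : dual ω ∉ percolates) (hx : (openCluster ω x).Infinite)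
    (hy : (openCluster ω y).Infinite) : Conn ω univ x y := by
  by_contra hxy
  have hyS : y ∉ openCluster ω x := hxy
  have hyA : openCluster ω y ⊆ side (openCluster ω x) y := fun v hv =>
    (conn_openCluster hv).mono (fun e => Bool.le_true (ω e)) fun w hw hw' =>
      hxy (Conn.trans hw' (Conn.symm hw))
  have hxA := subset_compl_side hyS
  obtain ⟨a, ha, b, hb, -, -, -, ⟨e, hj, -⟩, -⟩ := (conn_univ y x).first_exit
    (hyA (Conn.refl _ _ _)) (hxA (Conn.refl ω univ x))
  have he : ¬ (e.1 ∈ side (openCluster ω x) y ↔ bondEnd e ∈ side (openCluster ω x) y) := by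
    rcases hj with ⟨rfl, rfl⟩ | ⟨rfl, rfl⟩
    · exact fun h => hb (h.1 ha)
    · exact fun h => hb (h.2 ha)
  obtain ⟨N, -, hN⟩ := exists_subset_box
    (Set.not_infinite.1 fun h => hω ⟨e.1, h⟩ : (openCluster (dual ω) e.1).Finite) 0
  rw [box, Finset.coe_product, Finset.coe_Icc] at hN
  have hfin := (finite_Icc (-(N : ℤ) - 0) N).prod (finite_Icc (-(N : ℤ) - 0) N)
  rcases side_subset_or_compl_subset hyS
    (fun u hu v hv => ((conn_openCluster hu).symm.trans (conn_openCluster hv)).mono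
      (fun e => Bool.le_true (ω e)) le_rfl) ⟨x, Conn.refl _ _ _⟩
    (fun u hu v hv h => hv (h.mem_openCluster hu)) he hN with h | h
  · exact hy (hfin.subset (hyA.trans h))
  · exact hx (hfin.subset (hxA.trans h))

theorem perc_percolates_of_half_lt (hp : p ∈ Ioc (1 / 2 : ℝ) 1) : perc p percolates = 1 := by
  refine perc_percolates_of_exitRate hp fun S h0 => ?_
  by_contra! hS
  have hhalf : (1 / 2 : ℝ) ∈ Icc (0 : ℝ) 1 := by norm_num
  have hsum := summable_perc_real_arm hhalf h0 hS
  have h1 : ∀ᵐ ω ∂perc (1 / 2), ω ∉ percolates :=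
    measure_eq_zero_iff_ae_notMem.1 (perc_percolates_of_summable_arm hhalf hsum)
  have h2 : ∀ᵐ ω ∂perc (1 / 2), ∀ᶠ k : ℕ in Filter.atTop,
      ω ∉ dual ⁻¹' arm ((k : ℤ) + 1, 0) k := by
    refine ae_eventually_notMem ?_
    have hk : ∀ k : ℕ, perc (1 / 2) (dual ⁻¹' arm ((k : ℤ) + 1, 0) k) =
        ENNReal.ofReal ((perc (1 / 2)).real (arm 0 k)) := by
      intro k
      rw [← ofReal_measureReal, perc_real_dual hhalf (measurableSet_arm _ _), sub_half,
        perc_real_arm hhalf]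
    simp only [hk]
    exact hsum.tsum_ofReal_ne_top
  obtain ⟨ω, hω, hev⟩ := (h1.and h2).exists
  obtain ⟨n, hn⟩ := Filter.eventually_atTop.1 hev
  obtain ⟨k, hk, harm⟩ := exists_dual_arm hω n
  exact hn k hk harm

theorem ae_exists_unique_infinite (hp : p ∈ Ioc (1 / 2 : ℝ) 1) : ∀ᵐ ω ∂perc p,
    (∃ x, (openCluster ω x).Infinite) ∧ ∀ x y, (openCluster ω x).Infinite →
      (openCluster ω y).Infinite → Conn ω univ x y := by
  have hp' : p ∈ Icc (0 : ℝ) 1 := ⟨by linarith [hp.1], hp.2⟩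
  have h1 : ∀ᵐ ω ∂perc p, ω ∈ percolates :=
    (prob_compl_eq_zero_iff measurableSet_percolates).2 (perc_percolates_of_half_lt hp)
  have h2 : ∀ᵐ ω ∂perc p, dual ω ∉ percolates := by
    have h := perc_percolates_of_lt_half (p := 1 - p) (by linarith [hp.2]) (by linarith [hp.1])
    rw [← map_dual_perc hp'] at h
    exact ae_of_ae_map measurable_dual.aemeasurable (measure_eq_zero_iff_ae_notMem.1 h)
  filter_upwards [h1, h2] with ω hω hω'
  exact ⟨hω, fun x y => conn_of_infinite hω'⟩

end InfiniteCluster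

section LatticeEdges

variable {ω : Config} {u v : ℤ × ℤ} {p : ℝ}

/-! ### Bonds and lattice edges -/

theorem latticeAdj_iff : LatticeAdj u v ↔ ∃ e, Joins e u v := by
  obtain ⟨u1, u2⟩ := u
  obtain ⟨v1, v2⟩ := v
  simp only [LatticeAdj, Joins, bondEnd, Prod.exists, Bool.exists_bool, Bool.false_eq_true, if_true,
    if_false, Prod.mk.injEq]
  constructor
  · intro h
    rcases (by omega : (v1 = u1 + 1 ∧ v2 = u2) ∨ (u1 = v1 + 1 ∧ v2 = u2) ∨
      (v1 = u1 ∧ v2 = u2 + 1) ∨ (v1 = u1 ∧ u2 = v2 + 1)) with h | h | h | h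
    · exact ⟨u1, u2, Or.inl (Or.inl ⟨⟨rfl, rfl⟩, h⟩)⟩
    · exact ⟨v1, v2, Or.inl (Or.inr ⟨⟨rfl, rfl⟩, h.1, h.2.symm⟩)⟩
    · exact ⟨u1, u2, Or.inr (Or.inl ⟨⟨rfl, rfl⟩, h⟩)⟩
    · exact ⟨v1, v2, Or.inr (Or.inr ⟨⟨rfl, rfl⟩, h.1.symm, h.2⟩)⟩
  · rintro ⟨a, b, h⟩
    omega

theorem joins_iff {e : Bond} : Joins e u v ↔ s(e.1, bondEnd e) = s(u, v) := by
  rw [Sym2.eq_iff, Joins]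
  tauto

/-- The lattice edge with the same endpoints as a bond. -/
def bondEdge (e : Bond) : LatticeEdge :=
  ⟨s(e.1, bondEnd e), e.1, bondEnd e, latticeAdj_iff.2 ⟨e, Or.inl ⟨rfl, rfl⟩⟩, rfl⟩

theorem bondEdge_bijective : Function.Bijective bondEdge := by
  constructor
  · rintro ⟨⟨a, b⟩, o⟩ ⟨⟨a', b'⟩, o'⟩ h
    have h := Sym2.eq_iff.1 (Subtype.ext_iff.1 h)
    cases o <;> cases o' <;> simp [bondEnd] at h ⊢ <;> omega
  · rintro ⟨_, u, v, h, rfl⟩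
    obtain ⟨e, he⟩ := latticeAdj_iff.1 h
    exact ⟨e, Subtype.ext (joins_iff.1 he)⟩

/-- The bond configuration corresponding to a configuration of lattice edges. -/
def bondConfig (ω : Config) : BondConfig := fun e => ω (bondEdge e)

theorem measurable_bondConfig : Measurable bondConfig :=
  measurable_pi_lambda _ fun _ => measurable_pi_apply _

theorem openAdj_iff : OpenAdj ω u v ↔ Op (bondConfig ω) u v := by
  constructor
  · rintro ⟨e, he, h⟩
    obtain ⟨e, rfl⟩ := bondEdge_bijective.2 e
    exact ⟨e, joins_iff.2 he, h⟩
  · rintro ⟨e, hj, h⟩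
    exact ⟨bondEdge e, joins_iff.1 hj, h⟩

theorem cluster_eq (ω : Config) (u : ℤ × ℤ) : cluster ω u = openCluster (bondConfig ω) u := by
  ext v
  have : OpenAdj ω = fun a b => Op (bondConfig ω) a b ∧ a ∈ univ ∧ b ∈ univ := by
    ext a b
    simp [openAdj_iff]
  simp only [cluster, ConnectedIn, openCluster, Conn, this]

theorem map_bondConfig (hp : p ∈ Icc (0 : ℝ) 1) (P : Measure Config) [IsProbabilityMeasure P]
    (hP : IsBernoulliPercolation P p) : P.map bondConfig = perc p := by
  have : IsProbabilityMeasure (P.map bondConfig) :=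
    Measure.isProbabilityMeasure_map measurable_bondConfig.aemeasurable
  refine eq_perc_of_cylinder hp _ fun s g => ?_
  let E := Equiv.ofBijective bondEdge bondEdge_bijective
  rw [Measure.map_apply measurable_bondConfig (measurableSet_cylinder s g)]
  have h := hP (s.map E.toEmbedding) (g ∘ E.symm)
  simp only [Finset.mem_map_equiv, Finset.prod_map, Equiv.coe_toEmbedding, Function.comp_apply,
    Equiv.symm_apply_apply] at h
  refine Eq.trans (congrArg P ?_) h
  ext ω
  refine ⟨fun hω e he => ?_, fun hω e he => ?_⟩
  · rw [← hω _ he]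
    exact congrArg ω (E.apply_symm_apply e).symm
  · have := hω (E e) (by rwa [E.symm_apply_apply])
    rwa [E.symm_apply_apply] at this

end LatticeEdges

theorem kesten_phase_transition (p : ℝ) (hp0 : 0 ≤ p) (hp1 : p ≤ 1)
    (P : Measure Config) [IsProbabilityMeasure P]
    (hP : IsBernoulliPercolation P p) :
    (p < 1/2 → ∀ᵐ ω ∂P, ∀ a : ℤ × ℤ, ¬ (cluster ω a).Infinite) ∧
    (1/2 < p → ∀ᵐ ω ∂P, ∃! c : Set (ℤ × ℤ),
        (∃ a : ℤ × ℤ, c = cluster ω a) ∧ c.Infinite) := by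
  have hmap := map_bondConfig ⟨hp0, hp1⟩ P hP
  simp only [cluster_eq]
  constructor
  · intro hp
    have h := perc_percolates_of_lt_half hp0 hp
    rw [← hmap] at h
    filter_upwards [ae_of_ae_map measurable_bondConfig.aemeasurable
      (measure_eq_zero_iff_ae_notMem.1 h)] with ω hω a ha
    exact hω ⟨a, ha⟩
  · intro hp
    have h := ae_exists_unique_infinite ⟨hp, hp1⟩
    rw [← hmap] at h
    filter_upwards [ae_of_ae_map measurable_bondConfig.aemeasurable h] with ω ⟨⟨x, hx⟩, huniq⟩
    refine ⟨_, ⟨⟨x, rfl⟩, hx⟩, ?_⟩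
    rintro _ ⟨⟨y, rfl⟩, hy⟩
    have hxy := huniq x y hx hy
    ext z
    exact ⟨hxy.trans, hxy.symm.trans⟩
end
end

section
/- Let C ⊆ ℝ² be a nonempty compact path-connected set which equals the closure of its interior, and suppose the topological frontier of C is the union of the images of finitely many rectifiable Jordan loops γ₁, …, γ_n with pairwise disjoint images. Then diam_chem(C) ≤ 2 (length(γ₁) + ⋯ + length(γ_n)). -/
open Set
open scoped ENNReal

noncomputable section

abbrev Plane : Type := EuclideanSpace ℝ (Fin 2)

/-- The chemical distance in `E`: infimum of Euclidean lengths of continuous rectifiable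
paths from `x` to `y` contained in `E` (`∞` if no such path exists). -/
def chemDist (E : Set Plane) (x y : Plane) : ℝ≥0∞ :=
  ⨅ (γ : ℝ → Plane) (_ : ContinuousOn γ (Set.Icc 0 1) ∧ γ 0 = x ∧ γ 1 = y ∧
      Set.MapsTo γ (Set.Icc 0 1) E), eVariationOn γ (Set.Icc 0 1)

/-- The chemical diameter of a set. -/
def diamChem (A : Set Plane) : ℝ≥0∞ := ⨆ x ∈ A, ⨆ y ∈ A, chemDist A x y

/-- A rectifiable Jordan loop: continuous on `[0,1]`, closed, injective on `[0,1)`,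
of finite total variation. -/
def IsRectifiableJordanLoop (γ : ℝ → Plane) : Prop :=
  ContinuousOn γ (Set.Icc 0 1) ∧ γ 0 = γ 1 ∧ Set.InjOn γ (Set.Ico 0 1) ∧
    eVariationOn γ (Set.Icc 0 1) ≠ ⊤


/-- A family of integer multiples of `2 * π` that varies continuously over a preconnected set is
constant. -/
theorem IsPreconnected.eq_of_circleExp_eq_one {X : Type*} [TopologicalSpace X] {A : Set X}
    (hA : IsPreconnected A) {f : X → ℝ} (hf : Continuous f)
    (h : ∀ z ∈ A, Circle.exp (f z) = 1) {a b : X} (ha : a ∈ A) (hb : b ∈ A) : f a = f b := by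
  have hcount : (range fun m : ℤ => m * (2 * Real.pi)).Countable := countable_range _
  refine hcount.isTotallyDisconnected (f '' A) ?_ (hA.image f hf.continuousOn)
    (mem_image_of_mem f ha) (mem_image_of_mem f hb)
  rintro _ ⟨z, hz, rfl⟩
  obtain ⟨m, hm⟩ := Circle.exp_eq_one.mp (h z hz)
  exact ⟨m, hm.symm⟩

/-- A form of unicoherence: if the frontier of a connected closed set `C` is split into two disjoint
closed pieces, no connected subset of the closed complementary region joins them. -/
theorem IsPreconnected.not_joins_frontier_pieces {E : Type*} [NormedAddCommGroup E]
    [NormedSpace ℝ E] {C F₁ F₂ A : Set E} (hC : IsPreconnected C)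
    (hF₁ : IsClosed F₁) (hF₂ : IsClosed F₂) (hdisj : Disjoint F₁ F₂)
    (hfront : frontier C ⊆ F₁ ∪ F₂) (hA : IsPreconnected A) (hAC : A ⊆ closure Cᶜ) {a b : E}
    (ha : a ∈ A ∩ C ∩ F₁) (hb : b ∈ A ∩ C ∩ F₂) : False := by
  classical
  obtain ⟨g, hg₁, hg₂, -⟩ := exists_continuous_zero_one_of_isClosed hF₁ hF₂ hdisj
  have hexp : ∀ z ∈ frontier C, Circle.exp (-(Real.pi * g z)) = Circle.exp (Real.pi * g z) := by
    intro z hz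
    rcases hfront hz with h | h
    · simp [hg₁ h]
    · rw [Circle.exp_eq_exp]
      exact ⟨-1, by simp only [hg₂ h, Pi.one_apply]; push_cast; ring⟩
  have hcont : Continuous (C.piecewise (fun z => Circle.exp (-(Real.pi * g z)))
      (fun z => Circle.exp (Real.pi * g z))) :=
    Continuous.piecewise hexp (by fun_prop) (by fun_prop)
  obtain ⟨e₀, he₀⟩ := Circle.exp_surjective
    (C.piecewise (fun z => Circle.exp (-(Real.pi * g z))) (fun z => Circle.exp (Real.pi * g z)) a)
  obtain ⟨θ, ⟨-, hθ⟩, -⟩ :=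
    Circle.isCoveringMap_exp.existsUnique_continuousMap_lifts ⟨_, hcont⟩ a e₀ he₀
  have hθC : ∀ z ∈ C, Circle.exp (θ z) = Circle.exp (-(Real.pi * g z)) := fun z hz => by
    simpa [hz] using congrFun hθ z
  have hθA : ∀ z ∈ A, Circle.exp (θ z) = Circle.exp (Real.pi * g z) := fun z hz => by
    by_cases hzC : z ∈ C
    · rw [hθC z hzC]
      refine hexp z ?_
      rw [frontier_eq_closure_inter_closure]
      exact ⟨subset_closure hzC, hAC hz⟩
    · simpa [hzC] using congrFun hθ z
  have h₁ : θ a + Real.pi * g a = θ b + Real.pi * g b :=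
    hC.eq_of_circleExp_eq_one (f := fun z => θ z + Real.pi * g z) (by fun_prop)
      (fun z hz => by simp [Circle.exp_add, hθC z hz, Circle.exp_neg]) ha.1.2 hb.1.2
  have h₂ : θ a - Real.pi * g a = θ b - Real.pi * g b :=
    hA.eq_of_circleExp_eq_one (f := fun z => θ z - Real.pi * g z) (by fun_prop)
      (fun z hz => by simp [Circle.exp_sub, hθA z hz]) ha.1.1 hb.1.1
  have hga : g a = 0 := hg₁ ha.2
  have hgb : g b = 1 := hg₂ hb.2
  rw [hga, hgb] at h₁ h₂
  linarith [Real.pi_pos]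

/-- A closed subset of the line omitting a point `t` between two of its points has a gap
around `t`. -/
theorem IsClosed.exists_gap {G : Set ℝ} (hG : IsClosed G) {u v t : ℝ} (hu : u ∈ G) (hv : v ∈ G)
    (ht : t ∈ Icc u v) (htG : t ∉ G) :
    ∃ a ∈ G, ∃ b ∈ G, u ≤ a ∧ a < t ∧ t < b ∧ b ≤ v ∧ ∀ s ∈ Ioo a b, s ∉ G := by
  obtain ⟨a, ⟨haG, ha⟩, hamax⟩ :=
    ((isCompact_Icc (a := u) (b := t)).inter_left hG).exists_isGreatest
      ⟨u, hu, le_rfl, ht.1⟩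
  obtain ⟨b, ⟨hbG, hb⟩, hbmin⟩ :=
    ((isCompact_Icc (a := t) (b := v)).inter_left hG).exists_isLeast
      ⟨v, hv, ht.2, le_rfl⟩
  refine ⟨a, haG, b, hbG, ha.1, lt_of_le_of_ne ha.2 (by rintro rfl; exact htG haG),
    lt_of_le_of_ne hb.1 (by rintro rfl; exact htG hbG), hb.2, fun s hs hsG => ?_⟩
  rcases le_total s t with h | h
  · exact hs.1.not_ge (hamax ⟨hsG, ha.1.trans hs.1.le, h⟩)
  · exact hs.2.not_ge (hbmin ⟨hsG, h, hs.2.le.trans hb.2⟩)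

/-- Travelling along `[u, v]` inside the closed set `G`, while bypassing every gap of `G` by means
of a set `K i` meeting both its ends, costs at most the length of `[u, v]` plus the sum of the
costs `ℓ i` of travelling between points of `K i`. -/
theorem cost_le_of_gaps {ι : Type*} {D : ℝ → ℝ → ℝ≥0∞} {G : Set ℝ} {K : ι → Set ℝ}
    {ℓ : ι → ℝ≥0∞} {c : ℝ≥0∞} (hG : IsClosed G) (hK : ∀ i, IsClosed (K i)) (hKG : ∀ i, K i ⊆ G)
    (htri : ∀ a b d, D a d ≤ D a b + D b d)
    (hstraight : ∀ a b, a ≤ b → Icc a b ⊆ G → D a b ≤ ENNReal.ofReal (b - a) * c)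
    (hjump : ∀ i, ∀ a ∈ K i, ∀ b ∈ K i, D a b ≤ ℓ i) (S : Finset ι) {u v : ℝ} (huv : u ≤ v)
    (hu : u ∈ G) (hv : v ∈ G)
    (hgap : ∀ a ∈ G, ∀ b ∈ G, u ≤ a → a < b → b ≤ v → (∀ s ∈ Ioo a b, s ∉ G) →
      ∃ i ∈ S, a ∈ K i ∧ b ∈ K i) :
    D u v ≤ ENNReal.ofReal (v - u) * c + ∑ i ∈ S, ℓ i := by
  classical
  induction S using Finset.strongInduction generalizing u with
  | H S ih =>
  by_cases hIcc : Icc u v ⊆ G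
  · exact (hstraight u v huv hIcc).trans le_self_add
  obtain ⟨t, ht, htG⟩ := not_subset.mp hIcc
  obtain ⟨a₀, ha₀, b₀, hb₀, hua₀, hat₀, htb₀, hbv₀, hab₀⟩ := hG.exists_gap hu hv ht htG
  obtain ⟨i₀, hi₀, hai₀, -⟩ := hgap a₀ ha₀ b₀ hb₀ hua₀ (hat₀.trans htb₀) hbv₀ hab₀
  have hcpt : ∀ i, IsCompact (K i ∩ Icc u v) := fun i => isCompact_Icc.inter_left (hK i)
  obtain ⟨p, ⟨hpK, hp⟩, hpmin⟩ :=
    (S.isCompact_biUnion fun i _ => hcpt i).exists_isLeast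
      ⟨a₀, mem_biUnion hi₀ ⟨hai₀, hua₀, (hat₀.trans htb₀).le.trans hbv₀⟩⟩
    |>.imp fun p hp => by
      obtain ⟨i, hi, h⟩ := mem_iUnion₂.mp hp.1
      exact (⟨⟨⟨i, hi, h.1⟩, h.2⟩, hp.2⟩ :
        ((∃ i ∈ S, p ∈ K i) ∧ p ∈ Icc u v) ∧ p ∈ lowerBounds (⋃ i ∈ S, K i ∩ Icc u v))
  obtain ⟨i, hi, hpi⟩ := hpK
  obtain ⟨q, ⟨hqi, hq⟩, hqmax⟩ := (hcpt i).exists_isGreatest ⟨p, hpi, hp⟩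
  have hup : Icc u p ⊆ G := by
    intro s hs
    by_contra hsG
    obtain ⟨a, ha, b, hb, hua, has, hsb, hbv, hab⟩ :=
      hG.exists_gap hu hv ⟨hs.1, hs.2.trans hp.2⟩ hsG
    obtain ⟨j, hj, haj, -⟩ := hgap a ha b hb hua (has.trans hsb) hbv hab
    have := hpmin (mem_biUnion hj ⟨haj, hua, (has.trans hsb).le.trans hbv⟩)
    linarith [hs.2]
  have hrest : D q v ≤ ENNReal.ofReal (v - q) * c + ∑ j ∈ S.erase i, ℓ j := by
    refine ih _ (Finset.erase_ssubset hi) hq.2 (hKG i hqi) fun a ha b hb hqa hab hbv hgap' => ?_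
    obtain ⟨j, hj, haj, hbj⟩ := hgap a ha b hb (hq.1.trans hqa) hab hbv hgap'
    refine ⟨j, Finset.mem_erase.mpr ⟨?_, hj⟩, haj, hbj⟩
    rintro rfl
    have := hqmax ⟨hbj, hq.1.trans (hqa.trans hab.le), hbv⟩
    linarith
  have hpq : p ≤ q := hqmax ⟨hpi, hp⟩
  have hlen : ENNReal.ofReal (p - u) + ENNReal.ofReal (v - q) ≤ ENNReal.ofReal (v - u) := by
    rw [← ENNReal.ofReal_add (by linarith [hp.1]) (by linarith [hq.2])]
    exact ENNReal.ofReal_le_ofReal (by linarith)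
  calc D u v ≤ D u p + (D p q + D q v) :=
        (htri u p v).trans (add_le_add le_rfl (htri p q v))
    _ ≤ ENNReal.ofReal (p - u) * c +
          (ℓ i + (ENNReal.ofReal (v - q) * c + ∑ j ∈ S.erase i, ℓ j)) :=
        add_le_add (hstraight u p hp.1 hup) (add_le_add (hjump i p hpi q hqi) hrest)
    _ = (ENNReal.ofReal (p - u) + ENNReal.ofReal (v - q)) * c +
          (ℓ i + ∑ j ∈ S.erase i, ℓ j) := by ring
    _ ≤ ENNReal.ofReal (v - u) * c + ∑ j ∈ S, ℓ j := by
        rw [Finset.add_sum_erase S ℓ hi]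
        gcongr

theorem chemDist_le {E : Set Plane} {c : ℝ → Plane} (hc : ContinuousOn c (Icc 0 1))
    (hE : MapsTo c (Icc 0 1) E) : chemDist E (c 0) (c 1) ≤ eVariationOn c (Icc 0 1) :=
  iInf₂_le c ⟨hc, rfl, rfl, hE⟩

/-- The chemical distance between two points of a path is at most its length. -/
theorem chemDist_le_eVariationOn {E : Set Plane} {c : ℝ → Plane} {s : Set ℝ} (hs : s.OrdConnected)
    (hc : ContinuousOn c s) (hE : MapsTo c s E) {a b : ℝ} (ha : a ∈ s) (hb : b ∈ s) :
    chemDist E (c a) (c b) ≤ eVariationOn c s := by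
  have hmaps : MapsTo (AffineMap.lineMap a b : ℝ → ℝ) (Icc 0 1) s := fun t ht =>
    hs.uIcc_subset ha hb (segment_eq_uIcc a b ▸ lineMap_mem_segment ℝ a b ht)
  have hcont : Continuous (AffineMap.lineMap a b : ℝ → ℝ) := AffineMap.lineMap_continuous
  have h := chemDist_le (E := E) (hc.comp hcont.continuousOn hmaps) (hE.comp hmaps)
  simp only [Function.comp_apply, AffineMap.lineMap_apply_zero, AffineMap.lineMap_apply_one] at h
  refine h.trans ?_
  rcases le_total a b with hab | hab
  · exact eVariationOn.comp_le_of_monotoneOn c _ ((AffineMap.lineMap_mono hab).monotoneOn _) hmaps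
  · exact eVariationOn.comp_le_of_antitoneOn c _ ((AffineMap.lineMap_anti hab).antitoneOn _) hmaps

theorem chemDist_triangle (E : Set Plane) (x y z : Plane) :
    chemDist E x z ≤ chemDist E x y + chemDist E y z := by
  simp only [chemDist, ENNReal.iInf_add, ENNReal.add_iInf]
  refine le_iInf₂ fun c₂ ⟨hc₂, hy₂, hz, hE₂⟩ => le_iInf₂ fun c₁ ⟨hc₁, hx, hy₁, hE₁⟩ => ?_
  set c : ℝ → Plane := fun t => if t ≤ 1 then c₁ t else c₂ (t - 1) with hcdef
  have hsub : MapsTo (fun t : ℝ => t - 1) (Icc 1 2) (Icc 0 1) := fun t ht =>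
    ⟨by linarith [ht.1], by linarith [ht.2]⟩
  have e₁ : EqOn c c₁ (Icc 0 1) := fun t ht => if_pos ht.2
  have e₂ : EqOn c (c₂ ∘ fun t => t - 1) (Icc 1 2) := fun t ht => by
    rcases ht.1.eq_or_lt with rfl | h
    · simp [hcdef, hy₁, hy₂]
    · exact if_neg h.not_ge
  have hU : Icc (0 : ℝ) 1 ∪ Icc 1 2 = Icc 0 2 :=
    Icc_union_Icc_eq_Icc zero_le_one one_le_two
  have hcont : ContinuousOn c (Icc 0 2) := by
    rw [← hU]
    exact (hc₁.congr e₁).union_of_isClosed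
      ((hc₂.comp (by fun_prop) hsub).congr e₂) isClosed_Icc isClosed_Icc
  have hmaps : MapsTo c (Icc 0 2) E := by
    rw [← hU]
    exact (hE₁.congr e₁.symm).union ((hE₂.comp hsub).congr e₂.symm)
  have h := chemDist_le_eVariationOn ordConnected_Icc hcont hmaps
    (a := 0) (b := 2) (by norm_num) (by norm_num)
  have h0 : c 0 = x := by simp [hcdef, hx]
  have h2 : c 2 = z := by norm_num [hcdef, hz]
  rw [h0, h2, ← hU, eVariationOn.union c (isGreatest_Icc zero_le_one) (isLeast_Icc one_le_two),
    eVariationOn.congr e₁, eVariationOn.congr e₂] at h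
  refine h.trans (add_le_add le_rfl ?_)
  exact eVariationOn.comp_le_of_monotoneOn c₂ _ (fun a _ b _ hab => sub_le_sub_right hab 1) hsub

/-- A subsegment of a line inside `E` bounds the chemical distance of its ends. -/
theorem chemDist_lineMap_le {E : Set Plane} (x y : Plane) {a b : ℝ} (hab : a ≤ b)
    (hE : MapsTo (AffineMap.lineMap x y : ℝ → Plane) (Icc a b) E) :
    chemDist E (AffineMap.lineMap x y a) (AffineMap.lineMap x y b) ≤
      ENNReal.ofReal (b - a) * edist x y := by
  have hcont : Continuous (AffineMap.lineMap x y : ℝ → Plane) := AffineMap.lineMap_continuous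
  have hlip : LipschitzWith (nndist x y) (AffineMap.lineMap x y : ℝ → Plane) :=
    lipschitzWith_lineMap x y
  calc _ ≤ eVariationOn (AffineMap.lineMap x y : ℝ → Plane) (Icc a b) :=
        chemDist_le_eVariationOn ordConnected_Icc hcont.continuousOn hE
          (left_mem_Icc.mpr hab) (right_mem_Icc.mpr hab)
    _ ≤ nndist x y * eVariationOn id (Icc a b) :=
        (hlip.lipschitzOnWith (s := univ)).comp_eVariationOn_le (mapsTo_univ id _)
    _ = ENNReal.ofReal (b - a) * edist x y := by
        rw [eVariationOn_id_Icc, edist_nndist, mul_comm]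

/-- A line meeting a bounded set meets its frontier. -/
theorem Bornology.IsBounded.exists_add_smul_mem_frontier {E : Type*} [NormedAddCommGroup E]
    [NormedSpace ℝ E] {C : Set E} (hC : Bornology.IsBounded C) {z w : E} (hz : z ∈ C)
    (hw : w ≠ 0) : ∃ r : ℝ, z + r • w ∈ frontier C := by
  have hcont : Continuous fun r : ℝ => z + r • w := by fun_prop
  obtain ⟨R, hR⟩ := hC.exists_norm_le
  obtain ⟨r, hr⟩ : (frontier ((fun r : ℝ => z + r • w) ⁻¹' C)).Nonempty := by
    refine nonempty_frontier_iff.mpr ⟨⟨0, by simpa using hz⟩, fun h => ?_⟩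
    have hmem : z + ((R + ‖z‖ + 1) / ‖w‖) • w ∈ C :=
      eq_univ_iff_forall.mp h _
    have hw' : 0 < ‖w‖ := norm_pos_iff.mpr hw
    have hR₀ : 0 ≤ R := (norm_nonneg z).trans (hR z hz)
    have h₁ : ‖((R + ‖z‖ + 1) / ‖w‖) • w‖ = R + ‖z‖ + 1 := by
      rw [norm_smul, Real.norm_of_nonneg (by positivity)]
      field_simp
    have h₂ := norm_sub_le (z + ((R + ‖z‖ + 1) / ‖w‖) • w) z
    rw [add_sub_cancel_left, h₁] at h₂
    linarith [hR _ hmem]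
  exact ⟨r, hcont.frontier_preimage_subset C hr⟩

/-- Two points of a bounded connected planar set are no farther apart than the total length of
curves covering its frontier. -/
theorem edist_le_sum_eVariationOn {ι : Type*} [Fintype ι] {C : Set Plane}
    (hb : Bornology.IsBounded C) (hC : IsPreconnected C) {γ : ι → ℝ → Plane} {s : Set ℝ}
    (hfront : frontier C ⊆ ⋃ i, γ i '' s) {x y : Plane} (hx : x ∈ C) (hy : y ∈ C) :
    edist x y ≤ ∑ i, eVariationOn (γ i) s := by
  obtain ⟨w, hw, hwo⟩ : ∃ w : Plane, w ≠ 0 ∧ inner ℝ (y - x) w = 0 := by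
    by_cases h : y - x = 0
    · obtain ⟨w, hw⟩ := exists_ne (0 : Plane)
      exact ⟨w, hw, by rw [h, inner_zero_left]⟩
    · refine ⟨!₂[-(y - x) 1, (y - x) 0], fun h' => h ?_, ?_⟩
      · ext i
        have h0 := congrArg (fun v : Plane => v 0) h'
        have h1 := congrArg (fun v : Plane => v 1) h'
        fin_cases i <;> simp at h0 h1 ⊢ <;> linarith
      · simp [PiLp.inner_apply, Fin.sum_univ_two]
        ring
  set u : Plane := ‖y - x‖⁻¹ • (y - x) with hu
  have hnu : ‖u‖ ≤ 1 := by
    rw [hu, norm_smul, norm_inv, norm_norm]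
    exact inv_mul_le_one
  have huw : inner ℝ u w = 0 := by rw [hu, real_inner_smul_left, hwo, mul_zero]
  set φ : Plane → ℝ := fun z => inner ℝ u z with hφ
  have hφcont : Continuous φ := by fun_prop
  have hφlip : LipschitzWith 1 φ := LipschitzWith.of_dist_le_mul fun p q => by
    rw [Real.dist_eq, hφ, ← inner_sub_right, dist_eq_norm]
    refine (abs_real_inner_le_norm u (p - q)).trans ?_
    gcongr
    exact hnu
  have hφxy : φ y - φ x = ‖y - x‖ := by
    simp only [hφ]
    rw [← inner_sub_right, hu, real_inner_smul_left, real_inner_self_eq_norm_sq]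
    by_cases h : ‖y - x‖ = 0
    · simp [h]
    · field_simp
  have hcover : Icc (φ x) (φ y) ⊆ ⋃ i, φ '' (γ i '' s) := by
    intro t ht
    obtain ⟨z, hz, rfl⟩ := hC.intermediate_value hx hy hφcont.continuousOn ht
    obtain ⟨r, hr⟩ := hb.exists_add_smul_mem_frontier hz hw
    obtain ⟨i, hi⟩ := mem_iUnion.mp (hfront hr)
    refine mem_iUnion.mpr ⟨i, _, hi, ?_⟩
    simp [hφ, inner_add_right, real_inner_smul_right, huw]
  calc edist x y = MeasureTheory.volume (Icc (φ x) (φ y)) := by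
        rw [Real.volume_Icc, hφxy, edist_comm, edist_dist, dist_eq_norm]
    _ ≤ MeasureTheory.volume (⋃ i, φ '' (γ i '' s)) := MeasureTheory.measure_mono hcover
    _ ≤ ∑ i, MeasureTheory.volume (φ '' (γ i '' s)) := MeasureTheory.measure_iUnion_fintype_le _ _
    _ ≤ ∑ i, eVariationOn (γ i) s := by
        refine Finset.sum_le_sum fun i _ => (Real.volume_le_diam _).trans ?_
        refine Metric.ediam_image_le_iff.mpr ?_
        rintro _ ⟨a, ha, rfl⟩ _ ⟨b, hb, rfl⟩
        refine (hφlip (γ i a) (γ i b)).trans ?_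
        simpa using eVariationOn.edist_le (γ i) ha hb

theorem chemical_diameter_le_twice_boundary_length
    (C : Set Plane) (hne : C.Nonempty) (hcomp : IsCompact C)
    (hpc : IsPathConnected C) (hcl : C = closure (interior C))
    (n : ℕ) (γ : Fin n → ℝ → Plane)
    (hjordan : ∀ i, IsRectifiableJordanLoop (γ i))
    (hdisj : ∀ i j, i ≠ j → Disjoint (γ i '' Set.Icc 0 1) (γ j '' Set.Icc 0 1))
    (hfront : frontier C = ⋃ i, γ i '' Set.Icc 0 1) :
    diamChem C ≤ 2 * ∑ i, eVariationOn (γ i) (Set.Icc 0 1) := by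
  have hconn : IsPreconnected C := hpc.isConnected.isPreconnected
  have himg : ∀ i, IsClosed (γ i '' Icc 0 1) := fun i =>
    (isCompact_Icc.image_of_continuousOn (hjordan i).1).isClosed
  have hsub : ∀ i, γ i '' Icc 0 1 ⊆ C := fun i =>
    (subset_iUnion (fun i => γ i '' Icc 0 1) i).trans
      (hfront ▸ hcomp.isClosed.frontier_subset)
  refine iSup₂_le fun x hx => iSup₂_le fun y hy => ?_
  set σ : ℝ → Plane := fun t => AffineMap.lineMap x y t with hσ
  have hσc : Continuous σ := AffineMap.lineMap_continuous
  have hpath : chemDist C (σ 0) (σ 1) ≤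
      ENNReal.ofReal (1 - 0) * edist x y + ∑ i, eVariationOn (γ i) (Icc 0 1) := by
    refine cost_le_of_gaps (D := fun a b => chemDist C (σ a) (σ b)) (G := σ ⁻¹' C)
      (K := fun i => σ ⁻¹' (γ i '' Icc 0 1)) (hcomp.isClosed.preimage hσc)
      (fun i => (himg i).preimage hσc) (fun i => preimage_mono (hsub i))
      (fun a b d => chemDist_triangle C _ _ _) (fun a b hab h => chemDist_lineMap_le x y hab h)
      ?_ Finset.univ zero_le_one (by simpa [hσ] using hx) (by simpa [hσ] using hy) ?_
    · rintro i a ⟨s, hs, hsa⟩ b ⟨t, ht, htb⟩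
      simp only [← hsa, ← htb]
      exact chemDist_le_eVariationOn ordConnected_Icc (hjordan i).1
        (fun r hr => hsub i (mem_image_of_mem _ hr)) hs ht
    · intro a ha b hb _ hab _ hgap
      have hcl' : σ '' Icc a b ⊆ closure Cᶜ := by
        rw [← closure_Ioo hab.ne]
        refine (image_closure_subset_closure_image hσc).trans (closure_mono ?_)
        rintro _ ⟨t, ht, rfl⟩
        exact hgap t ht
      have hmem : ∀ t ∈ Icc a b, σ t ∈ C → σ t ∈ ⋃ i, γ i '' Icc 0 1 := fun t ht htC => by
        rw [← hfront, frontier_eq_closure_inter_closure]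
        exact ⟨subset_closure htC, hcl' (mem_image_of_mem σ ht)⟩
      obtain ⟨i, hi⟩ := mem_iUnion.mp (hmem a (left_mem_Icc.mpr hab.le) ha)
      obtain ⟨j, hj⟩ := mem_iUnion.mp (hmem b (right_mem_Icc.mpr hab.le) hb)
      refine ⟨i, Finset.mem_univ i, hi, ?_⟩
      by_contra hbi
      have hij : j ≠ i := by
        rintro rfl
        exact hbi hj
      refine hconn.not_joins_frontier_pieces (A := σ '' Icc a b) (a := σ a) (b := σ b)
        (F₁ := γ i '' Icc 0 1) (F₂ := ⋃ k : {k // k ≠ i}, γ k '' Icc 0 1) (himg i)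
        (isClosed_iUnion_of_finite fun k => himg k)
        (disjoint_iUnion_right.mpr fun k => hdisj i k k.2.symm) ?_
        (isPreconnected_Icc.image σ hσc.continuousOn) hcl'
        ⟨⟨mem_image_of_mem σ (left_mem_Icc.mpr hab.le), ha⟩, hi⟩
        ⟨⟨mem_image_of_mem σ (right_mem_Icc.mpr hab.le), hb⟩, mem_iUnion.mpr ⟨⟨j, hij⟩, hj⟩⟩
      rw [hfront]
      refine iUnion_subset fun k => ?_
      by_cases hk : k = i
      · exact hk ▸ subset_union_left
      · exact (subset_iUnion (fun k : {k // k ≠ i} => γ k '' Icc 0 1) ⟨k, hk⟩).trans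
          subset_union_right
  have hxy := edist_le_sum_eVariationOn hcomp.isBounded hconn hfront.subset hx hy
  simp only [hσ, AffineMap.lineMap_apply_zero, AffineMap.lineMap_apply_one, sub_zero,
    ENNReal.ofReal_one, one_mul] at hpath
  rw [two_mul]
  exact hpath.trans (add_le_add hxy le_rfl)
end
end
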